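/- arXiv:1912.03532 — 4 statements merged into one kernel-verified Lean document; each statement's English description precedes it below -/
import Mathlib

section
/- Let n ≥ 2, let θ ∈ (0,1], let ν be a finite Borel measure on ℝⁿ, and let K ∈ [0,∞). Suppose that for every nonnegative compactly supported Lipschitz function v : ℝⁿ → ℝ one has sup_{ρ>0} ρ·ν({x ∈ ℝⁿ : v(x) ≥ ρ})^θ ≤ K ∫_{ℝⁿ} |∇v(x)| dx, where ∇v denotes the (almost everywhere defined) gradient of v. Then there exists a constant C depending only on θ such that ∫₀^∞ ν({x ∈ ℝⁿ : u(x) > λ})^θ dλ ≤ C·K·∫_{ℝⁿ} |∇u(x)| dx for every nonnegative compactly supported Lipschitz function u : ℝⁿ → ℝ. (This is Maz'ya's truncation principle: a weak-type gradient estimate with exponent 1/θ self-improves to the corresponding Lorentz L^{1/θ,1} estimate.) -/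
open MeasureTheory Set
open scoped ENNReal NNReal

/-- The slice of `u` between the levels `t` and `2 * t`, shifted down to start at `0`. -/
noncomputable def levelSlice {E : Type*} (u : E → ℝ) (t : ℝ) (x : E) : ℝ :=
  min (max (u x - t) 0) t

section LevelSlice

variable {E : Type*} {u : E → ℝ} {t : ℝ}

lemma levelSlice_nonneg (ht : 0 ≤ t) (x : E) : 0 ≤ levelSlice u t x :=
  le_min (le_max_right _ _) ht

lemma levelSlice_le (x : E) : levelSlice u t x ≤ t :=
  min_le_right _ _

lemma levelSlice_eq_zero (ht : 0 ≤ t) {x : E} (hx : u x ≤ t) : levelSlice u t x = 0 := by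
  rw [levelSlice, max_eq_right (by linarith), min_eq_left ht]

lemma levelSlice_eq_top (ht : 0 ≤ t) {x : E} (hx : 2 * t ≤ u x) : levelSlice u t x = t := by
  rw [levelSlice, max_eq_left (by linarith), min_eq_right (by linarith)]

lemma levelSlice_eq_sub {x : E} (hx : u x ∈ Ioo t (2 * t)) : levelSlice u t x = u x - t := by
  rw [levelSlice, max_eq_left (by linarith [hx.1]), min_eq_left (by linarith [hx.2])]

lemma LipschitzWith.levelSlice [PseudoEMetricSpace E] {L : ℝ≥0} (hu : LipschitzWith L u) :
    LipschitzWith L (levelSlice u t) := by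
  have h : LipschitzWith L fun x => u x - t := by
    simpa using hu.sub (LipschitzWith.const t)
  exact (h.max_const 0).min_const t

lemma HasCompactSupport.levelSlice [TopologicalSpace E] (hu : HasCompactSupport u) (ht : 0 ≤ t) :
    HasCompactSupport (levelSlice u t) :=
  hu.mono fun _ hx h0 => hx (levelSlice_eq_zero ht (h0.trans_le ht))

lemma enorm_fderiv_levelSlice_le [NormedAddCommGroup E] [NormedSpace ℝ E] (hu : Continuous u)
    (ht : 0 ≤ t) (x : E) :
    ‖fderiv ℝ (levelSlice u t) x‖ₑ ≤
      (u ⁻¹' Ioo t (2 * t)).indicator (fun y => ‖fderiv ℝ u y‖ₑ) x := by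
  by_cases hx : u x ∈ Ioo t (2 * t)
  · have heq : levelSlice u t =ᶠ[nhds x] fun y => u y - t := by
      filter_upwards [(isOpen_Ioo.preimage hu).mem_nhds hx] with y hy using levelSlice_eq_sub hy
    rw [heq.fderiv_eq, fderiv_sub_const, indicator_of_mem (show x ∈ u ⁻¹' Ioo t (2 * t) from hx)]
  · have hext : IsLocalExtr (levelSlice u t) x := by
      rcases le_or_gt (u x) t with h | h
      · refine Or.inl (Filter.Eventually.of_forall fun y => ?_)
        rw [levelSlice_eq_zero ht h]
        exact levelSlice_nonneg ht y
      · refine Or.inr (Filter.Eventually.of_forall fun y => ?_)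
        rw [levelSlice_eq_top ht (not_lt.1 fun h' => hx ⟨h, h'⟩)]
        exact levelSlice_le y
    rw [hext.fderiv_eq_zero]
    exact (enorm_zero (E := E →L[ℝ] ℝ)).trans_le zero_le

end LevelSlice

lemma LipschitzWith.integrable_fderiv {E : Type*} [NormedAddCommGroup E] [NormedSpace ℝ E]
    [FiniteDimensional ℝ E] [MeasurableSpace E] [BorelSpace E] {μ : Measure E}
    [IsFiniteMeasureOnCompacts μ] {u : E → ℝ} {L : ℝ≥0} (hu : LipschitzWith L u)
    (hc : HasCompactSupport u) : Integrable (fderiv ℝ u) μ := by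
  have hm : AEStronglyMeasurable (fderiv ℝ u) μ :=
    (measurable_fderiv ℝ u).aestronglyMeasurable
  have hon : IntegrableOn (fun x => ‖fderiv ℝ u x‖) (tsupport u) μ :=
    Measure.integrableOn_of_bounded (M := L) hc.isCompact.measure_lt_top.ne hm.norm
      (Filter.Eventually.of_forall fun x => by
        simpa using norm_fderiv_le_of_lipschitz ℝ hu)
  have hsupp : Function.support (fun x => ‖fderiv ℝ u x‖) ⊆ tsupport u := fun x hx =>
    support_fderiv_subset ℝ fun h => hx (by simp [h])
  exact (integrable_norm_iff hm).1
    ((integrableOn_iff_integrable_of_support_subset hsupp).1 hon)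

lemma ofReal_integral_norm_le_lintegral_enorm {α F : Type*} [MeasurableSpace α]
    [NormedAddCommGroup F] (μ : Measure α) (f : α → F) :
    ENNReal.ofReal (∫ x, ‖f x‖ ∂μ) ≤ ∫⁻ x, ‖f x‖ₑ ∂μ := by
  refine (Real.ofReal_le_enorm _).trans ((enorm_integral_le_lintegral_enorm _).trans ?_)
  simp

/-- Dyadic upper bound for the layer-cake integral of a non-increasing function. -/
lemma setLIntegral_Ioi_le_tsum_zpow {f : ℝ → ℝ≥0∞} (hf : Antitone f) :
    ∫⁻ s in Ioi (0 : ℝ), f s ≤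
      ∑' k : ℤ, ENNReal.ofReal (2 * 2 ^ k) * f (2 * 2 ^ k) := by
  have hcover : Ioi (0 : ℝ) ⊆ ⋃ k : ℤ, Ico (2 * 2 ^ k : ℝ) (2 * (2 * 2 ^ k)) := by
    intro s hs
    obtain ⟨k, hk₁, hk₂⟩ := exists_mem_Ico_zpow (half_pos (mem_Ioi.1 hs)) one_lt_two
    rw [zpow_add_one₀ two_ne_zero] at hk₂
    exact mem_iUnion.2 ⟨k, by linarith, by linarith⟩
  refine (lintegral_mono_set hcover).trans ((lintegral_iUnion_le _ _).trans ?_)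
  refine ENNReal.tsum_le_tsum fun k => ?_
  calc ∫⁻ s in Ico (2 * 2 ^ k : ℝ) (2 * (2 * 2 ^ k)), f s
      ≤ ∫⁻ _ in Ico (2 * 2 ^ k : ℝ) (2 * (2 * 2 ^ k)), f (2 * 2 ^ k) :=
        setLIntegral_mono measurable_const fun s hs => hf hs.1
    _ = ENNReal.ofReal (2 * 2 ^ k) * f (2 * 2 ^ k) := by
        rw [setLIntegral_const, Real.volume_Ico, mul_comm]
        congr 2
        ring

lemma tsum_setLIntegral_dyadic_preimage_le {α : Type*} [MeasurableSpace α] {μ : Measure α}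
    {u : α → ℝ} (hu : Measurable u) (g : α → ℝ≥0∞) :
    ∑' k : ℤ, ∫⁻ x in u ⁻¹' Ioo ((2 : ℝ) ^ k) (2 * 2 ^ k), g x ∂μ ≤ ∫⁻ x, g x ∂μ := by
  have hmono : Monotone fun k : ℤ => (2 : ℝ) ^ k := zpow_right_mono₀ one_le_two
  have hdisj : Pairwise (Function.onFun Disjoint
      fun k : ℤ => u ⁻¹' Ioo ((2 : ℝ) ^ k) (2 * 2 ^ k)) := by
    intro j k hjk
    have := hmono.pairwise_disjoint_on_Ioo_succ hjk
    simp only [Function.onFun, Order.succ_eq_add_one, zpow_add_one₀ (two_ne_zero' ℝ),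
      mul_comm _ (2 : ℝ)] at this
    exact this.preimage u
  rw [← lintegral_iUnion (fun k => hu measurableSet_Ioo) hdisj]
  exact setLIntegral_le_lintegral _ _

/-- **Maz'ya's truncation principle.** A weak-type gradient estimate with exponent `1/θ`
self-improves to the corresponding Lorentz `L^{1/θ,1}` estimate, with a constant depending
only on `θ`. -/
theorem mazya_truncation (θ : ℝ) (hθ : θ ∈ Set.Ioc (0 : ℝ) 1) :
    ∃ C : ℝ, 0 < C ∧
      ∀ n : ℕ, 2 ≤ n →
      ∀ ν : Measure (EuclideanSpace ℝ (Fin n)), IsFiniteMeasure ν →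
      ∀ K : ℝ, 0 ≤ K →
      (∀ v : EuclideanSpace ℝ (Fin n) → ℝ,
          (∃ L : ℝ≥0, LipschitzWith L v) → HasCompactSupport v → (∀ x, 0 ≤ v x) →
          ∀ ρ : ℝ, 0 < ρ →
            ENNReal.ofReal ρ * (ν {x | ρ ≤ v x}) ^ θ ≤
              ENNReal.ofReal (K * ∫ x, ‖fderiv ℝ v x‖)) →
      ∀ u : EuclideanSpace ℝ (Fin n) → ℝ,
        (∃ L : ℝ≥0, LipschitzWith L u) → HasCompactSupport u → (∀ x, 0 ≤ u x) →
        (∫⁻ lam in Set.Ioi (0 : ℝ), (ν {x | lam < u x}) ^ θ) ≤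
          ENNReal.ofReal (C * K * ∫ x, ‖fderiv ℝ u x‖) := by
  obtain ⟨hθ₀, -⟩ := hθ
  refine ⟨2, two_pos, fun n _ ν _ K hK hweak u ⟨L, hL⟩ hc _ => ?_⟩
  have hslice (k : ℤ) : ENNReal.ofReal (2 ^ k) * ν {x | 2 * 2 ^ k ≤ u x} ^ θ ≤
      ENNReal.ofReal K * ∫⁻ x in u ⁻¹' Ioo ((2 : ℝ) ^ k) (2 * 2 ^ k), ‖fderiv ℝ u x‖ₑ := by
    have ht : (0 : ℝ) < 2 ^ k := by positivity
    calc ENNReal.ofReal (2 ^ k) * ν {x | 2 * 2 ^ k ≤ u x} ^ θ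
        ≤ ENNReal.ofReal (2 ^ k) * ν {x | 2 ^ k ≤ levelSlice u (2 ^ k) x} ^ θ := by
          have hsub : {x | 2 * 2 ^ k ≤ u x} ⊆ {x | 2 ^ k ≤ levelSlice u (2 ^ k) x} :=
            fun x hx => (levelSlice_eq_top ht.le hx).ge
          gcongr ENNReal.ofReal _ * ?_ ^ θ
          exact measure_mono hsub
      _ ≤ ENNReal.ofReal (K * ∫ x, ‖fderiv ℝ (levelSlice u (2 ^ k)) x‖) :=
          hweak _ ⟨L, hL.levelSlice⟩ (hc.levelSlice ht.le) (levelSlice_nonneg ht.le) _ ht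
      _ ≤ ENNReal.ofReal K * ∫⁻ x, ‖fderiv ℝ (levelSlice u (2 ^ k)) x‖ₑ := by
          rw [ENNReal.ofReal_mul hK]
          gcongr
          exact ofReal_integral_norm_le_lintegral_enorm _ _
      _ ≤ _ := by
          rw [← lintegral_indicator (hL.continuous.measurable measurableSet_Ioo)]
          gcongr with x
          exact enorm_fderiv_levelSlice_le hL.continuous ht.le x
  calc ∫⁻ lam in Ioi (0 : ℝ), ν {x | lam < u x} ^ θ
      ≤ ∫⁻ lam in Ioi (0 : ℝ), ν {x | lam ≤ u x} ^ θ := by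
        gcongr with lam x
        exact le_of_lt
    _ ≤ ∑' k : ℤ, ENNReal.ofReal (2 * 2 ^ k) * ν {x | 2 * 2 ^ k ≤ u x} ^ θ := by
        refine setLIntegral_Ioi_le_tsum_zpow (f := fun s => ν {x | s ≤ u x} ^ θ) fun a b hab => ?_
        dsimp only
        gcongr
    _ ≤ ∑' k : ℤ, ENNReal.ofReal (2 * K) *
          ∫⁻ x in u ⁻¹' Ioo ((2 : ℝ) ^ k) (2 * 2 ^ k), ‖fderiv ℝ u x‖ₑ := by
        refine ENNReal.tsum_le_tsum fun k => ?_
        rw [ENNReal.ofReal_mul two_pos.le, ENNReal.ofReal_mul two_pos.le, mul_assoc, mul_assoc]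
        exact mul_le_mul_right (hslice k) _
    _ ≤ ENNReal.ofReal (2 * K) * ∫⁻ x, ‖fderiv ℝ u x‖ₑ := by
        rw [ENNReal.tsum_mul_left]
        gcongr
        exact tsum_setLIntegral_dyadic_preimage_le hL.continuous.measurable _
    _ = ENNReal.ofReal (2 * K * ∫ x, ‖fderiv ℝ u x‖) := by
        rw [ENNReal.ofReal_mul (p := 2 * K) (by positivity),
          ofReal_integral_norm_eq_lintegral_enorm (hL.integrable_fderiv hc)]
end

section
/- Let n ≥ 2, let m ∈ ℕ with 1 ≤ m < n, and let d ∈ [n−m, n]. Let ν be a finite Borel measure on ℝⁿ and set A = sup_{x ∈ ℝⁿ, r > 0} ν(B_r(x))/r^d, assumed finite, where B_r(x) is the open ball of center x and radius r. Then there exists a constant C depending only on n, m, d such that for every u ∈ C_c^∞(ℝⁿ): ∫₀^∞ ν({x ∈ ℝⁿ : |u(x)| > λ})^{(n−m)/d} dλ ≤ C · A^{(n−m)/d} · ∫_{ℝⁿ} |∇^m u(x)| dx. (Equivalently, ‖u‖_{L^{d/(n−m),1}(ℝⁿ,ν)} ≲ A^{(n−m)/d} ‖∇^m u‖_{L¹(ℝⁿ)}.)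 -/
open MeasureTheory Set
open scoped ENNReal NNReal

namespace EndpointTrace

open Metric Module Filter Topology

section

variable {E : Type*} [NormedAddCommGroup E] [NormedSpace ℝ E]

lemma enorm_sub_le_lintegral_fderiv {v : E → ℝ} (hv : ContDiff ℝ 1 v) (x w : E) {T : ℝ}
    (hT : 0 ≤ T) :
    ‖v (x + T • w) - v x‖ₑ ≤ ‖w‖ₑ * ∫⁻ t in Ioc 0 T, ‖fderiv ℝ v (x + t • w)‖ₑ := by
  have hc : Continuous fun t : ℝ => fderiv ℝ v (x + t • w) :=
    (hv.continuous_fderiv one_ne_zero).comp (by fun_prop)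
  have hder : ∀ t : ℝ, HasDerivAt (fun t : ℝ => v (x + t • w)) (fderiv ℝ v (x + t • w) w) t := by
    intro t
    have h1 : HasDerivAt (fun t : ℝ => x + t • w) w t := by
      simpa using ((hasDerivAt_id t).smul_const w).const_add x
    exact ((hv.differentiable one_ne_zero _).hasFDerivAt).comp_hasDerivAt t h1
  have hftc := intervalIntegral.integral_eq_sub_of_hasDerivAt (a := 0) (b := T)
    (fun t _ => hder t) ((hc.clm_apply continuous_const).intervalIntegrable _ _)
  simp only [zero_smul, add_zero] at hftc
  rw [← hftc, intervalIntegral.integral_of_le hT,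
    ← lintegral_const_mul _ hc.enorm.measurable]
  refine (enorm_integral_le_lintegral_enorm _).trans (lintegral_mono fun t => ?_)
  rw [mul_comm]
  exact ContinuousLinearMap.le_opENorm _ _

variable [MeasurableSpace E] [BorelSpace E] [FiniteDimensional ℝ E]
  (μ : Measure E) [μ.IsAddHaarMeasure]

lemma lintegral_comp_add_smul {g : E → ℝ≥0∞} (hg : Measurable g) (a : E) {t : ℝ} (ht : t ≠ 0) :
    ∫⁻ y, g (a + t • y) ∂μ = ENNReal.ofReal |(t ^ finrank ℝ E)⁻¹| * ∫⁻ y, g y ∂μ := by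
  have h := lintegral_map (μ := μ) (f := fun z => g (a + z)) (g := fun y => t • y)
    (hg.comp (measurable_const_add a)) (measurable_const_smul t)
  rw [← h, Measure.map_addHaar_smul μ ht, lintegral_smul_measure, lintegral_add_left_eq_self]
  rfl

lemma lintegral_ball_comp_segment_le {g : E → ℝ≥0∞} (hg : Measurable g) {c : E} {R : ℝ} {x : E}
    (hx : x ∈ ball c R) {t : ℝ} (ht : 1 / 2 ≤ t) (ht1 : t ≤ 1) :
    ∫⁻ y in ball c R, g (x + t • (y - x)) ∂μ ≤ 2 ^ finrank ℝ E * ∫⁻ z in ball c R, g z ∂μ := by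
  have ht0 : 0 < t := by linarith
  calc ∫⁻ y in ball c R, g (x + t • (y - x)) ∂μ
      = ∫⁻ y in ball c R, (ball c R).indicator g ((x - t • x) + t • y) ∂μ := by
        refine setLIntegral_congr_fun measurableSet_ball fun y hy => ?_
        have hmem : x + t • (y - x) ∈ ball c R :=
          (convex_ball c R).add_smul_sub_mem hx hy ⟨ht0.le, ht1⟩
        have heq : (x - t • x) + t • y = x + t • (y - x) := by rw [smul_sub]; abel
        rw [heq, indicator_of_mem hmem]
    _ ≤ ∫⁻ y, (ball c R).indicator g ((x - t • x) + t • y) ∂μ := setLIntegral_le_lintegral _ _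
    _ = ENNReal.ofReal |(t ^ finrank ℝ E)⁻¹| * ∫⁻ z in ball c R, g z ∂μ := by
        rw [lintegral_comp_add_smul μ (hg.indicator measurableSet_ball) _ ht0.ne',
          lintegral_indicator measurableSet_ball]
    _ ≤ 2 ^ finrank ℝ E * ∫⁻ z in ball c R, g z ∂μ := by
        gcongr
        have h2 : (2 : ℝ≥0∞) ^ finrank ℝ E = ENNReal.ofReal (2 ^ finrank ℝ E) := by
          rw [ENNReal.ofReal_pow (by norm_num)]; norm_num
        rw [h2, abs_of_pos (by positivity), ← inv_pow]
        refine ENNReal.ofReal_le_ofReal (pow_le_pow_left₀ (by positivity) ?_ _)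
        rw [inv_le_comm₀ ht0 (by norm_num)]
        linarith

lemma lintegral_ball_ball_comp_segment_le {g : E → ℝ≥0∞} (hg : Measurable g) (c : E) (R : ℝ)
    {t : ℝ} (ht : 0 ≤ t) (ht1 : t ≤ 1) :
    ∫⁻ x in ball c R, ∫⁻ y in ball c R, g (x + t • (y - x)) ∂μ ∂μ ≤
      2 ^ finrank ℝ E * (∫⁻ z in ball c R, g z ∂μ) * μ (ball c R) := by
  rcases le_total (1 / 2) t with h | h
  · rw [← setLIntegral_const]
    exact setLIntegral_mono measurable_const fun x hx =>
      lintegral_ball_comp_segment_le μ hg hx h ht1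
  · have hm : Measurable fun p : E × E => g (p.1 + t • (p.2 - p.1)) := hg.comp (by fun_prop)
    rw [lintegral_lintegral_swap hm.aemeasurable, ← setLIntegral_const]
    refine setLIntegral_mono measurable_const fun y hy => ?_
    refine le_trans (le_of_eq ?_)
      (lintegral_ball_comp_segment_le μ hg hy (t := 1 - t) (by linarith) (by linarith))
    refine lintegral_congr fun x => ?_
    congr 1
    module

lemma lintegral_ball_ball_enorm_sub_le {v : E → ℝ} (hv : ContDiff ℝ 1 v) (c : E) (R : ℝ) :
    ∫⁻ x in ball c R, ∫⁻ y in ball c R, ‖v y - v x‖ₑ ∂μ ∂μ ≤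
      ENNReal.ofReal (2 * R) * (2 ^ finrank ℝ E *
        (∫⁻ z in ball c R, ‖fderiv ℝ v z‖ₑ ∂μ) * μ (ball c R)) := by
  have hg : Measurable fun z => ‖fderiv ℝ v z‖ₑ :=
    (hv.continuous_fderiv one_ne_zero).enorm.measurable
  set g : E → ℝ≥0∞ := fun z => ‖fderiv ℝ v z‖ₑ with hgdef
  calc ∫⁻ x in ball c R, ∫⁻ y in ball c R, ‖v y - v x‖ₑ ∂μ ∂μ
      ≤ ∫⁻ x in ball c R, ∫⁻ y in ball c R,
          ENNReal.ofReal (2 * R) * (∫⁻ t in Ioc (0 : ℝ) 1, g (x + t • (y - x))) ∂μ ∂μ := by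
        refine setLIntegral_mono' measurableSet_ball fun x hx =>
          setLIntegral_mono' measurableSet_ball fun y hy => ?_
        have h := enorm_sub_le_lintegral_fderiv hv x (y - x) zero_le_one
        rw [one_smul, add_sub_cancel] at h
        refine h.trans ?_
        gcongr
        rw [← ofReal_norm, ← dist_eq_norm]
        refine ENNReal.ofReal_le_ofReal ?_
        rw [mem_ball] at hx hy
        linarith [dist_triangle_right y x c]
    _ = ENNReal.ofReal (2 * R) * ∫⁻ t in Ioc (0 : ℝ) 1, ∫⁻ x in ball c R, ∫⁻ y in ball c R,
          g (x + t • (y - x)) ∂μ ∂μ := by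
        have h1 : ∀ x, ∫⁻ y in ball c R, ENNReal.ofReal (2 * R) *
            (∫⁻ t in Ioc (0 : ℝ) 1, g (x + t • (y - x))) ∂μ =
            ENNReal.ofReal (2 * R) * ∫⁻ t in Ioc (0 : ℝ) 1, ∫⁻ y in ball c R,
              g (x + t • (y - x)) ∂μ := by
          intro x
          rw [lintegral_const_mul' _ _ ENNReal.ofReal_ne_top, lintegral_lintegral_swap]
          have hm : Measurable fun p : E × ℝ => g (x + p.2 • (p.1 - x)) := hg.comp (by fun_prop)
          exact hm.aemeasurable
        simp_rw [h1]
        rw [lintegral_const_mul' _ _ ENNReal.ofReal_ne_top, lintegral_lintegral_swap]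
        refine Measurable.aemeasurable ?_
        have : Measurable fun p : (E × ℝ) × E => g (p.1.1 + p.1.2 • (p.2 - p.1.1)) :=
          hg.comp (by fun_prop)
        exact this.lintegral_prod_right'
    _ ≤ ENNReal.ofReal (2 * R) * ∫⁻ _t in Ioc (0 : ℝ) 1, 2 ^ finrank ℝ E *
        (∫⁻ z in ball c R, g z ∂μ) * μ (ball c R) := by
        refine mul_le_mul_right ?_ _
        exact setLIntegral_mono' measurableSet_Ioc fun t ht =>
          lintegral_ball_ball_comp_segment_le μ hg c R ht.1.le ht.2
    _ = _ := by simp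

/-- If `v k` increases to the indicator of `U` from inside, the product of the measures of the two
parts of a ball cut by `U` is controlled by the gradients of `v k` on that ball. -/
lemma measure_diff_mul_measure_inter_le {U : Set E} (hU : MeasurableSet U) {v : ℕ → E → ℝ}
    (hv : ∀ k, ContDiff ℝ 1 (v k)) (hv0 : ∀ k, ∀ x ∉ U, v k x ≤ 0)
    (hv1 : ∀ x ∈ U, ∀ᶠ k in atTop, 1 ≤ v k x) (c : E) (R : ℝ) :
    μ (ball c R \ U) * μ (ball c R ∩ U) ≤ ENNReal.ofReal (2 * R) * (2 ^ finrank ℝ E *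
      liminf (fun k => ∫⁻ z in ball c R, ‖fderiv ℝ (v k) z‖ₑ ∂μ) atTop * μ (ball c R)) := by
  have hm : ∀ k, Measurable fun p : E × E => ‖v k p.2 - v k p.1‖ₑ := fun k =>
    (((hv k).continuous.comp continuous_snd).sub
      ((hv k).continuous.comp continuous_fst)).enorm.measurable
  have hpt : ∀ x ∈ ball c R \ U, μ (ball c R ∩ U) ≤
      liminf (fun k => ∫⁻ y in ball c R, ‖v k y - v k x‖ₑ ∂μ) atTop := by
    intro x hx
    calc μ (ball c R ∩ U) = ∫⁻ _y in ball c R ∩ U, 1 ∂μ := (setLIntegral_one _).symm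
      _ ≤ ∫⁻ y in ball c R ∩ U, liminf (fun k => ‖v k y - v k x‖ₑ) atTop ∂μ := by
        refine setLIntegral_mono' (measurableSet_ball.inter hU) fun y hy => ?_
        refine le_liminf_of_le (by isBoundedDefault) ?_
        filter_upwards [hv1 y hy.2] with k hk
        rw [← ofReal_norm, ← ENNReal.ofReal_one]
        refine ENNReal.ofReal_le_ofReal ((?_ : (1 : ℝ) ≤ _).trans (le_abs_self _))
        linarith [hv0 k x hx.2]
      _ ≤ liminf (fun k => ∫⁻ y in ball c R ∩ U, ‖v k y - v k x‖ₑ ∂μ) atTop :=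
        lintegral_liminf_le fun k => (hm k).comp measurable_prodMk_left
      _ ≤ _ := liminf_le_liminf (Eventually.of_forall fun k =>
        lintegral_mono_set inter_subset_left)
  calc μ (ball c R \ U) * μ (ball c R ∩ U)
      = ∫⁻ _x in ball c R \ U, μ (ball c R ∩ U) ∂μ := by rw [setLIntegral_const, mul_comm]
    _ ≤ ∫⁻ x in ball c R \ U, liminf (fun k => ∫⁻ y in ball c R, ‖v k y - v k x‖ₑ ∂μ) atTop ∂μ :=
      setLIntegral_mono' (measurableSet_ball.diff hU) hpt
    _ ≤ liminf (fun k => ∫⁻ x in ball c R \ U, ∫⁻ y in ball c R, ‖v k y - v k x‖ₑ ∂μ ∂μ) atTop :=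
      lintegral_liminf_le fun k => (hm k).lintegral_prod_right'
    _ ≤ liminf (fun k => (ENNReal.ofReal (2 * R) * (2 ^ finrank ℝ E * μ (ball c R))) *
          ∫⁻ z in ball c R, ‖fderiv ℝ (v k) z‖ₑ ∂μ) atTop := by
      refine liminf_le_liminf (Eventually.of_forall fun k => ?_)
      refine (lintegral_mono_set sdiff_subset).trans
        ((lintegral_ball_ball_enorm_sub_le μ (hv k) c R).trans (le_of_eq ?_))
      ring
    _ = _ := by
      rw [ENNReal.liminf_const_mul_of_ne_top (by finiteness)]
      ring

variable [Nontrivial E]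

lemma exists_lt_measure_ball {M : ℝ≥0∞} (hM : M ≠ ⊤) :
    ∃ R₀ : ℝ, 0 < R₀ ∧ ∀ x R, R₀ ≤ R → M < μ (ball x R) := by
  have hω : μ (ball (0 : E) 1) ≠ 0 := (measure_ball_pos μ _ one_pos).ne'
  have hω' : μ (ball (0 : E) 1) ≠ ⊤ := measure_ball_lt_top.ne
  have hN : finrank ℝ E ≠ 0 := finrank_pos.ne'
  have hfin : M / μ (ball (0 : E) 1) ≠ ⊤ := ENNReal.div_ne_top hM hω
  refine ⟨(M / μ (ball (0 : E) 1)).toReal + 1,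
    add_pos_of_nonneg_of_pos ENNReal.toReal_nonneg one_pos, fun x R hR => ?_⟩
  have h0 : 0 ≤ (M / μ (ball (0 : E) 1)).toReal := ENNReal.toReal_nonneg
  rw [Measure.addHaar_ball μ x (by linarith), ← ENNReal.div_lt_iff (Or.inl hω) (Or.inl hω'),
    ← ENNReal.ofReal_toReal hfin]
  refine (ENNReal.ofReal_lt_ofReal_iff (pow_pos (by linarith) _)).2 ?_
  calc (M / μ (ball (0 : E) 1)).toReal < R := by linarith
    _ ≤ R ^ finrank ℝ E := le_self_pow₀ (by linarith) hN

/-- Around a point of an open set of finite measure there is a ball in which both the set and its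
complement have a definite density. -/
lemma exists_balanced_ball {U : Set E} (hU : IsOpen U) (hμU : μ U ≠ ⊤) {x : E} (hx : x ∈ U) :
    ∃ R : ℝ, 0 < R ∧ μ (ball x R) ≤ 2 ^ (finrank ℝ E + 1) * μ (ball x R ∩ U) ∧
      μ (ball x R) ≤ 2 * μ (ball x R \ U) := by
  obtain ⟨ρ, hρ, hρU⟩ := Metric.isOpen_iff.1 hU x hx
  obtain ⟨R₀, hR₀, hbig⟩ := exists_lt_measure_ball μ (ENNReal.mul_ne_top ENNReal.ofNat_ne_top hμU :
    2 * μ U ≠ ⊤)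
  let P : ℕ → Prop := fun k => μ (ball x (2 ^ k * ρ)) ≤ 2 * μ (ball x (2 ^ k * ρ) ∩ U)
  have hP0 : P 0 := by
    simp only [P, pow_zero, one_mul, inter_eq_left.2 hρU]
    exact le_mul_of_one_le_left zero_le (by norm_num)
  have hPne : ∃ k, ¬ P k := by
    obtain ⟨k, hk⟩ := pow_unbounded_of_one_lt (R₀ / ρ) (one_lt_two : (1 : ℝ) < 2)
    refine ⟨k, not_le.2 (lt_of_le_of_lt ?_ (hbig x _ ((div_lt_iff₀ hρ).1 hk).le))⟩
    gcongr
    exact inter_subset_right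
  obtain ⟨k, hk, hk1⟩ : ∃ k, P k ∧ ¬ P (k + 1) := by
    by_contra! h
    obtain ⟨k, hk⟩ := hPne
    exact hk (Nat.rec hP0 (fun k ih => h k ih) k)
  have hrpos : 0 < (2 : ℝ) ^ k * ρ := by positivity
  have hrad : (2 : ℝ) ^ (k + 1) * ρ = 2 * (2 ^ k * ρ) := by ring
  simp only [P, hrad, not_le] at hk hk1
  set r := (2 : ℝ) ^ k * ρ
  refine ⟨2 * r, by positivity, ?_, ?_⟩
  · have hvol : μ (ball x (2 * r)) = 2 ^ finrank ℝ E * μ (ball x r) := by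
      rw [Measure.addHaar_ball_mul μ x zero_le_two, Measure.addHaar_ball_center μ x,
        ENNReal.ofReal_pow zero_le_two, ENNReal.ofReal_ofNat]
    calc μ (ball x (2 * r)) = 2 ^ finrank ℝ E * μ (ball x r) := hvol
      _ ≤ 2 ^ finrank ℝ E * (2 * μ (ball x r ∩ U)) := by gcongr
      _ ≤ 2 ^ finrank ℝ E * (2 * μ (ball x (2 * r) ∩ U)) := by gcongr; linarith
      _ = _ := by ring
  · have hsplit := measure_inter_add_sdiff (μ := μ) (ball x (2 * r)) hU.measurableSet
    have hfin : μ (ball x (2 * r) ∩ U) ≠ ⊤ := measure_ne_top_of_subset inter_subset_right hμU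
    rw [← hsplit, two_mul (μ (_ ∩ _))] at hk1
    rw [← hsplit, two_mul (μ (_ \ _))]
    exact add_le_add_left ((ENNReal.add_lt_add_iff_left hfin).1 hk1).le _

/-- The constant in the lower bound for the gradient on a balanced ball. -/
noncomputable def gradientConst : ℝ≥0∞ := 2 ^ (2 * finrank ℝ E + 3) / μ (ball (0 : E) 1)

omit [BorelSpace E] [FiniteDimensional ℝ E] [Nontrivial E] in
lemma gradientConst_ne_top : gradientConst μ ≠ ⊤ :=
  ENNReal.div_ne_top (by finiteness) (measure_ball_pos μ _ one_pos).ne'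

lemma rpow_radius_le_of_balanced {U : Set E} (hU : MeasurableSet U) {v : ℕ → E → ℝ}
    (hv : ∀ k, ContDiff ℝ 1 (v k)) (hv0 : ∀ k, ∀ x ∉ U, v k x ≤ 0)
    (hv1 : ∀ x ∈ U, ∀ᶠ k in atTop, 1 ≤ v k x) {c : E} {R : ℝ} (hR : 0 < R)
    (h1 : μ (ball c R) ≤ 2 ^ (finrank ℝ E + 1) * μ (ball c R ∩ U))
    (h2 : μ (ball c R) ≤ 2 * μ (ball c R \ U)) :
    ENNReal.ofReal (R ^ ((finrank ℝ E : ℝ) - 1)) ≤ gradientConst μ *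
      liminf (fun k => ∫⁻ z in ball c R, ‖fderiv ℝ (v k) z‖ₑ ∂μ) atTop := by
  set L := liminf (fun k => ∫⁻ z in ball c R, ‖fderiv ℝ (v k) z‖ₑ ∂μ) atTop
  set N := finrank ℝ E
  have hω : μ (ball (0 : E) 1) ≠ 0 := (measure_ball_pos μ _ one_pos).ne'
  have hω' : μ (ball (0 : E) 1) ≠ ⊤ := measure_ball_lt_top.ne
  have hB : μ (ball c R) ≠ 0 := (measure_ball_pos μ _ hR).ne'
  have hB' : μ (ball c R) ≠ ⊤ := measure_ball_lt_top.ne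
  have hR0 : ENNReal.ofReal R ≠ 0 := (ENNReal.ofReal_pos.2 hR).ne'
  have key : μ (ball c R) * μ (ball c R) ≤
      μ (ball c R) * (ENNReal.ofReal R * (2 ^ (2 * N + 3) * L)) := by
    calc μ (ball c R) * μ (ball c R)
        ≤ (2 * μ (ball c R \ U)) * (2 ^ (N + 1) * μ (ball c R ∩ U)) := mul_le_mul' h2 h1
      _ = 2 ^ (N + 2) * (μ (ball c R \ U) * μ (ball c R ∩ U)) := by ring
      _ ≤ 2 ^ (N + 2) * (ENNReal.ofReal (2 * R) * (2 ^ N * L * μ (ball c R))) := by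
        exact mul_le_mul_right (measure_diff_mul_measure_inter_le μ hU hv hv0 hv1 c R) _
      _ = _ := by
        rw [ENNReal.ofReal_mul zero_le_two, ENNReal.ofReal_ofNat]
        ring
  have key2 := (ENNReal.mul_le_mul_iff_right hB hB').1 key
  have hpow : R ^ N = R * R ^ ((N : ℝ) - 1) := by
    rw [Real.rpow_sub_one hR.ne', Real.rpow_natCast]
    field_simp
  rw [Measure.addHaar_ball μ c hR.le, hpow, ENNReal.ofReal_mul hR.le, mul_assoc] at key2
  have key3 := (ENNReal.mul_le_mul_iff_right hR0 ENNReal.ofReal_ne_top).1 key2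
  rw [← ENNReal.le_div_iff_mul_le (Or.inl hω) (Or.inl hω')] at key3
  refine key3.trans (le_of_eq ?_)
  simp only [gradientConst, div_eq_mul_inv]
  ring

/-- The growth condition `ν (B_r(x)) ≤ A r ^ d` on all balls. -/
def IsFrostman (ν : Measure E) (A : ℝ≥0∞) (d : ℝ) : Prop :=
  ∀ (x : E) (r : ℝ), 0 < r → ν (ball x r) ≤ A * ENNReal.ofReal (r ^ d)

/-- The constant in the boxing inequality. -/
noncomputable def boxingConst : ℝ≥0∞ :=
  ENNReal.ofReal (5 ^ ((finrank ℝ E : ℝ) - 1)) * gradientConst μ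

omit [BorelSpace E] [FiniteDimensional ℝ E] [Nontrivial E] in
lemma boxingConst_ne_top : boxingConst μ ≠ ⊤ :=
  ENNReal.mul_ne_top ENNReal.ofReal_ne_top (gradientConst_ne_top μ)

/-- A form of Gustin's boxing inequality: a measure of codimension one growth is controlled by the
perimeter, which is expressed here by functions approximating the indicator. -/
lemma measure_le_liminf_of_isFrostman {ν : Measure E} {A : ℝ≥0∞}
    (hν : IsFrostman ν A ((finrank ℝ E : ℝ) - 1)) {U : Set E} (hU : IsOpen U) (hμU : μ U ≠ ⊤)
    {v : ℕ → E → ℝ} (hv : ∀ k, ContDiff ℝ 1 (v k)) (hv0 : ∀ k, ∀ x ∉ U, v k x ≤ 0)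
    (hv1 : ∀ x ∈ U, ∀ᶠ k in atTop, 1 ≤ v k x) :
    ν U ≤ A * boxingConst μ * liminf (fun k => ∫⁻ z, ‖fderiv ℝ (v k) z‖ₑ ∂μ) atTop := by
  choose! R hRpos hR1 hR2 using fun x (hx : x ∈ U) => exists_balanced_ball μ hU hμU hx
  obtain ⟨R₀, -, hR₀⟩ := exists_lt_measure_ball μ (M := 2 ^ (finrank ℝ E + 1) * μ U)
    (ENNReal.mul_ne_top (by finiteness) hμU)
  have hRle : ∀ x ∈ U, R x ≤ R₀ := by
    intro x hx
    by_contra! h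
    refine absurd ((hR1 x hx).trans ?_) (not_le.2 (hR₀ x _ h.le))
    gcongr
    exact inter_subset_right
  obtain ⟨s, hsU, hsdisj, hscov⟩ := Vitali.exists_disjoint_subfamily_covering_enlargement_closedBall
    U id R R₀ hRle 4 (by norm_num)
  simp only [id] at hsdisj hscov
  have hdisj : s.PairwiseDisjoint fun x => ball x (R x) :=
    hsdisj.mono fun x => ball_subset_closedBall
  have hcount : s.Countable := hdisj.countable_of_isOpen (fun _ _ => isOpen_ball)
    fun x hx => ⟨x, mem_ball_self (hRpos x (hsU hx))⟩
  have := hcount.to_subtype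
  have hcover : U ⊆ ⋃ b ∈ s, ball b (5 * R b) := by
    intro x hx
    obtain ⟨b, hb, hsub⟩ := hscov x hx
    refine mem_iUnion₂.2 ⟨b, hb, ?_⟩
    refine closedBall_subset_ball ?_ (hsub (mem_closedBall_self (hRpos x hx).le))
    linarith [hRpos b (hsU hb)]
  have hball : ∀ b : s, ν (ball b (5 * R b)) ≤ A * boxingConst μ *
      liminf (fun k => ∫⁻ z in ball (b : E) (R b), ‖fderiv ℝ (v k) z‖ₑ ∂μ) atTop := by
    rintro ⟨b, hb⟩
    have hb0 := hRpos b (hsU hb)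
    refine (hν b (5 * R b) (by positivity)).trans ?_
    rw [Real.mul_rpow (by norm_num) hb0.le, ENNReal.ofReal_mul (by positivity), boxingConst,
      mul_assoc, mul_assoc]
    gcongr
    exact rpow_radius_le_of_balanced μ hU.measurableSet hv hv0 hv1 hb0 (hR1 b (hsU hb))
      (hR2 b (hsU hb))
  calc ν U ≤ ν (⋃ b ∈ s, ball b (5 * R b)) := measure_mono hcover
    _ ≤ ∑' b : s, ν (ball (b : E) (5 * R b)) := measure_biUnion_le ν hcount _
    _ ≤ ∑' b : s, A * boxingConst μ *
        liminf (fun k => ∫⁻ z in ball (b : E) (R b), ‖fderiv ℝ (v k) z‖ₑ ∂μ) atTop :=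
      ENNReal.tsum_le_tsum hball
    _ = A * boxingConst μ * ∫⁻ b : s,
        liminf (fun k => ∫⁻ z in ball (b : E) (R b), ‖fderiv ℝ (v k) z‖ₑ ∂μ) atTop
          ∂Measure.count := by
      rw [ENNReal.tsum_mul_left, lintegral_count]
    _ ≤ A * boxingConst μ * liminf (fun k => ∫⁻ b : s, ∫⁻ z in ball (b : E) (R b),
        ‖fderiv ℝ (v k) z‖ₑ ∂μ ∂Measure.count) atTop := by
      gcongr
      exact lintegral_liminf_le fun _ => measurable_of_countable _
    _ ≤ A * boxingConst μ * liminf (fun k => ∫⁻ z, ‖fderiv ℝ (v k) z‖ₑ ∂μ) atTop := by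
      refine mul_le_mul_right (liminf_le_liminf (Eventually.of_forall fun k => ?_)) _
      rw [lintegral_count,
        ← lintegral_biUnion hcount (fun _ _ => measurableSet_ball) hdisj]
      exact setLIntegral_le_lintegral _ _

lemma lintegral_enorm_deriv_smoothTransition_ne_top :
    ∫⁻ t, ‖deriv Real.smoothTransition t‖ₑ ≠ ⊤ := by
  have hcont : Continuous (deriv Real.smoothTransition) :=
    (Real.smoothTransition.contDiff (n := 1)).continuous_deriv le_rfl
  have hsupp : HasCompactSupport (deriv Real.smoothTransition) := by
    refine HasCompactSupport.intro (isCompact_Icc (a := (0 : ℝ)) (b := 1)) fun t ht => ?_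
    rw [mem_Icc, not_and_or, not_le, not_le] at ht
    rcases ht with ht | ht
    · have : Real.smoothTransition =ᶠ[𝓝 t] fun _ => 0 := by
        filter_upwards [Iio_mem_nhds ht] with y hy
        exact Real.smoothTransition.zero_of_nonpos (le_of_lt hy)
      rw [this.deriv_eq, deriv_const]
    · have : Real.smoothTransition =ᶠ[𝓝 t] fun _ => 1 := by
        filter_upwards [Ioi_mem_nhds ht] with y hy
        exact Real.smoothTransition.one_of_one_le (le_of_lt hy)
      rw [this.deriv_eq, deriv_const]
  exact (hcont.integrable_of_hasCompactSupport hsupp).2.ne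

lemma lintegral_enorm_deriv_smoothTransition_comp (a : ℝ) {b : ℝ} (hb : 0 < b) :
    ∫⁻ s, ‖deriv Real.smoothTransition (b * (a - s)) * b‖ₑ =
      ∫⁻ t, ‖deriv Real.smoothTransition t‖ₑ := by
  have hm : Measurable fun t => ‖deriv Real.smoothTransition t‖ₑ := (measurable_deriv _).enorm
  have h := lintegral_comp_add_smul volume hm (b * a) (neg_ne_zero.2 hb.ne')
  have heq : ∀ s, ‖deriv Real.smoothTransition (b * (a - s)) * b‖ₑ =
      ‖b‖ₑ * ‖deriv Real.smoothTransition (b * a + -b • s)‖ₑ := by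
    intro s
    rw [enorm_mul, mul_comm, smul_eq_mul]
    congr 3
    ring
  simp_rw [heq]
  rw [lintegral_const_mul' _ _ enorm_ne_top, h, ← mul_assoc, finrank_self, pow_one, inv_neg, abs_neg,
    abs_of_pos (inv_pos.2 hb), Real.enorm_eq_ofReal hb.le, ← ENNReal.ofReal_mul hb.le,
    mul_inv_cancel₀ hb.ne', ENNReal.ofReal_one, one_mul]

/-- The constant in the trace inequality for `W^{1,1}`. -/
noncomputable def firstOrderConst : ℝ≥0∞ :=
  boxingConst μ * ∫⁻ t, ‖deriv Real.smoothTransition t‖ₑ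

omit [BorelSpace E] [FiniteDimensional ℝ E] [Nontrivial E] in
lemma firstOrderConst_ne_top : firstOrderConst μ ≠ ⊤ :=
  ENNReal.mul_ne_top (boxingConst_ne_top μ) lintegral_enorm_deriv_smoothTransition_ne_top

lemma lintegral_measure_superlevel_le {ν : Measure E} {A : ℝ≥0∞}
    (hν : IsFrostman ν A ((finrank ℝ E : ℝ) - 1)) {u : E → ℝ} (hu : ContDiff ℝ 1 u)
    (hsupp : HasCompactSupport u) :
    ∫⁻ s in Ioi (0 : ℝ), ν {x | s < u x} ≤
      A * firstOrderConst μ * ∫⁻ z, ‖fderiv ℝ u z‖ₑ ∂μ := by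
  have hσ : ContDiff ℝ 1 Real.smoothTransition := Real.smoothTransition.contDiff
  have hσ' : Continuous (deriv Real.smoothTransition) := hσ.continuous_deriv le_rfl
  have hDu : Continuous (fderiv ℝ u) := hu.continuous_fderiv one_ne_zero
  let v : ℝ → ℕ → E → ℝ := fun s k x => Real.smoothTransition ((k + 1) * (u x - s))
  have hfd : ∀ s k x, ‖fderiv ℝ (v s k) x‖ₑ =
      ‖deriv Real.smoothTransition ((k + 1) * (u x - s)) * (k + 1)‖ₑ * ‖fderiv ℝ u x‖ₑ := by
    intro s k x
    have h1 : HasFDerivAt (fun x => ((k : ℝ) + 1) * (u x - s)) (((k : ℝ) + 1) • fderiv ℝ u x) x :=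
      ((hu.differentiable one_ne_zero x).hasFDerivAt.sub_const s).const_mul _
    have h2 := ((hσ.differentiable one_ne_zero _).hasDerivAt).comp_hasFDerivAt x h1
    have h3 : fderiv ℝ (v s k) x = _ := h2.fderiv
    rw [h3, smul_smul, enorm_smul]
  have hlevel : ∀ s ∈ Ioi (0 : ℝ), ν {x | s < u x} ≤
      A * boxingConst μ * liminf (fun k => ∫⁻ z, ‖fderiv ℝ (v s k) z‖ₑ ∂μ) atTop := by
    intro s hs
    refine measure_le_liminf_of_isFrostman μ hν (isOpen_lt continuous_const hu.continuous) ?_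
      (fun k => hσ.comp (contDiff_const.mul (hu.sub contDiff_const))) (fun k x hx => ?_)
      fun x hx => ?_
    · refine measure_ne_top_of_subset (fun x hx => subset_tsupport u ?_) hsupp.measure_lt_top.ne
      exact (lt_trans hs hx).ne'
    · refine (Real.smoothTransition.zero_of_nonpos ?_).le
      exact mul_nonpos_of_nonneg_of_nonpos (by positivity) (sub_nonpos.2 (not_lt.1 hx))
    · have hx' : 0 < u x - s := sub_pos.2 hx
      obtain ⟨K, hK⟩ := exists_nat_ge (1 / (u x - s))
      filter_upwards [eventually_ge_atTop K] with k hk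
      refine (Real.smoothTransition.one_of_one_le ?_).ge
      rw [div_le_iff₀ hx'] at hK
      have : (K : ℝ) ≤ k := by exact_mod_cast hk
      nlinarith
  have hm : ∀ k : ℕ, Measurable fun p : ℝ × E =>
      ‖deriv Real.smoothTransition ((k + 1) * (u p.2 - p.1)) * (k + 1)‖ₑ *
        ‖fderiv ℝ u p.2‖ₑ := by
    intro k
    have := hu.continuous
    have h1 : Continuous fun p : ℝ × E =>
        deriv Real.smoothTransition ((k + 1) * (u p.2 - p.1)) * (k + 1) := by fun_prop
    exact h1.enorm.measurable.mul (hDu.comp continuous_snd).enorm.measurable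
  calc ∫⁻ s in Ioi (0 : ℝ), ν {x | s < u x}
      ≤ ∫⁻ s in Ioi (0 : ℝ), A * boxingConst μ *
          liminf (fun k => ∫⁻ z, ‖fderiv ℝ (v s k) z‖ₑ ∂μ) atTop :=
        setLIntegral_mono' measurableSet_Ioi hlevel
    _ ≤ ∫⁻ s, A * boxingConst μ * liminf (fun k => ∫⁻ z, ‖fderiv ℝ (v s k) z‖ₑ ∂μ) atTop :=
        setLIntegral_le_lintegral _ _
    _ ≤ A * boxingConst μ *
          liminf (fun k => ∫⁻ s, ∫⁻ z, ‖fderiv ℝ (v s k) z‖ₑ ∂μ) atTop := by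
        simp_rw [hfd]
        rw [lintegral_const_mul _
          (Measurable.liminf fun k => (hm k).lintegral_prod_right')]
        exact mul_le_mul_right (lintegral_liminf_le fun k => (hm k).lintegral_prod_right') _
    _ = A * boxingConst μ * liminf (fun _ : ℕ =>
          (∫⁻ t, ‖deriv Real.smoothTransition t‖ₑ) * ∫⁻ z, ‖fderiv ℝ u z‖ₑ ∂μ) atTop := by
        congr 2
        ext k
        simp_rw [hfd]
        rw [lintegral_lintegral_swap (hm k).aemeasurable,
          ← lintegral_const_mul _ hDu.enorm.measurable]
        refine lintegral_congr fun z => ?_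
        rw [lintegral_mul_const' _ _ enorm_ne_top,
          lintegral_enorm_deriv_smoothTransition_comp _ (by positivity)]
    _ = A * firstOrderConst μ * ∫⁻ z, ‖fderiv ℝ u z‖ₑ ∂μ := by
        rw [liminf_const, firstOrderConst]
        ring

/-- The trace inequality `∫ |u| dν ≲ A ∫ |∇u|` of Meyers and Ziemer. -/
lemma lintegral_enorm_le_of_isFrostman_first_order {ν : Measure E} {A : ℝ≥0∞}
    (hν : IsFrostman ν A ((finrank ℝ E : ℝ) - 1)) {u : E → ℝ} (hu : ContDiff ℝ 1 u)
    (hsupp : HasCompactSupport u) :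
    ∫⁻ x, ‖u x‖ₑ ∂ν ≤ 2 * firstOrderConst μ * A * ∫⁻ z, ‖fderiv ℝ u z‖ₑ ∂μ := by
  have hpos := lintegral_measure_superlevel_le μ hν hu hsupp
  have hneg := lintegral_measure_superlevel_le μ hν (u := -u) hu.neg hsupp.neg
  have hfd : ∀ z, ‖fderiv ℝ (-u) z‖ₑ = ‖fderiv ℝ u z‖ₑ := fun z => by rw [fderiv_neg, enorm_neg]
  simp_rw [hfd] at hneg
  have hmono : Antitone fun s : ℝ => ν {x | s < u x} :=
    fun s t hst => measure_mono fun x hx => lt_of_le_of_lt hst hx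
  calc ∫⁻ x, ‖u x‖ₑ ∂ν = ∫⁻ x, ENNReal.ofReal |u x| ∂ν := by
        simp_rw [← ofReal_norm, Real.norm_eq_abs]
    _ = ∫⁻ s in Ioi (0 : ℝ), ν {x | s < |u x|} :=
        lintegral_eq_lintegral_meas_lt ν (Eventually.of_forall fun x => abs_nonneg _)
          hu.continuous.abs.measurable.aemeasurable
    _ ≤ ∫⁻ s in Ioi (0 : ℝ), (ν {x | s < u x} + ν {x | s < (-u) x}) := by
        refine lintegral_mono fun s => (measure_mono fun x hx => ?_).trans (measure_union_le _ _)
        exact lt_abs.1 (show s < |u x| from hx)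
    _ = (∫⁻ s in Ioi (0 : ℝ), ν {x | s < u x}) + ∫⁻ s in Ioi (0 : ℝ), ν {x | s < (-u) x} :=
        lintegral_add_left hmono.measurable _
    _ ≤ _ := (add_le_add hpos hneg).trans (le_of_eq (by ring))

/-- The average of the measures `ν` transported along all rays `t ↦ x + t • ω`, `‖ω‖ < 1`. -/
noncomputable def raySmoothing (ν : Measure E) : Measure E :=
  ((ν.prod (μ.restrict (ball 0 1))).prod (volume.restrict (Ioi (0 : ℝ)))).map
    fun p => p.1.1 + p.2 • p.1.2

instance (ν : Measure E) [SFinite ν] : SFinite (raySmoothing μ ν) := by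
  unfold raySmoothing
  infer_instance

omit [Nontrivial E] in
lemma lintegral_raySmoothing (ν : Measure E) [SFinite ν] {g : E → ℝ≥0∞} (hg : Measurable g) :
    ∫⁻ z, g z ∂(raySmoothing μ ν) =
      ∫⁻ x, ∫⁻ ω in ball (0 : E) 1, (∫⁻ t in Ioi (0 : ℝ), g (x + t • ω)) ∂μ ∂ν := by
  have hm : Measurable fun p : (E × E) × ℝ => p.1.1 + p.2 • p.1.2 := by fun_prop
  have hgm : Measurable fun p : (E × E) × ℝ => g (p.1.1 + p.2 • p.1.2) := hg.comp hm
  rw [raySmoothing, lintegral_map hg hm, lintegral_prod _ hgm.aemeasurable,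
    lintegral_prod _ hgm.lintegral_prod_right'.aemeasurable]

omit [Nontrivial E] in
lemma lintegral_raySmoothing' (ν : Measure E) [SFinite ν] {g : E → ℝ≥0∞} (hg : Measurable g) :
    ∫⁻ z, g z ∂(raySmoothing μ ν) =
      ∫⁻ t in Ioi (0 : ℝ), ∫⁻ x, ∫⁻ ω in ball (0 : E) 1, g (x + t • ω) ∂μ ∂ν := by
  have hm : Measurable fun p : (E × E) × ℝ => p.1.1 + p.2 • p.1.2 := by fun_prop
  have hgm : Measurable fun p : (E × E) × ℝ => g (p.1.1 + p.2 • p.1.2) := hg.comp hm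
  rw [raySmoothing, lintegral_map hg hm, lintegral_prod_symm' _ hgm]
  refine lintegral_congr fun t => ?_
  have hgt : Measurable fun p : E × E => g (p.1 + t • p.2) := hg.comp (by fun_prop)
  exact lintegral_prod _ hgt.aemeasurable

omit [FiniteDimensional ℝ E] [μ.IsAddHaarMeasure] [Nontrivial E] in
lemma lintegral_ray_near_le [SFinite μ] [SecondCountableTopology E] {ν : Measure E} [SFinite ν]
    {A : ℝ≥0∞} {d : ℝ}
    (hν : IsFrostman ν A d) (y : E) {r : ℝ} (hr : 0 < r) (t : ℝ) :
    ∫⁻ x, ∫⁻ ω in ball (0 : E) 1, (ball y r).indicator 1 (x + t • ω) ∂μ ∂ν ≤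
      A * ENNReal.ofReal (r ^ d) * μ (ball (0 : E) 1) := by
  have hg : Measurable ((ball y r).indicator (1 : E → ℝ≥0∞)) :=
    measurable_one.indicator measurableSet_ball
  have hm : Measurable fun p : E × E => (ball y r).indicator (1 : E → ℝ≥0∞) (p.1 + t • p.2) :=
    hg.comp (by fun_prop)
  rw [lintegral_lintegral_swap hm.aemeasurable, ← setLIntegral_const]
  refine lintegral_mono fun ω => ?_
  have heq : ∀ x, (ball y r).indicator (1 : E → ℝ≥0∞) (x + t • ω) =
      (ball (y - t • ω) r).indicator 1 x := by
    intro x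
    have : x + t • ω ∈ ball y r ↔ x ∈ ball (y - t • ω) r := by
      rw [mem_ball_iff_norm, mem_ball_iff_norm, sub_sub_eq_add_sub]
    by_cases h : x + t • ω ∈ ball y r
    · rw [indicator_of_mem h, indicator_of_mem (this.1 h), Pi.one_apply, Pi.one_apply]
    · rw [indicator_of_notMem h, indicator_of_notMem (mt this.2 h)]
  simp_rw [heq]
  rw [lintegral_indicator_one measurableSet_ball]
  exact hν _ r hr

lemma lintegral_ray_far_le {ν : Measure E} {A : ℝ≥0∞} {d : ℝ} (hν : IsFrostman ν A d) (y : E)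
    {r t : ℝ} (hr : 0 < r) (hrt : r < t) :
    ∫⁻ x, ∫⁻ ω in ball (0 : E) 1, (ball y r).indicator 1 (x + t • ω) ∂μ ∂ν ≤
      A * μ (ball (0 : E) 1) *
        ENNReal.ofReal (r ^ finrank ℝ E * 2 ^ d * t ^ (d - finrank ℝ E)) := by
  have ht : 0 < t := hr.trans hrt
  have hg : Measurable ((ball y r).indicator (1 : E → ℝ≥0∞)) :=
    measurable_one.indicator measurableSet_ball
  set c : ℝ≥0∞ := ENNReal.ofReal |(t ^ finrank ℝ E)⁻¹| * μ (ball y r)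
  have hpt : ∀ x, ∫⁻ ω in ball (0 : E) 1, (ball y r).indicator 1 (x + t • ω) ∂μ ≤
      (ball y (2 * t)).indicator (fun _ => c) x := by
    intro x
    by_cases hx : x ∈ ball y (2 * t)
    · rw [indicator_of_mem hx]
      refine (setLIntegral_le_lintegral _ _).trans ?_
      rw [lintegral_comp_add_smul μ hg x ht.ne', lintegral_indicator_one measurableSet_ball]
    · rw [indicator_of_notMem hx, nonpos_iff_eq_zero, ← lintegral_zero (μ := μ.restrict (ball 0 1))]
      refine setLIntegral_congr_fun measurableSet_ball fun ω hω => ?_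
      refine indicator_of_notMem (fun hmem => hx ?_) _
      rw [mem_ball_iff_norm] at hmem ⊢
      rw [mem_ball_zero_iff] at hω
      have h1 : ‖x - y‖ ≤ ‖x + t • ω - y‖ + ‖t • ω‖ := by
        refine le_trans (le_of_eq ?_) (norm_sub_le _ _)
        congr 1
        abel
      rw [norm_smul, Real.norm_of_nonneg ht.le] at h1
      nlinarith
  refine (lintegral_mono hpt).trans ?_
  rw [lintegral_indicator measurableSet_ball, setLIntegral_const]
  refine (mul_le_mul_right (hν y (2 * t) (by positivity)) _).trans (le_of_eq ?_)
  simp only [c]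
  rw [Measure.addHaar_ball μ y hr.le, abs_of_pos (by positivity)]
  have hpow : r ^ finrank ℝ E * 2 ^ d * t ^ (d - finrank ℝ E) =
      (t ^ finrank ℝ E)⁻¹ * r ^ finrank ℝ E * (2 * t) ^ d := by
    rw [Real.rpow_sub ht, Real.rpow_natCast, Real.mul_rpow zero_le_two ht.le]
    field_simp
  rw [hpow, ENNReal.ofReal_mul (by positivity), ENNReal.ofReal_mul (by positivity)]
  ring

/-- The factor by which `raySmoothing` changes the constant of a Frostman measure. -/
noncomputable def rayConst (d : ℝ) : ℝ≥0∞ :=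
  μ (ball (0 : E) 1) * (1 + ENNReal.ofReal (2 ^ d / (finrank ℝ E - 1 - d)))

omit [BorelSpace E] [Nontrivial E] in
lemma rayConst_ne_top (d : ℝ) : rayConst μ d ≠ ⊤ :=
  ENNReal.mul_ne_top measure_ball_lt_top.ne (by finiteness)

lemma IsFrostman.raySmoothing {ν : Measure E} [SFinite ν] {A : ℝ≥0∞} {d : ℝ}
    (hd : d < finrank ℝ E - 1) (hν : IsFrostman ν A d) :
    IsFrostman (raySmoothing μ ν) (A * rayConst μ d) (d + 1) := by
  intro y r hr
  have hg : Measurable ((ball y r).indicator (1 : E → ℝ≥0∞)) :=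
    measurable_one.indicator measurableSet_ball
  have hexp : d - finrank ℝ E < -1 := by linarith
  have hden : 0 < finrank ℝ E - 1 - d := by linarith
  have hfar : ∫⁻ t in Ioi r, ENNReal.ofReal (r ^ finrank ℝ E * 2 ^ d * t ^ (d - finrank ℝ E)) =
      ENNReal.ofReal (2 ^ d / (finrank ℝ E - 1 - d)) * ENNReal.ofReal (r ^ (d + 1)) := by
    rw [← ofReal_integral_eq_lintegral_ofReal
        ((integrableOn_Ioi_rpow_of_lt hexp hr).const_mul _), integral_const_mul,
      integral_Ioi_rpow_of_lt hexp hr, ← ENNReal.ofReal_mul (by positivity)]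
    · congr 1
      have h1 : d - finrank ℝ E + 1 = (d + 1) - finrank ℝ E := by ring
      have h2 : r ^ (d - finrank ℝ E + 1) = r ^ (d + 1) / r ^ finrank ℝ E := by
        rw [h1, Real.rpow_sub hr, Real.rpow_natCast]
      have h3 : d - finrank ℝ E + 1 = -(finrank ℝ E - 1 - d) := by ring
      rw [h2, h3, neg_div_neg_eq]
      field_simp
    · filter_upwards [ae_restrict_mem measurableSet_Ioi] with t ht
      have : 0 < t := hr.trans ht
      positivity
  rw [← lintegral_indicator_one measurableSet_ball, lintegral_raySmoothing' μ ν hg,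
    ← Ioc_union_Ioi_eq_Ioi hr.le,
    lintegral_union measurableSet_Ioi (Ioc_disjoint_Ioi le_rfl)]
  calc (∫⁻ t in Ioc 0 r, ∫⁻ x, ∫⁻ ω in ball (0 : E) 1,
          (ball y r).indicator 1 (x + t • ω) ∂μ ∂ν) +
        ∫⁻ t in Ioi r, ∫⁻ x, ∫⁻ ω in ball (0 : E) 1, (ball y r).indicator 1 (x + t • ω) ∂μ ∂ν
      ≤ (∫⁻ _t in Ioc 0 r, A * ENNReal.ofReal (r ^ d) * μ (ball (0 : E) 1)) +
        ∫⁻ t in Ioi r, A * μ (ball (0 : E) 1) *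
          ENNReal.ofReal (r ^ finrank ℝ E * 2 ^ d * t ^ (d - finrank ℝ E)) :=
        add_le_add (lintegral_mono fun t => lintegral_ray_near_le μ hν y hr t)
          (setLIntegral_mono' measurableSet_Ioi fun t ht => lintegral_ray_far_le μ hν y hr ht)
    _ = A * ENNReal.ofReal (r ^ d) * μ (ball (0 : E) 1) * ENNReal.ofReal r +
        A * μ (ball (0 : E) 1) * (ENNReal.ofReal (2 ^ d / (finrank ℝ E - 1 - d)) *
          ENNReal.ofReal (r ^ (d + 1))) := by
        rw [setLIntegral_const, Real.volume_Ioc, sub_zero, lintegral_const_mul _ (by fun_prop), hfar]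
    _ = A * rayConst μ d * ENNReal.ofReal (r ^ (d + 1)) := by
        rw [rayConst, Real.rpow_add_one hr.ne', ENNReal.ofReal_mul (by positivity)]
        ring

omit [MeasurableSpace E] [BorelSpace E] [FiniteDimensional ℝ E] [Nontrivial E] in
lemma enorm_le_lintegral_ray {u : E → ℝ} (hu : ContDiff ℝ 1 u) (hsupp : HasCompactSupport u)
    (x : E) {ω : E} (hω : ω ≠ 0) (hω1 : ‖ω‖ < 1) :
    ‖u x‖ₑ ≤ ∫⁻ t in Ioi (0 : ℝ), ‖fderiv ℝ u (x + t • ω)‖ₑ := by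
  obtain ⟨M, hM⟩ := hsupp.isCompact.isBounded.subset_closedBall (0 : E)
  have hω0 : 0 < ‖ω‖ := norm_pos_iff.2 hω
  set T : ℝ := (|M| + ‖x‖ + 1) / ‖ω‖
  have hT : 0 ≤ T := by positivity
  have hTω : ‖T • ω‖ = |M| + ‖x‖ + 1 := by
    rw [norm_smul, Real.norm_of_nonneg hT, div_mul_cancel₀ _ hω0.ne']
  have hzero : u (x + T • ω) = 0 := by
    refine image_eq_zero_of_notMem_tsupport fun hmem => ?_
    have h1 := mem_closedBall_zero_iff.1 (hM hmem)
    have h2 : ‖T • ω‖ ≤ ‖x + T • ω‖ + ‖x‖ := by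
      simpa using norm_sub_le (x + T • ω) x
    linarith [le_abs_self M]
  have h := enorm_sub_le_lintegral_fderiv hu x ω hT
  rw [hzero, zero_sub, enorm_neg] at h
  calc ‖u x‖ₑ ≤ 1 * ∫⁻ t in Ioc 0 T, ‖fderiv ℝ u (x + t • ω)‖ₑ := by
        refine h.trans (mul_le_mul_left ?_ _)
        rw [← ofReal_norm]
        exact ENNReal.ofReal_le_one.2 hω1.le
    _ ≤ _ := by
        rw [one_mul]
        exact lintegral_mono_set Ioc_subset_Ioi_self

lemma measure_ball_mul_lintegral_enorm_le {ν : Measure E} [SFinite ν] {u : E → ℝ}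
    (hu : ContDiff ℝ 1 u) (hsupp : HasCompactSupport u) :
    μ (ball (0 : E) 1) * ∫⁻ x, ‖u x‖ₑ ∂ν ≤ ∫⁻ z, ‖fderiv ℝ u z‖ₑ ∂(raySmoothing μ ν) := by
  rw [lintegral_raySmoothing μ ν (hu.continuous_fderiv one_ne_zero).enorm.measurable,
    ← lintegral_const_mul _ hu.continuous.enorm.measurable]
  refine lintegral_mono fun x => ?_
  rw [mul_comm, ← setLIntegral_const]
  refine lintegral_mono_ae ?_
  filter_upwards [ae_restrict_mem measurableSet_ball,
    ae_restrict_of_ae (μ.ae_ne (0 : E))] with ω hω hω0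
  exact enorm_le_lintegral_ray hu hsupp x hω0 (mem_ball_zero_iff.1 hω)

omit [MeasurableSpace E] [BorelSpace E] [FiniteDimensional ℝ E] [Nontrivial E] in
lemma enorm_iteratedFDeriv_fderiv_apply_le {u : E → ℝ} (hu : ContDiff ℝ (⊤ : ℕ∞) u) (m : ℕ)
    (e x : E) :
    ‖iteratedFDeriv ℝ m (fun y => fderiv ℝ u y e) x‖ₑ ≤
      ‖e‖ₑ * ‖iteratedFDeriv ℝ (m + 1) u x‖ₑ := by
  have hDu : ContDiff ℝ (⊤ : ℕ∞) (fderiv ℝ u) := hu.fderiv_right (by simp)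
  have h := norm_iteratedFDeriv_clm_apply_const (c := e) (n := m) (hDu.contDiffAt (x := x))
    (by exact_mod_cast le_top)
  rw [norm_iteratedFDeriv_fderiv] at h
  rw [← ofReal_norm, ← ofReal_norm, ← ofReal_norm, ← ENNReal.ofReal_mul (norm_nonneg _)]
  exact ENNReal.ofReal_le_ofReal h

omit [MeasurableSpace E] [BorelSpace E] [FiniteDimensional ℝ E] [Nontrivial E] in
lemma exists_enorm_le_mul_sum {ι : Type*} [Fintype ι] (b : Basis ι ℝ E) :
    ∃ K : ℝ≥0∞, K ≠ ⊤ ∧ ∀ L : E →L[ℝ] ℝ, ‖L‖ₑ ≤ K * ∑ i, ‖L (b i)‖ₑ := by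
  refine ⟨ENNReal.ofReal (Fintype.card ι • ‖b.equivFunL.toContinuousLinearMap‖),
    ENNReal.ofReal_ne_top, fun L => ?_⟩
  have h := b.opNorm_le (u := L) (M := ∑ i, ‖L (b i)‖) (by positivity) fun i =>
    Finset.single_le_sum (f := fun i => ‖L (b i)‖) (fun i _ => norm_nonneg _) (Finset.mem_univ i)
  simp_rw [← ofReal_norm]
  rw [← ENNReal.ofReal_sum_of_nonneg fun i _ => norm_nonneg _, ← ENNReal.ofReal_mul (by positivity)]
  exact ENNReal.ofReal_le_ofReal h

/-- The trace inequality `∫ |u| dν ≲ A ∫ |∇^m u|` for measures of codimension `m`. -/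
theorem exists_lintegral_enorm_le_of_isFrostman {m : ℕ} (hm : 1 ≤ m) (hmN : m < finrank ℝ E) :
    ∃ C : ℝ≥0∞, C ≠ ⊤ ∧ ∀ (ν : Measure E) [SFinite ν] (A : ℝ≥0∞),
      IsFrostman ν A ((finrank ℝ E : ℝ) - m) → ∀ u : E → ℝ, ContDiff ℝ (⊤ : ℕ∞) u →
        HasCompactSupport u →
        ∫⁻ x, ‖u x‖ₑ ∂ν ≤ C * A * ∫⁻ x, ‖iteratedFDeriv ℝ m u x‖ₑ ∂μ := by
  induction m, hm using Nat.le_induction with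
  | base =>
    refine ⟨2 * firstOrderConst μ, ENNReal.mul_ne_top (by simp) (firstOrderConst_ne_top μ),
      fun ν _ A hν u hu hsupp => ?_⟩
    rw [Nat.cast_one] at hν
    refine (lintegral_enorm_le_of_isFrostman_first_order μ hν (hu.of_le (by exact_mod_cast le_top))
      hsupp).trans (le_of_eq ?_)
    congr 1
    refine lintegral_congr fun x => ?_
    rw [← ofReal_norm, ← ofReal_norm, norm_iteratedFDeriv_one]
  | succ m hm ih =>
    obtain ⟨C, hC, ihC⟩ := ih (by omega)
    obtain ⟨K, hK, hKb⟩ := exists_enorm_le_mul_sum (finBasis ℝ E)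
    set b := finBasis ℝ E
    set d : ℝ := (finrank ℝ E : ℝ) - (m + 1 : ℕ)
    have hd : d < finrank ℝ E - 1 := by
      have : (1 : ℝ) ≤ m := by exact_mod_cast hm
      simp only [d]
      push_cast
      linarith
    have hω : μ (ball (0 : E) 1) ≠ 0 := (measure_ball_pos μ _ one_pos).ne'
    have hω' : μ (ball (0 : E) 1) ≠ ⊤ := measure_ball_lt_top.ne
    refine ⟨(μ (ball (0 : E) 1))⁻¹ * (K * (C * rayConst μ d * ∑ i, ‖b i‖ₑ)), ?_,
      fun ν _ A hν u hu hsupp => ?_⟩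
    · have hsum : ∑ i, ‖b i‖ₑ ≠ ⊤ := ENNReal.sum_ne_top.2 fun i _ => enorm_ne_top
      exact ENNReal.mul_ne_top (ENNReal.inv_ne_top.2 hω)
        (ENNReal.mul_ne_top hK (ENNReal.mul_ne_top (ENNReal.mul_ne_top hC (rayConst_ne_top μ d)) hsum))
    · have hν' := hν.raySmoothing μ hd
      have hdm : d + 1 = (finrank ℝ E : ℝ) - m := by simp only [d]; push_cast; ring
      rw [hdm] at hν'
      have hu1 : ContDiff ℝ 1 u := hu.of_le (by exact_mod_cast le_top)
      have hDu : ContDiff ℝ (⊤ : ℕ∞) (fderiv ℝ u) := hu.fderiv_right (by simp)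
      have hpart : ∀ i, ∫⁻ z, ‖fderiv ℝ u z (b i)‖ₑ ∂(raySmoothing μ ν) ≤
          C * (A * rayConst μ d) * (‖b i‖ₑ * ∫⁻ x, ‖iteratedFDeriv ℝ (m + 1) u x‖ₑ ∂μ) := by
        intro i
        refine (ihC _ _ hν' (fun z => fderiv ℝ u z (b i)) (hDu.clm_apply contDiff_const)
          (hsupp.fderiv_apply ℝ (b i))).trans ?_
        rw [← lintegral_const_mul' _ _ enorm_ne_top]
        gcongr with x
        exact enorm_iteratedFDeriv_fderiv_apply_le hu m (b i) x
      set I := ∫⁻ x, ‖iteratedFDeriv ℝ (m + 1) u x‖ₑ ∂μ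
      have hmeas : ∀ i, Measurable fun z => ‖fderiv ℝ u z (b i)‖ₑ := fun i =>
        (hDu.continuous.clm_apply continuous_const).enorm.measurable
      have hkey := calc μ (ball (0 : E) 1) * ∫⁻ x, ‖u x‖ₑ ∂ν
          ≤ ∫⁻ z, ‖fderiv ℝ u z‖ₑ ∂(raySmoothing μ ν) :=
            measure_ball_mul_lintegral_enorm_le μ hu1 hsupp
        _ ≤ ∫⁻ z, K * ∑ i, ‖fderiv ℝ u z (b i)‖ₑ ∂(raySmoothing μ ν) :=
            lintegral_mono fun z => hKb _
        _ = K * ∑ i, ∫⁻ z, ‖fderiv ℝ u z (b i)‖ₑ ∂(raySmoothing μ ν) := by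
            rw [lintegral_const_mul' _ _ hK, lintegral_finsetSum _ fun i _ => hmeas i]
        _ ≤ K * ∑ i, C * (A * rayConst μ d) * (‖b i‖ₑ * I) := by
            gcongr with i
            exact hpart i
        _ = K * (C * rayConst μ d * ∑ i, ‖b i‖ₑ) * A * I := by
            rw [← Finset.mul_sum, ← Finset.sum_mul]
            ring
      calc ∫⁻ x, ‖u x‖ₑ ∂ν
          = (μ (ball (0 : E) 1))⁻¹ * (μ (ball (0 : E) 1) * ∫⁻ x, ‖u x‖ₑ ∂ν) := by
            rw [← mul_assoc, ENNReal.inv_mul_cancel hω hω', one_mul]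
        _ ≤ (μ (ball (0 : E) 1))⁻¹ * (K * (C * rayConst μ d * ∑ i, ‖b i‖ₑ) * A * I) := by
            gcongr
        _ = _ := by ring

end

section

variable {α : Type*} [MeasurableSpace α] {ν : Measure α} {f : α → ℝ}

lemma measure_setOf_measure_superlevel_le (hf0 : ∀ x, 0 ≤ f x) (t : ℝ≥0∞) :
    ν {x | ν {y | f x ≤ f y} ≤ t} ≤ t := by
  set S := {x | ν {y | f x ≤ f y} ≤ t}
  rcases S.eq_empty_or_nonempty with hS | hS
  · simp [hS]
  have hbdd : BddBelow (f '' S) := ⟨0, by rintro _ ⟨x, -, rfl⟩; exact hf0 x⟩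
  by_cases hmin : sInf (f '' S) ∈ f '' S
  · obtain ⟨x, hx, hxe⟩ := hmin
    refine (measure_mono fun y hy => ?_).trans hx
    exact hxe.le.trans (csInf_le hbdd (mem_image_of_mem f hy))
  · obtain ⟨a, hanti, hlim, hmem⟩ := exists_seq_tendsto_sInf (hS.image f) hbdd
    have hsub : S ⊆ ⋃ k, {y | a k ≤ f y} := by
      intro y hy
      have hlt : sInf (f '' S) < f y := lt_of_le_of_ne (csInf_le hbdd (mem_image_of_mem f hy))
        fun h => hmin (h ▸ mem_image_of_mem f hy)
      obtain ⟨k, hk⟩ := (hlim.eventually_lt_const hlt).exists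
      exact mem_iUnion.2 ⟨k, hk.le⟩
    have hmono : Monotone fun k => {y | a k ≤ f y} := fun i j hij y hy => (hanti hij).trans hy
    refine (measure_mono hsub).trans ?_
    rw [hmono.measure_iUnion]
    refine iSup_le fun k => ?_
    obtain ⟨x, hx, hxa⟩ := hmem k
    rw [← hxa]
    exact hx

/-- The weight which turns the `L^{1/p,1}` quasinorm of `f` into a weighted `L¹` norm. -/
noncomputable def lorentzWeight (ν : Measure α) (f : α → ℝ) (p : ℝ) (x : α) : ℝ≥0∞ :=
  ν {y | f x ≤ f y} ^ (p - 1)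

lemma measurable_measure_superlevel (hf : Measurable f) :
    Measurable fun x => ν {y | f x ≤ f y} := by
  have : Antitone fun a : ℝ => ν {y | a ≤ f y} :=
    fun a c hac => measure_mono fun y hy => hac.trans hy
  exact this.measurable.comp hf

variable [IsFiniteMeasure ν]

lemma measure_superlevel_rpow_le_lintegral_lorentzWeight (hf : Measurable f) {p : ℝ} (hp : 0 < p)
    (hp1 : p ≤ 1) (a : ℝ) :
    ν {x | a < f x} ^ p ≤ ∫⁻ x in {x | a < f x}, lorentzWeight ν f p x ∂ν := by
  rcases eq_or_ne (ν {x | a < f x}) 0 with h0 | h0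
  · simp [h0, ENNReal.zero_rpow_of_pos hp]
  have hpow : ν {x | a < f x} ^ p = ν {x | a < f x} ^ (p - 1) * ν {x | a < f x} := by
    have h := ENNReal.rpow_add (p - 1) 1 h0 (measure_ne_top _ _)
    rwa [sub_add_cancel, ENNReal.rpow_one] at h
  rw [hpow, ← setLIntegral_const]
  refine setLIntegral_mono' (measurableSet_lt measurable_const hf) fun x hx => ?_
  rw [lorentzWeight, ← neg_sub 1 p, ENNReal.rpow_neg, ENNReal.rpow_neg, ENNReal.inv_le_inv]
  refine ENNReal.rpow_le_rpow (measure_mono fun y hy => ?_) (by linarith)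
  exact lt_of_lt_of_le (mem_ofPred.1 hx) (mem_ofPred.1 hy)

lemma setLIntegral_lorentzWeight_le (hf : Measurable f) (hf0 : ∀ x, 0 ≤ f x) {p : ℝ} (hp : 0 < p)
    (hp1 : p ≤ 1) (B : Set α) :
    ∫⁻ x in B, lorentzWeight ν f p x ∂ν ≤ ENNReal.ofReal (1 / p) * ν B ^ p := by
  rcases hp1.eq_or_lt with rfl | hp1
  · simp [lorentzWeight]
  rcases eq_or_ne (ν B) 0 with hB | hB
  · simp [Measure.restrict_eq_zero.2 hB]
  set s : ℝ := 1 - p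
  have hs : 0 < s := by simp only [s]; linarith
  have hs1 : s < 1 := by simp only [s]; linarith
  set M : ℝ := (ν B).toReal
  have hM : 0 < M := ENNReal.toReal_pos hB (measure_ne_top _ _)
  have hνB : ν B = ENNReal.ofReal M := (ENNReal.ofReal_toReal (measure_ne_top _ _)).symm
  set G : α → ℝ≥0∞ := fun x => ν {y | f x ≤ f y}
  have hG : Measurable G := measurable_measure_superlevel hf
  set h : α → ℝ := fun x => (G x).toReal ^ (-s)
  have hG0 : ∀ᵐ x ∂ν, G x ≠ 0 := by
    rw [ae_iff]
    refine le_antisymm ((measure_mono fun x hx => ?_).trans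
      (measure_setOf_measure_superlevel_le hf0 0)) zero_le
    exact (not_not.1 hx).le
  have hw : ∫⁻ x in B, lorentzWeight ν f p x ∂ν = ∫⁻ x in B, ENNReal.ofReal (h x) ∂ν := by
    refine lintegral_congr_ae (ae_restrict_of_ae ?_)
    filter_upwards [hG0] with x hx
    have hx' : 0 < (G x).toReal := ENNReal.toReal_pos hx (measure_ne_top _ _)
    rw [← ENNReal.ofReal_rpow_of_pos hx', ENNReal.ofReal_toReal (measure_ne_top _ _)]
    simp only [lorentzWeight, s, neg_sub]
  have hlevel : ∀ τ ∈ Ioi (0 : ℝ), ν.restrict B {x | τ < h x} ≤ ENNReal.ofReal (τ ^ (-1 / s)) := by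
    intro τ hτ
    refine (Measure.restrict_apply_le _ _).trans ((measure_mono fun x hx => ?_).trans
      (measure_setOf_measure_superlevel_le hf0 _))
    have hGx : 0 < (G x).toReal := by
      refine lt_of_le_of_ne ENNReal.toReal_nonneg fun h0 => ?_
      have : τ < (G x).toReal ^ (-s) := hx
      rw [← h0, Real.zero_rpow (by linarith)] at this
      exact lt_asymm hτ this
    refine (ENNReal.le_ofReal_iff_toReal_le (measure_ne_top _ _) (Real.rpow_nonneg (le_of_lt hτ) _)).2 ?_
    calc (G x).toReal = ((G x).toReal ^ (-s)) ^ (-1 / s) := by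
          rw [← Real.rpow_mul hGx.le]
          field_simp
          rw [Real.rpow_one]
      _ ≤ τ ^ (-1 / s) := Real.rpow_le_rpow_of_nonpos hτ (le_of_lt hx)
          (div_nonpos_of_nonpos_of_nonneg (by norm_num) hs.le)
  set T : ℝ := M ^ (-s)
  have hT : 0 < T := Real.rpow_pos_of_pos hM _
  have hexp : -1 / s < -1 := by rw [div_lt_iff₀ hs]; linarith
  have htail : ∫⁻ τ in Ioi T, ENNReal.ofReal (τ ^ (-1 / s)) = ENNReal.ofReal (M ^ p * (s / p)) := by
    rw [← ofReal_integral_eq_lintegral_ofReal (integrableOn_Ioi_rpow_of_lt hexp hT),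
      integral_Ioi_rpow_of_lt hexp hT]
    · congr 1
      have h1 : T ^ (-1 / s + 1) = M ^ p := by
        rw [← Real.rpow_mul hM.le]
        congr 1
        field_simp
        simp only [s]
        ring
      have h2 : -1 / s + 1 = -(p / s) := by
        field_simp
        simp only [s]
        ring
      rw [h1, h2, neg_div_neg_eq, div_div_eq_mul_div, mul_div_assoc]
    · filter_upwards [ae_restrict_mem measurableSet_Ioi] with τ hτ
      exact Real.rpow_nonneg (hT.trans hτ).le _
  rw [hw, lintegral_eq_lintegral_meas_lt _
      (Eventually.of_forall fun x => Real.rpow_nonneg ENNReal.toReal_nonneg _)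
      (hG.ennreal_toReal.pow_const _).aemeasurable, ← Ioc_union_Ioi_eq_Ioi hT.le,
    lintegral_union measurableSet_Ioi (Ioc_disjoint_Ioi le_rfl)]
  calc (∫⁻ τ in Ioc 0 T, ν.restrict B {x | τ < h x}) + ∫⁻ τ in Ioi T, ν.restrict B {x | τ < h x}
      ≤ (∫⁻ _τ in Ioc 0 T, ν B) + ∫⁻ τ in Ioi T, ENNReal.ofReal (τ ^ (-1 / s)) := by
        refine add_le_add (lintegral_mono fun τ => ?_)
          (setLIntegral_mono' measurableSet_Ioi fun τ hτ => hlevel τ (hT.trans hτ))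
        exact (measure_mono (subset_univ _)).trans (Measure.restrict_apply_univ B).le
    _ = ENNReal.ofReal (M * T + M ^ p * (s / p)) := by
        rw [htail, setLIntegral_const, Real.volume_Ioc, sub_zero, hνB, ← ENNReal.ofReal_mul hM.le,
          ← ENNReal.ofReal_add (by positivity) (by positivity)]
    _ = ENNReal.ofReal (1 / p) * ν B ^ p := by
        rw [hνB, ENNReal.ofReal_rpow_of_pos hM, ← ENNReal.ofReal_mul (by positivity)]
        congr 1
        have h1 : M * T = M ^ p := by
          rw [mul_comm, ← Real.rpow_add_one hM.ne']
          congr 1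
          simp only [s]
          ring
        rw [h1]
        field_simp
        simp only [s]
        ring

end

end EndpointTrace

open Metric Module EndpointTrace in
/-- **Endpoint trace inequality for `W^{m,1}` with a `d`-Frostman measure, `d ∈ [n-m, n]`.**
If `ν(B_r(x)) ≤ A r^d` for all balls, then the Lorentz `L^{d/(n-m),1}(ν)` norm of `u` is
controlled by the `L¹` norm of `∇^m u`, with a constant depending only on `n, m, d`. -/
theorem endpoint_trace_Wm1 (n m : ℕ) (hn : 2 ≤ n) (hm : 1 ≤ m) (hmn : m < n)
    (d : ℝ) (hd1 : (n : ℝ) - m ≤ d) (hd2 : d ≤ n) :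
    ∃ C : ℝ, 0 < C ∧
      ∀ ν : Measure (EuclideanSpace ℝ (Fin n)), IsFiniteMeasure ν →
      ∀ A : ℝ, 0 ≤ A →
      (∀ (x : EuclideanSpace ℝ (Fin n)) (r : ℝ), 0 < r →
          ν (Metric.ball x r) ≤ ENNReal.ofReal (A * r ^ d)) →
      ∀ u : EuclideanSpace ℝ (Fin n) → ℝ, ContDiff ℝ (⊤ : ℕ∞) u → HasCompactSupport u →
        (∫⁻ lam in Set.Ioi (0 : ℝ), (ν {x | lam < |u x|}) ^ (((n : ℝ) - m) / d)) ≤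
          ENNReal.ofReal
            (C * A ^ (((n : ℝ) - m) / d) * ∫ x, ‖iteratedFDeriv ℝ m u x‖) := by
  have hfin : finrank ℝ (EuclideanSpace ℝ (Fin n)) = n := finrank_euclideanSpace_fin
  have : Nontrivial (EuclideanSpace ℝ (Fin n)) :=
    Module.nontrivial_of_finrank_pos (R := ℝ) (by omega)
  have hcodim : (0 : ℝ) < n - m := sub_pos.2 (by exact_mod_cast hmn)
  have hd : 0 < d := hcodim.trans_le hd1
  set p : ℝ := ((n : ℝ) - m) / d
  have hp : 0 < p := div_pos hcodim hd
  have hp1 : p ≤ 1 := (div_le_one hd).2 hd1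
  have hdp : d * p = n - m := mul_div_cancel₀ _ hd.ne'
  obtain ⟨C, hC, hCb⟩ := exists_lintegral_enorm_le_of_isFrostman
    (volume : Measure (EuclideanSpace ℝ (Fin n))) hm (hmn.trans_eq hfin.symm)
  refine ⟨C.toReal * (1 / p) + 1, by positivity, fun ν _ A hA hν u hu hsupp => ?_⟩
  have hf : Measurable fun x => |u x| := hu.continuous.abs.measurable
  set ν' := ν.withDensity (lorentzWeight ν (fun x => |u x|) p)
  have hFrost : IsFrostman ν' (ENNReal.ofReal (1 / p * A ^ p))
      ((finrank ℝ (EuclideanSpace ℝ (Fin n)) : ℝ) - m) := by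
    intro x r hr
    rw [hfin, withDensity_apply _ measurableSet_ball]
    calc ∫⁻ y in ball x r, lorentzWeight ν (fun x => |u x|) p y ∂ν
        ≤ ENNReal.ofReal (1 / p) * ν (ball x r) ^ p :=
          setLIntegral_lorentzWeight_le hf (fun _ => abs_nonneg _) hp hp1 _
      _ ≤ ENNReal.ofReal (1 / p) * ENNReal.ofReal (A * r ^ d) ^ p := by
          gcongr
          exact hν x r hr
      _ = _ := by
          rw [ENNReal.ofReal_rpow_of_nonneg (by positivity) hp.le,
            Real.mul_rpow hA (by positivity), ← Real.rpow_mul hr.le, hdp,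
            ← ENNReal.ofReal_mul (by positivity), ← ENNReal.ofReal_mul (by positivity), mul_assoc]
  have hint : Integrable (fun x => iteratedFDeriv ℝ m u x) :=
    (hu.continuous_iteratedFDeriv (by exact_mod_cast le_top)).integrable_of_hasCompactSupport
      (hsupp.iteratedFDeriv m)
  calc ∫⁻ lam in Ioi (0 : ℝ), ν {x | lam < |u x|} ^ p
      ≤ ∫⁻ lam in Ioi (0 : ℝ), ν' {x | lam < |u x|} := by
        refine lintegral_mono fun lam => ?_
        rw [withDensity_apply _ (measurableSet_lt measurable_const hf)]
        exact measure_superlevel_rpow_le_lintegral_lorentzWeight hf hp hp1 lam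
    _ = ∫⁻ x, ‖u x‖ₑ ∂ν' := by
        rw [← lintegral_eq_lintegral_meas_lt _ (ae_of_all _ fun _ => abs_nonneg _) hf.aemeasurable]
        refine lintegral_congr fun x => ?_
        rw [← ofReal_norm, Real.norm_eq_abs]
    _ ≤ C * ENNReal.ofReal (1 / p * A ^ p) * ∫⁻ x, ‖iteratedFDeriv ℝ m u x‖ₑ :=
        hCb ν' _ hFrost u hu hsupp
    _ = ENNReal.ofReal (C.toReal * (1 / p * A ^ p) * ∫ x, ‖iteratedFDeriv ℝ m u x‖) := by
        rw [← ofReal_integral_norm_eq_lintegral_enorm hint,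
          ENNReal.ofReal_mul (p := C.toReal * (1 / p * A ^ p)) (by positivity),
          ENNReal.ofReal_mul (p := C.toReal) ENNReal.toReal_nonneg,
          ENNReal.ofReal_toReal hC]
    _ ≤ _ := by
        refine ENNReal.ofReal_le_ofReal (mul_le_mul_of_nonneg_right ?_
          (integral_nonneg fun _ => norm_nonneg _))
        rw [← mul_assoc]
        exact mul_le_mul_of_nonneg_right (le_add_of_nonneg_right zero_le_one) (by positivity)
end

section
/- Let Ω be an open set of finite Lebesgue measure in ℝⁿ, n ≥ 2, let m ∈ ℕ with m < n, and let d ∈ (0, n−m). Let μ be a finite Borel measure on Ω satisfying the d-Frostman condition sup_{x ∈ ℝⁿ, r > 0} μ(B_r(x) ∩ Ω)/r^d < ∞. Then there exists a constant C (depending on n, m, d, Ω and μ) such that for every u ∈ C_c^∞(Ω): (∫_Ω |u|^{(n−d)/m} dμ)^{m/(n−d)} ≤ C · ∫₀^∞ |{x ∈ Ω : |∇^m u(x)| > λ}|^{m/(n−d)} dλ, where |·| denotes Lebesgue measure. (Equivalently, ‖u‖_{L^{(n−d)/m}(Ω,μ)} ≲ ‖∇^m u‖_{L^{(n−d)/m,1}(Ω)}.)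 -/
open MeasureTheory Set
open scoped ENNReal NNReal

section PointwiseBound

variable {E : Type*} [NormedAddCommGroup E] [NormedSpace ℝ E]

theorem enorm_iteratedFDeriv_le_lintegral_ray {u : E → ℝ} (hu : ContDiff ℝ (⊤ : ℕ∞) u)
    (hc : HasCompactSupport u) (k : ℕ) (x : E) {ω : E} (hω : ‖ω‖ = 1) (r : ℝ) :
    ‖iteratedFDeriv ℝ k u (x + r • ω)‖ₑ ≤
      ∫⁻ s in Ioi r, ‖iteratedFDeriv ℝ (k + 1) u (x + s • ω)‖ₑ := by
  set f : ℝ → E [×k]→L[ℝ] ℝ := fun s => iteratedFDeriv ℝ k u (x + s • ω)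
  have hD : ContDiff ℝ 1 (iteratedFDeriv ℝ k u) :=
    hu.iteratedFDeriv_right (by exact_mod_cast le_top)
  have hline : ∀ s : ℝ, HasDerivAt (fun s : ℝ => x + s • ω) ω s := fun s => by
    simpa using ((hasDerivAt_id s).smul_const ω).const_add x
  have hderiv : ∀ s, HasDerivAt f (fderiv ℝ (iteratedFDeriv ℝ k u) (x + s • ω) ω) s := fun s =>
    ((hD.differentiable one_ne_zero) _).hasFDerivAt.comp_hasDerivAt s (hline s)
  have hfC : ContDiff ℝ 1 f := hD.comp (by fun_prop)
  have hiso : Isometry (fun s : ℝ => x + s • ω) := by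
    refine Isometry.of_dist_eq fun a b => ?_
    rw [dist_add_left, dist_eq_norm, ← sub_smul, norm_smul, hω, mul_one, Real.dist_eq,
      Real.norm_eq_abs]
  have hfc : HasCompactSupport f :=
    (hc.iteratedFDeriv (𝕜 := ℝ) k).comp_isClosedEmbedding hiso.isClosedEmbedding
  calc ‖f r‖ₑ = ‖∫ s in Ioi r, deriv f s‖ₑ := by
        rw [hfc.integral_Ioi_deriv_eq hfC, enorm_neg]
    _ ≤ ∫⁻ s in Ioi r, ‖deriv f s‖ₑ := enorm_integral_le_lintegral_enorm _
    _ ≤ _ := by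
        refine lintegral_mono fun s => ?_
        rw [(hderiv s).deriv, enorm_le_iff_norm_le, ← norm_fderiv_iteratedFDeriv]
        simpa [hω] using (fderiv ℝ (iteratedFDeriv ℝ k u) (x + s • ω)).le_opNorm ω

theorem enorm_le_lintegral_ray {u : E → ℝ} (hu : ContDiff ℝ (⊤ : ℕ∞) u)
    (hc : HasCompactSupport u) (k : ℕ) (x : E) {ω : E} (hω : ‖ω‖ = 1) :
    ‖u x‖ₑ ≤ ∫⁻ r in Ioi (0 : ℝ),
      ENNReal.ofReal (r ^ k) * ‖iteratedFDeriv ℝ (k + 1) u (x + r • ω)‖ₑ := by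
  have hmeas : ∀ j, Measurable fun s : ℝ => ‖iteratedFDeriv ℝ j u (x + s • ω)‖ₑ := fun j => by
    have : Continuous (iteratedFDeriv ℝ j u) :=
      hu.continuous_iteratedFDeriv (by exact_mod_cast le_top)
    exact (this.comp (by fun_prop)).enorm.measurable
  induction k with
  | zero =>
    have h0 := enorm_iteratedFDeriv_le_lintegral_ray hu hc 0 x hω 0
    have h1 : ‖u x‖ₑ = ‖iteratedFDeriv ℝ 0 u (x + (0 : ℝ) • ω)‖ₑ := by
      rw [← ofReal_norm, ← ofReal_norm, norm_iteratedFDeriv_zero]; simp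
    simpa [h1] using h0
  | succ k ih =>
    refine ih.trans ?_
    set F : ℝ → ℝ≥0∞ := fun s => ‖iteratedFDeriv ℝ (k + 2) u (x + s • ω)‖ₑ
    calc ∫⁻ r in Ioi (0 : ℝ),
          ENNReal.ofReal (r ^ k) * ‖iteratedFDeriv ℝ (k + 1) u (x + r • ω)‖ₑ
        ≤ ∫⁻ r in Ioi (0 : ℝ), ∫⁻ s in Ioi (0 : ℝ),
          (Ioi r).indicator (fun s => ENNReal.ofReal (r ^ k) * F s) s := by
          refine setLIntegral_mono' measurableSet_Ioi fun r (hr : 0 < r) => ?_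
          rw [lintegral_indicator measurableSet_Ioi, Measure.restrict_restrict measurableSet_Ioi,
            inter_eq_left.2 (Ioi_subset_Ioi hr.le), lintegral_const_mul _ (hmeas _)]
          gcongr
          exact enorm_iteratedFDeriv_le_lintegral_ray hu hc (k + 1) x hω r
      _ = ∫⁻ s in Ioi (0 : ℝ), ∫⁻ r in Ioi (0 : ℝ),
          (Ioi r).indicator (fun s => ENNReal.ofReal (r ^ k) * F s) s := by
          refine lintegral_lintegral_swap (Measurable.aemeasurable ?_)
          have : Function.uncurry (fun r s : ℝ =>
              (Ioi r).indicator (fun s => ENNReal.ofReal (r ^ k) * F s) s) =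
              {p : ℝ × ℝ | p.1 < p.2}.indicator
                (fun p => ENNReal.ofReal (p.1 ^ k) * F p.2) := by
            ext ⟨r, s⟩; simp [indicator]
          rw [this]
          refine Measurable.indicator ?_ (measurableSet_lt measurable_fst measurable_snd)
          exact (by fun_prop : Measurable fun p : ℝ × ℝ => ENNReal.ofReal (p.1 ^ k)).mul
            ((hmeas _).comp measurable_snd)
      _ ≤ ∫⁻ s in Ioi (0 : ℝ), ENNReal.ofReal (s ^ (k + 1)) * F s := by
          refine setLIntegral_mono' measurableSet_Ioi fun s (hs : 0 < s) => ?_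
          calc ∫⁻ r in Ioi (0 : ℝ),
                (Ioi r).indicator (fun s => ENNReal.ofReal (r ^ k) * F s) s
              ≤ ∫⁻ r in Ioi (0 : ℝ),
                (Iio s).indicator (fun _ => ENNReal.ofReal (s ^ k) * F s) r := by
                refine setLIntegral_mono' measurableSet_Ioi fun r (hr : 0 < r) => ?_
                by_cases h : r < s
                · rw [indicator_of_mem (mem_Ioi.2 h), indicator_of_mem (mem_Iio.2 h)]
                  gcongr
                · rw [indicator_of_notMem (by simpa using h)]
                  exact zero_le
            _ = _ := by
                rw [lintegral_indicator measurableSet_Iio,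
                  Measure.restrict_restrict measurableSet_Iio, setLIntegral_const,
                  Iio_inter_Ioi, Real.volume_Ioo, sub_zero, pow_succ,
                  ENNReal.ofReal_mul (by positivity)]
                ring

variable [FiniteDimensional ℝ E] [MeasurableSpace E] [BorelSpace E]

theorem lintegral_eq_lintegral_toSphere [Nontrivial E] (ν : Measure E) [ν.IsAddHaarMeasure]
    {f : E → ℝ≥0∞} (hf : Measurable f) :
    ∫⁻ z, f z ∂ν = ∫⁻ ω, (∫⁻ r in Ioi (0 : ℝ),
      ENNReal.ofReal (r ^ (Module.finrank ℝ E - 1)) * f (r • (ω : E))) ∂ν.toSphere := by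
  have hmp := ν.measurePreserving_homeomorphUnitSphereProd
  have hg : Measurable fun p : Metric.sphere (0 : E) 1 × Ioi (0 : ℝ) =>
      f ((p.2 : ℝ) • (p.1 : E)) := hf.comp (by fun_prop)
  calc ∫⁻ z, f z ∂ν = ∫⁻ z in ({0}ᶜ : Set E), f z ∂ν := by
        rw [restrict_compl_singleton]
    _ = ∫⁻ z : ({0}ᶜ : Set E), f z ∂(ν.comap (↑)) :=
        (lintegral_subtype_comap (measurableSet_singleton _).compl f).symm
    _ = ∫⁻ p, f ((p.2 : ℝ) • (p.1 : E))
          ∂(ν.toSphere.prod (.volumeIoiPow (Module.finrank ℝ E - 1))) := by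
        rw [← hmp.lintegral_comp hg]
        refine lintegral_congr fun z => ?_
        have hz : (z : E) ≠ 0 := z.2
        simp [smul_smul, hz]
    _ = ∫⁻ ω, ∫⁻ r : Ioi (0 : ℝ), f ((r : ℝ) • (ω : E))
          ∂(.volumeIoiPow (Module.finrank ℝ E - 1)) ∂ν.toSphere := lintegral_prod _ hg.aemeasurable
    _ = _ := by
        refine lintegral_congr fun ω => ?_
        have hm : Measurable fun r : Ioi (0 : ℝ) => f ((r : ℝ) • (ω : E)) := hf.comp (by fun_prop)
        rw [Measure.volumeIoiPow, lintegral_withDensity_eq_lintegral_mul _ (by fun_prop) hm]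
        exact lintegral_subtype_comap measurableSet_Ioi
          (fun r => ENNReal.ofReal (r ^ (Module.finrank ℝ E - 1)) * f (r • (ω : E)))

/-- The Riesz potential bound of a test function by its derivatives of order `m < dim E`. -/
theorem toSphere_mul_enorm_le_rieszPotential (ν : Measure E) [ν.IsAddHaarMeasure]
    {m : ℕ} (hm : 1 ≤ m) (hmn : m < Module.finrank ℝ E) {u : E → ℝ}
    (hu : ContDiff ℝ (⊤ : ℕ∞) u) (hc : HasCompactSupport u) (x : E) :
    ν.toSphere univ * ‖u x‖ₑ ≤ ∫⁻ y, ENNReal.ofReal ((‖y - x‖ ^ (Module.finrank ℝ E - m))⁻¹) *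
      ‖iteratedFDeriv ℝ m u y‖ₑ ∂ν := by
  have : Nontrivial E := Module.finrank_pos_iff (R := ℝ).1 (by omega)
  have hcont : Continuous (iteratedFDeriv ℝ m u) :=
    hu.continuous_iteratedFDeriv (by exact_mod_cast le_top)
  set n := Module.finrank ℝ E
  have hmeas : Measurable fun z : E => ENNReal.ofReal ((‖z‖ ^ (n - m))⁻¹) *
      ‖iteratedFDeriv ℝ m u (x + z)‖ₑ :=
    (by fun_prop : Measurable fun z : E => ENNReal.ofReal ((‖z‖ ^ (n - m))⁻¹)).mul
      (hcont.comp (by fun_prop)).enorm.measurable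
  calc ν.toSphere univ * ‖u x‖ₑ = ∫⁻ _, ‖u x‖ₑ ∂ν.toSphere := by
        rw [lintegral_const, mul_comm]
    _ ≤ ∫⁻ ω, (∫⁻ r in Ioi (0 : ℝ), ENNReal.ofReal (r ^ (n - 1)) *
          (ENNReal.ofReal ((‖r • (ω : E)‖ ^ (n - m))⁻¹) *
            ‖iteratedFDeriv ℝ m u (x + r • (ω : E))‖ₑ)) ∂ν.toSphere := by
        refine lintegral_mono fun ω => ?_
        have hω : ‖(ω : E)‖ = 1 := by simp
        refine (enorm_le_lintegral_ray hu hc (m - 1) x hω).trans_eq ?_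
        refine setLIntegral_congr_fun measurableSet_Ioi fun r (hr : 0 < r) => ?_
        rw [← mul_assoc, ← ENNReal.ofReal_mul (by positivity), Nat.sub_add_cancel hm, norm_smul, hω,
          mul_one, Real.norm_of_nonneg hr.le]
        congr 2
        rw [show n - 1 = (m - 1) + (n - m) by omega, pow_add, mul_assoc,
          mul_inv_cancel₀ (by positivity), mul_one]
    _ = ∫⁻ z, ENNReal.ofReal ((‖z‖ ^ (n - m))⁻¹) * ‖iteratedFDeriv ℝ m u (x + z)‖ₑ ∂ν :=
        (lintegral_eq_lintegral_toSphere ν hmeas).symm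
    _ = _ := by
        rw [← lintegral_sub_right_eq_self _ x]
        simp

end PointwiseBound

section RestrictedEstimate

variable {E : Type*} [NormedAddCommGroup E] [NormedSpace ℝ E]
  [MeasurableSpace E]

/-- The integral of `r ^ k` over the radii `r > 0` at which the set `S` has `ν`-measure larger than
`s * r ^ dim E` in the ball of center `x` and radius `r`. -/
noncomputable def denseRadiiMoment (ν : Measure E) (S : Set E) (k : ℕ) (s : ℝ) (x : E) : ℝ≥0∞ :=
  ∫⁻ r in Ioi (0 : ℝ),
    {r : ℝ | ENNReal.ofReal (s * r ^ Module.finrank ℝ E) < ν (S ∩ Metric.ball x r)}.indicator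
      (fun r => ENNReal.ofReal (r ^ k)) r

theorem ofReal_inv_pow_le_lintegral {p : ℕ} (hp : 1 ≤ p) {c : ℝ} (hc : 0 ≤ c) :
    ENNReal.ofReal ((c ^ p)⁻¹) ≤ ∫⁻ r in Ioi c, ENNReal.ofReal (p * (r ^ (p + 1))⁻¹) := by
  have hp0 : (0 : ℝ) < p := by exact_mod_cast hp
  rcases hc.eq_or_lt with rfl | hc
  · simp [show p ≠ 0 by omega]
  have hexp : (-((p : ℝ) + 1)) < -1 := by linarith
  have hcongr : EqOn (fun r : ℝ => (p : ℝ) * r ^ (-((p : ℝ) + 1)))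
      (fun r => p * (r ^ (p + 1))⁻¹) (Ioi c) := fun r (hr : c < r) => by
    have hr0 : 0 < r := hc.trans hr
    simp only
    rw [Real.rpow_neg hr0.le, ← Nat.cast_succ, Real.rpow_natCast]
  have hint : IntegrableOn (fun r : ℝ => (p : ℝ) * (r ^ (p + 1))⁻¹) (Ioi c) :=
    IntegrableOn.congr_fun ((integrableOn_Ioi_rpow_of_lt hexp hc).const_mul (p : ℝ)) hcongr
      measurableSet_Ioi
  rw [← ofReal_integral_eq_lintegral_ofReal hint
    ((ae_restrict_mem measurableSet_Ioi).mono fun r hr => by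
      have : 0 < r := hc.trans hr
      simp only [Pi.zero_apply]; positivity),
    ← setIntegral_congr_fun measurableSet_Ioi hcongr, integral_const_mul,
    integral_Ioi_rpow_of_lt hexp hc]
  refine le_of_eq (congrArg _ ?_)
  rw [show -((p : ℝ) + 1) + 1 = -(p : ℝ) by ring, Real.rpow_neg hc.le, Real.rpow_natCast]
  field_simp

theorem denseRadiiMoment_le {ν : Measure E} {S : Set E} {k : ℕ} {s : ℝ} {x : E} {R : ℝ}
    (hR : 0 ≤ R) (h : ∀ r : ℝ, 0 < r →
      ENNReal.ofReal (s * r ^ Module.finrank ℝ E) < ν (S ∩ Metric.ball x r) → r ≤ R) :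
    denseRadiiMoment ν S k s x ≤ ENNReal.ofReal (R ^ (k + 1)) := by
  calc denseRadiiMoment ν S k s x
      ≤ ∫⁻ r in Ioi (0 : ℝ), (Iic R).indicator (fun _ => ENNReal.ofReal (R ^ k)) r := by
        refine setLIntegral_mono' measurableSet_Ioi fun r (hr : 0 < r) => ?_
        by_cases hmem : ENNReal.ofReal (s * r ^ Module.finrank ℝ E) < ν (S ∩ Metric.ball x r)
        · rw [indicator_of_mem (by exact hmem), indicator_of_mem (mem_Iic.2 (h r hr hmem))]
          gcongr
          exact h r hr hmem
        · rw [indicator_of_notMem (by exact hmem)]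
          exact zero_le
    _ = _ := by
        rw [lintegral_indicator measurableSet_Iic, Measure.restrict_restrict measurableSet_Iic,
          setLIntegral_const, Iic_inter_Ioi, Real.volume_Ioc, sub_zero, pow_succ,
          ENNReal.ofReal_mul (by positivity)]

variable [BorelSpace E] [FiniteDimensional ℝ E]

theorem measurable_measure_inter_ball (ν : Measure E) [SFinite ν] {S : Set E}
    (hS : MeasurableSet S) :
    Measurable fun z : E × ℝ => ν (S ∩ Metric.ball z.1 z.2) := by
  have : MeasurableSet {w : (E × ℝ) × E | w.2 ∈ S ∧ dist w.2 w.1.1 < w.1.2} :=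
    (measurable_snd hS).inter (measurableSet_lt
      (measurable_snd.dist measurable_fst.fst) measurable_fst.snd)
  exact measurable_measure_prodMk_left this

theorem measurable_denseRadiiMoment (ν : Measure E) [SFinite ν] {S : Set E}
    (hS : MeasurableSet S) (k : ℕ) :
    Measurable fun z : ℝ × E => denseRadiiMoment ν S k z.1 z.2 := by
  have hset : MeasurableSet {w : (ℝ × E) × ℝ |
      ENNReal.ofReal (w.1.1 * w.2 ^ Module.finrank ℝ E) < ν (S ∩ Metric.ball w.1.2 w.2)} :=
    measurableSet_lt (by fun_prop) ((measurable_measure_inter_ball ν hS).comp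
      (by fun_prop : Measurable fun w : (ℝ × E) × ℝ => (w.1.2, w.2)))
  exact Measurable.lintegral_prod_right' (ν := volume.restrict (Ioi (0 : ℝ)))
    ((by fun_prop : Measurable fun w : (ℝ × E) × ℝ => ENNReal.ofReal (w.2 ^ k)).indicator hset)

theorem rieszPotential_le_lintegral_denseRadiiMoment (ν : Measure E) [ν.IsAddHaarMeasure]
    {S : Set E} (hS : MeasurableSet S) {k p : ℕ} (hp : 1 ≤ p)
    (hkp : k + 1 + p = Module.finrank ℝ E) (x : E) :
    ∫⁻ y in S, ENNReal.ofReal ((‖y - x‖ ^ p)⁻¹) ∂ν ≤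
      p * ∫⁻ s in Ioo 0 (ν.real (Metric.ball 0 1)), denseRadiiMoment ν S k s x := by
  set N := Module.finrank ℝ E
  set W := ν.real (Metric.ball (0 : E) 1) with hW
  have : Nontrivial E := Module.finrank_pos_iff (R := ℝ).1 (by omega)
  set v : ℝ → ℝ≥0∞ := fun r => ν (S ∩ Metric.ball x r)
  have hvm : Measurable v := (measurable_measure_inter_ball ν hS).comp (by fun_prop :
    Measurable fun r : ℝ => (x, r))
  have hvtop : ∀ r, v r ≠ ⊤ := fun r =>
    ((measure_mono inter_subset_right).trans_lt measure_ball_lt_top).ne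
  have hvW : ∀ r, 0 < r → v r ≤ ENNReal.ofReal (r ^ N * W) := fun r hr => by
    refine (measure_mono inter_subset_right).trans_eq ?_
    rw [Measure.addHaar_ball ν x hr.le, ENNReal.ofReal_mul (by positivity), hW, measureReal_def,
      ENNReal.ofReal_toReal measure_ball_lt_top.ne]
  calc ∫⁻ y in S, ENNReal.ofReal ((‖y - x‖ ^ p)⁻¹) ∂ν
      ≤ ∫⁻ y in S, (∫⁻ r in Ioi (0 : ℝ),
          (Metric.ball x r).indicator (fun _ => ENNReal.ofReal (p * (r ^ (p + 1))⁻¹)) y) ∂ν := by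
        refine lintegral_mono fun y => (ofReal_inv_pow_le_lintegral hp (norm_nonneg _)).trans ?_
        rw [← inter_eq_left.2 (Ioi_subset_Ioi (norm_nonneg (y - x))),
          ← Measure.restrict_restrict measurableSet_Ioi, ← lintegral_indicator measurableSet_Ioi]
        refine lintegral_mono fun r => le_of_eq ?_
        simp [indicator, dist_eq_norm]
    _ = ∫⁻ r in Ioi (0 : ℝ), ∫⁻ y in S,
          (Metric.ball x r).indicator (fun _ => ENNReal.ofReal (p * (r ^ (p + 1))⁻¹)) y ∂ν := by
        refine lintegral_lintegral_swap (Measurable.aemeasurable ?_)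
        have hset : MeasurableSet {z : E × ℝ | dist z.1 x < z.2} :=
          measurableSet_lt (by fun_prop) (by fun_prop)
        exact (by fun_prop : Measurable fun z : E × ℝ =>
          ENNReal.ofReal (p * (z.2 ^ (p + 1))⁻¹)).indicator hset
    _ = ∫⁻ r in Ioi (0 : ℝ), ENNReal.ofReal (p * (r ^ (p + 1))⁻¹) * v r := by
        refine lintegral_congr fun r => ?_
        rw [lintegral_indicator measurableSet_ball, setLIntegral_const,
          Measure.restrict_apply measurableSet_ball, inter_comm]
    _ ≤ ∫⁻ r in Ioi (0 : ℝ), ∫⁻ s in Ioo 0 W, p *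
          {r : ℝ | ENNReal.ofReal (s * r ^ N) < v r}.indicator
            (fun r => ENNReal.ofReal (r ^ k)) r := by
        refine setLIntegral_mono' measurableSet_Ioi fun r (hr : 0 < r) => ?_
        have hle : v r ≤ ENNReal.ofReal (r ^ N) * ∫⁻ s in Ioo 0 W,
            {s : ℝ | ENNReal.ofReal (s * r ^ N) < v r}.indicator 1 s := by
          rw [lintegral_indicator_one (measurableSet_lt (by fun_prop) measurable_const),
            Measure.restrict_apply (measurableSet_lt (by fun_prop) measurable_const)]
          have hsub : Ioo 0 ((v r).toReal / r ^ N) ⊆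
              {s : ℝ | ENNReal.ofReal (s * r ^ N) < v r} ∩ Ioo 0 W := by
            rintro s ⟨hs0, hs⟩
            rw [lt_div_iff₀ (by positivity)] at hs
            refine ⟨(ENNReal.ofReal_lt_iff_lt_toReal (by positivity) (hvtop r)).2 hs, hs0, ?_⟩
            have := hs.trans_le (ENNReal.toReal_le_of_le_ofReal (by positivity) (hvW r hr))
            rw [mul_comm] at this
            exact lt_of_mul_lt_mul_left this (by positivity)
          refine le_trans ?_ (mul_le_mul_right (measure_mono hsub) _)
          rw [Real.volume_Ioo, sub_zero, ← ENNReal.ofReal_mul (by positivity),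
            mul_div_cancel₀ _ (by positivity), ENNReal.ofReal_toReal (hvtop r)]
        refine (mul_le_mul_right hle _).trans_eq ?_
        rw [← mul_assoc, ← lintegral_const_mul _
          (measurable_one.indicator (measurableSet_lt (by fun_prop) measurable_const))]
        refine lintegral_congr fun s => ?_
        have hpow : ENNReal.ofReal (p * (r ^ (p + 1))⁻¹) * ENNReal.ofReal (r ^ N) =
            p * ENNReal.ofReal (r ^ k) := by
          rw [← ENNReal.ofReal_mul (by positivity), ← ENNReal.ofReal_natCast p,
            ← ENNReal.ofReal_mul (by positivity), ← hkp]
          congr 1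
          field_simp
          ring
        by_cases h : ENNReal.ofReal (s * r ^ N) < v r
        · rw [indicator_of_mem (by exact h), indicator_of_mem (by exact h), Pi.one_apply, mul_one,
            hpow]
        · simp [h]
    _ = ∫⁻ s in Ioo 0 W, ∫⁻ r in Ioi (0 : ℝ), p *
          {r : ℝ | ENNReal.ofReal (s * r ^ N) < v r}.indicator
            (fun r => ENNReal.ofReal (r ^ k)) r := by
        refine lintegral_lintegral_swap (Measurable.aemeasurable (Measurable.const_mul ?_ _))
        have hset : MeasurableSet {z : ℝ × ℝ | ENNReal.ofReal (z.2 * z.1 ^ N) < v z.1} :=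
          measurableSet_lt (by fun_prop) (hvm.comp measurable_fst)
        exact (by fun_prop : Measurable fun z : ℝ × ℝ => ENNReal.ofReal (z.1 ^ k)).indicator hset
    _ = _ := by
        rw [← lintegral_const_mul' _ _ (ENNReal.natCast_ne_top p)]
        refine lintegral_congr fun s => ?_
        rw [lintegral_const_mul' _ _ (ENNReal.natCast_ne_top p)]
        rfl

theorem lintegral_denseRadiiMoment_rpow_le (ν : Measure E)
    {S : Set E} (hS : MeasurableSet S) (hSfin : ν S ≠ ⊤) (hN : 1 ≤ Module.finrank ℝ E)
    (μ : Measure E) {A d : ℝ} (hA : 0 ≤ A) (hd0 : 0 < d)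
    (hμ : ∀ (x : E) (r : ℝ), 0 < r → μ (Metric.ball x r) ≤ ENNReal.ofReal (A * r ^ d))
    {k : ℕ} {q : ℝ} (hq : 0 < q) (hqd : ((k + 1 : ℕ) : ℝ) * q + d = Module.finrank ℝ E)
    {s : ℝ} (hs : 0 < s) :
    ∫⁻ x, denseRadiiMoment ν S k s x ^ q ∂μ ≤
      ENNReal.ofReal (A * 4 ^ Module.finrank ℝ E / s) * ν S := by
  set N := Module.finrank ℝ E
  let T : E → Set ℝ := fun x =>
    {r | 0 < r ∧ ENNReal.ofReal (s * r ^ N) < ν (S ∩ Metric.ball x r)}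
  have hTbdd : ∀ x, ∀ r ∈ T x, r ≤ max 1 ((ν S).toReal / s) := by
    rintro x r ⟨hr0, hr⟩
    by_contra! hlt
    obtain ⟨h1, h2⟩ := max_lt_iff.1 hlt
    have h3 := hr.trans_le (measure_mono inter_subset_left)
    rw [ENNReal.ofReal_lt_iff_lt_toReal (by positivity) hSfin] at h3
    rw [div_lt_iff₀ hs] at h2
    have h4 : r ≤ r ^ N := le_self_pow₀ h1.le (by omega)
    nlinarith
  have hex : ∀ x, ∃ r, (T x).Nonempty → r ∈ T x ∧ ∀ r' ∈ T x, r' ≤ 2 * r := fun x => by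
    by_cases hne : (T x).Nonempty
    · have hbdd : BddAbove (T x) := ⟨_, hTbdd x⟩
      have hpos : 0 < sSup (T x) := hne.some_mem.1.trans_le (le_csSup hbdd hne.some_mem)
      obtain ⟨r, hr, hlt⟩ := exists_lt_of_lt_csSup hne (half_lt_self hpos)
      exact ⟨r, fun _ => ⟨hr, fun r' hr' => by linarith [le_csSup hbdd hr']⟩⟩
    · exact ⟨0, fun h => absurd h hne⟩
  choose ρ hρ using hex
  let t : Set E := {x | (T x).Nonempty}
  have hρpos : ∀ x ∈ t, 0 < ρ x := fun x hx => (hρ x hx).1.1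
  obtain ⟨w, hwt, hdisj, hcov⟩ := Vitali.exists_disjoint_subfamily_covering_enlargement
    (fun x => Metric.ball x (ρ x)) t ρ 2 one_lt_two (fun x hx => (hρpos x hx).le)
    (max 1 ((ν S).toReal / s)) (fun x hx => hTbdd x _ (hρ x hx).1)
    (fun x hx => ⟨x, Metric.mem_ball_self (hρpos x hx)⟩)
  have hwc : w.Countable := hdisj.countable_of_isOpen (fun _ _ => Metric.isOpen_ball)
    fun x hx => ⟨x, Metric.mem_ball_self (hρpos x (hwt hx))⟩
  have := hwc.to_subtype
  have hpt : ∀ x, denseRadiiMoment ν S k s x ^ q ≤ ∑' b : w,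
      (Metric.ball (b : E) (3 * ρ b)).indicator
        (fun _ => ENNReal.ofReal ((4 * ρ b) ^ ((N : ℝ) - d))) x := fun x => by
    by_cases hx : x ∈ t
    · obtain ⟨b, hb, ⟨z, hzx, hzb⟩, hxb⟩ := hcov x hx
      have hbpos := hρpos b (hwt hb)
      have hmem : x ∈ Metric.ball b (3 * ρ b) := by
        rw [Metric.mem_ball] at *
        linarith [dist_triangle_left x b z]
      refine le_trans ?_ (ENNReal.le_tsum ⟨b, hb⟩)
      rw [indicator_of_mem hmem]
      have hG := denseRadiiMoment_le (ν := ν) (S := S) (k := k) (s := s) (x := x)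
        (R := 4 * ρ b) (by positivity)
        fun r hr0 hr => ((hρ x hx).2 r ⟨hr0, hr⟩).trans (by linarith)
      refine (ENNReal.rpow_le_rpow hG hq.le).trans_eq ?_
      rw [ENNReal.ofReal_rpow_of_nonneg (by positivity) hq.le, ← Real.rpow_natCast,
        ← Real.rpow_mul (by positivity), ← hqd, add_sub_cancel_right]
    · have hG := denseRadiiMoment_le (ν := ν) (S := S) (k := k) (s := s) (x := x) (R := 0) le_rfl
        fun r hr0 hr => absurd ⟨r, hr0, hr⟩ hx
      have : denseRadiiMoment ν S k s x = 0 := by simpa using hG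
      rw [this, ENNReal.zero_rpow_of_pos hq]
      exact zero_le
  have hterm : ∀ b : w, ENNReal.ofReal ((4 * ρ b) ^ ((N : ℝ) - d)) *
      μ (Metric.ball (b : E) (3 * ρ b)) ≤
      ENNReal.ofReal (A * 4 ^ N / s) * ν (S ∩ Metric.ball (b : E) (ρ b)) := fun b => by
    have hb := hρpos b (hwt b.2)
    refine le_trans ?_ (mul_le_mul_right (hρ b (hwt b.2)).1.2.le _)
    refine (mul_le_mul_right (hμ b (3 * ρ b) (by positivity)) _).trans ?_
    rw [← ENNReal.ofReal_mul (by positivity), ← ENNReal.ofReal_mul (by positivity)]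
    refine ENNReal.ofReal_le_ofReal ?_
    calc (4 * ρ b) ^ ((N : ℝ) - d) * (A * (3 * ρ b) ^ d)
        ≤ (4 * ρ b) ^ ((N : ℝ) - d) * (A * (4 * ρ b) ^ d) := by
          gcongr; norm_num
      _ = A * ((4 * ρ b) ^ ((N : ℝ) - d) * (4 * ρ b) ^ d) := by ring
      _ = A * (4 * ρ b) ^ N := by
          rw [← Real.rpow_add (by positivity), sub_add_cancel, Real.rpow_natCast]
      _ = A * 4 ^ N / s * (s * ρ b ^ N) := by
          rw [mul_pow]
          field_simp
  calc ∫⁻ x, denseRadiiMoment ν S k s x ^ q ∂μ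
      ≤ ∫⁻ x, ∑' b : w, (Metric.ball (b : E) (3 * ρ b)).indicator
          (fun _ => ENNReal.ofReal ((4 * ρ b) ^ ((N : ℝ) - d))) x ∂μ := lintegral_mono hpt
    _ = ∑' b : w, ENNReal.ofReal ((4 * ρ b) ^ ((N : ℝ) - d)) *
          μ (Metric.ball (b : E) (3 * ρ b)) := by
        rw [lintegral_tsum fun b =>
          (measurable_const.indicator measurableSet_ball).aemeasurable]
        refine tsum_congr fun b => ?_
        rw [lintegral_indicator measurableSet_ball, setLIntegral_const]
    _ ≤ ∑' b : w, ENNReal.ofReal (A * 4 ^ N / s) * ν (S ∩ Metric.ball (b : E) (ρ b)) :=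
        ENNReal.tsum_le_tsum hterm
    _ ≤ ENNReal.ofReal (A * 4 ^ N / s) * ν S := by
        rw [ENNReal.tsum_mul_left]
        gcongr
        refine (tsum_meas_le_meas_iUnion_of_disjoint ν (fun b => hS.inter measurableSet_ball)
          ?_).trans (measure_mono (iUnion_subset fun b => inter_subset_left))
        intro a b hab
        exact (hdisj a.2 b.2 (Subtype.coe_injective.ne hab)).mono inter_subset_right
          inter_subset_right

theorem lintegral_mul_rieszPotential_le (ν : Measure E) [ν.IsAddHaarMeasure]
    {S : Set E} (hS : MeasurableSet S) (hSfin : ν S ≠ ⊤)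
    (μ : Measure E) [SFinite μ] {A d : ℝ} (hA : 0 ≤ A) (hd0 : 0 < d)
    (hμ : ∀ (x : E) (r : ℝ), 0 < r → μ (Metric.ball x r) ≤ ENNReal.ofReal (A * r ^ d))
    {k p : ℕ} (hp : 1 ≤ p) (hkp : k + 1 + p = Module.finrank ℝ E)
    {q q' : ℝ} (hqq' : q'.HolderConjugate q)
    (hqd : ((k + 1 : ℕ) : ℝ) * q + d = Module.finrank ℝ E)
    {g : E → ℝ≥0∞} (hg : Measurable g) :
    ∫⁻ x, g x * ∫⁻ y in S, ENNReal.ofReal ((‖y - x‖ ^ p)⁻¹) ∂ν ∂μ ≤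
      p * (∫⁻ s in Ioo 0 (ν.real (Metric.ball (0 : E) 1)),
          ENNReal.ofReal (A * 4 ^ Module.finrank ℝ E / s) ^ (1 / q)) *
        (∫⁻ x, g x ^ q' ∂μ) ^ (1 / q') * ν S ^ (1 / q) := by
  set W := ν.real (Metric.ball (0 : E) 1)
  set N := Module.finrank ℝ E
  have hGm := measurable_denseRadiiMoment ν hS k
  have hq := hqq'.symm.pos
  calc ∫⁻ x, g x * ∫⁻ y in S, ENNReal.ofReal ((‖y - x‖ ^ p)⁻¹) ∂ν ∂μ
      ≤ ∫⁻ x, p * (g x * ∫⁻ s in Ioo 0 W, denseRadiiMoment ν S k s x) ∂μ := by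
        refine lintegral_mono fun x => ?_
        rw [mul_left_comm]
        gcongr
        exact rieszPotential_le_lintegral_denseRadiiMoment ν hS hp hkp x
    _ = p * ∫⁻ x, (∫⁻ s in Ioo 0 W, g x * denseRadiiMoment ν S k s x) ∂μ := by
        rw [lintegral_const_mul' _ _ (ENNReal.natCast_ne_top p)]
        congr 1
        refine lintegral_congr fun x => ?_
        exact (lintegral_const_mul _
          (hGm.comp (by fun_prop : Measurable fun s : ℝ => (s, x)))).symm
    _ = p * ∫⁻ s in Ioo 0 W, (∫⁻ x, g x * denseRadiiMoment ν S k s x ∂μ) := by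
        congr 1
        refine lintegral_lintegral_swap (Measurable.aemeasurable ?_)
        exact (hg.comp measurable_fst).mul (hGm.comp measurable_swap)
    _ ≤ p * ∫⁻ s in Ioo 0 W, ENNReal.ofReal (A * 4 ^ N / s) ^ (1 / q) *
          ((∫⁻ x, g x ^ q' ∂μ) ^ (1 / q') * ν S ^ (1 / q)) := by
        refine mul_le_mul_right ?_ _
        refine setLIntegral_mono' measurableSet_Ioo fun s hs => ?_
        refine (ENNReal.lintegral_mul_le_Lp_mul_Lq μ hqq' hg.aemeasurable
          (hGm.comp (by fun_prop : Measurable fun x : E => (s, x))).aemeasurable).trans ?_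
        rw [mul_left_comm, ← ENNReal.mul_rpow_of_nonneg _ _ (by positivity)]
        gcongr
        exact lintegral_denseRadiiMoment_rpow_le ν hS hSfin (by omega) μ hA hd0 hμ hq hqd hs.1
    _ = _ := by
        rw [lintegral_mul_const _ (by fun_prop)]
        ring

end RestrictedEstimate

theorem lintegral_ofReal_div_rpow_ne_top {W B q : ℝ} (hW : 0 ≤ W) (hB : 0 ≤ B) (hq : 1 < q) :
    ∫⁻ s in Ioo 0 W, ENNReal.ofReal (B / s) ^ (1 / q) ≠ ⊤ := by
  have hq0 : 0 < q := one_pos.trans hq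
  have hint : IntegrableOn (fun s : ℝ => B ^ (1 / q) * s ^ (-(1 / q))) (Ioo 0 W) := by
    have h1 : -1 < -(1 / q) := by
      rw [neg_lt_neg_iff, div_lt_one hq0]; exact hq
    have h2 := (intervalIntegral.intervalIntegrable_rpow' (a := 0) (b := W) h1).const_mul
      (B ^ (1 / q))
    rw [intervalIntegrable_iff_integrableOn_Ioo_of_le hW] at h2
    exact h2
  rw [setLIntegral_congr_fun measurableSet_Ioo fun s hs => ?_]
  · exact hint.lintegral_lt_top.ne
  · have hs0 : 0 < s := hs.1
    rw [ENNReal.ofReal_rpow_of_nonneg (by positivity) (by positivity),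
      Real.div_rpow hB hs0.le, Real.rpow_neg hs0.le, div_eq_mul_inv]

theorem enorm_eq_lintegral_indicator_lt {F : Type*} [SeminormedAddCommGroup F] (v : F) :
    ‖v‖ₑ = ∫⁻ t in Ioi (0 : ℝ), {t : ℝ | t < ‖v‖}.indicator 1 t := by
  have hset : {t : ℝ | t < ‖v‖} = Iio ‖v‖ := rfl
  rw [hset, lintegral_indicator_one measurableSet_Iio, Measure.restrict_apply measurableSet_Iio,
    Iio_inter_Ioi, Real.volume_Ioo, sub_zero, ofReal_norm]

section Trace

variable {E : Type*} [NormedAddCommGroup E] [NormedSpace ℝ E] [FiniteDimensional ℝ E]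
  [MeasurableSpace E] [BorelSpace E]

theorem toSphere_mul_lintegral_rpow_le (ν : Measure E) [ν.IsAddHaarMeasure]
    (μ : Measure E) [SFinite μ] {A d : ℝ} (hA : 0 ≤ A) (hd0 : 0 < d)
    (hμ : ∀ (x : E) (r : ℝ), 0 < r → μ (Metric.ball x r) ≤ ENNReal.ofReal (A * r ^ d))
    {m : ℕ} (hm : 1 ≤ m) (hmN : m < Module.finrank ℝ E)
    {q q' : ℝ} (hqq' : q'.HolderConjugate q) (hqd : (m : ℝ) * q + d = Module.finrank ℝ E)
    {u : E → ℝ} (hu : ContDiff ℝ (⊤ : ℕ∞) u) (hc : HasCompactSupport u) :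
    ν.toSphere univ * ∫⁻ x, ‖u x‖ₑ ^ q ∂μ ≤
      (Module.finrank ℝ E - m : ℕ) * (∫⁻ s in Ioo 0 (ν.real (Metric.ball (0 : E) 1)),
          ENNReal.ofReal (A * 4 ^ Module.finrank ℝ E / s) ^ (1 / q)) *
        (∫⁻ x, ‖u x‖ₑ ^ q ∂μ) ^ (1 / q') *
        ∫⁻ t in Ioi (0 : ℝ), ν {y | t < ‖iteratedFDeriv ℝ m u y‖} ^ (1 / q) := by
  obtain ⟨k, rfl⟩ : ∃ k, m = k + 1 := ⟨m - 1, by omega⟩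
  have hfc : Continuous (iteratedFDeriv ℝ (k + 1) u) :=
    hu.continuous_iteratedFDeriv (by exact_mod_cast le_top)
  set N := Module.finrank ℝ E
  set p := N - (k + 1)
  set f : E → ℝ := fun y => ‖iteratedFDeriv ℝ (k + 1) u y‖
  have hf : Measurable f := hfc.norm.measurable
  set J := ∫⁻ s in Ioo 0 (ν.real (Metric.ball (0 : E) 1)), ENNReal.ofReal (A * 4 ^ N / s) ^ (1 / q)
  set X := ∫⁻ x, ‖u x‖ₑ ^ q ∂μ with hX
  have hum : Measurable fun x => ‖u x‖ₑ := hu.continuous.enorm.measurable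
  have hq1 : 0 < q - 1 := hqq'.symm.sub_one_pos
  set g : E → ℝ≥0∞ := fun x => ‖u x‖ₑ ^ (q - 1) with hgdef
  have hg : Measurable g := hum.pow_const _
  have hgq : ∫⁻ x, g x ^ q' ∂μ = X := by
    refine lintegral_congr fun x => ?_
    rw [hgdef, ← ENNReal.rpow_mul, hqq'.symm.sub_one_mul_conj]
  have hmul : ∀ x, ‖u x‖ₑ ^ q = g x * ‖u x‖ₑ := fun x => by
    conv_lhs => rw [← sub_add_cancel q 1, ENNReal.rpow_add_of_nonneg _ _ hq1.le zero_le_one,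
      ENNReal.rpow_one]
  have hkm : Measurable fun z : E × E => ENNReal.ofReal ((‖z.2 - z.1‖ ^ p)⁻¹) := by fun_prop
  have hsub : ∀ t, MeasurableSet {y | t < f y} := fun t => measurableSet_lt measurable_const hf
  set H : E → ℝ → ℝ≥0∞ := fun x t =>
    ∫⁻ y in {y | t < f y}, ENNReal.ofReal ((‖y - x‖ ^ p)⁻¹) ∂ν
  have hHm : Measurable fun z : E × ℝ => H z.1 z.2 := by
    have hset : MeasurableSet {w : (E × ℝ) × E | w.1.2 < f w.2} :=
      measurableSet_lt (by fun_prop) (by fun_prop)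
    have := Measurable.lintegral_prod_right' (ν := ν)
      ((hkm.comp (by fun_prop : Measurable fun w : (E × ℝ) × E => (w.1.1, w.2))).indicator hset)
    convert this using 2 with z
    exact (lintegral_indicator (hsub z.2) _).symm
  have hlayer : ∀ x, ∫⁻ y, ENNReal.ofReal ((‖y - x‖ ^ p)⁻¹) * ‖iteratedFDeriv ℝ (k + 1) u y‖ₑ ∂ν =
      ∫⁻ t in Ioi (0 : ℝ), H x t := fun x => by
    calc ∫⁻ y, ENNReal.ofReal ((‖y - x‖ ^ p)⁻¹) * ‖iteratedFDeriv ℝ (k + 1) u y‖ₑ ∂ν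
        = ∫⁻ y, (∫⁻ t in Ioi (0 : ℝ),
            {y | t < f y}.indicator (fun y => ENNReal.ofReal ((‖y - x‖ ^ p)⁻¹)) y) ∂ν := by
          refine lintegral_congr fun y => ?_
          rw [enorm_eq_lintegral_indicator_lt, ← lintegral_const_mul' _ _ ENNReal.ofReal_ne_top]
          refine lintegral_congr fun t => ?_
          simp [indicator, f]
      _ = ∫⁻ t in Ioi (0 : ℝ), (∫⁻ y,
            {y | t < f y}.indicator (fun y => ENNReal.ofReal ((‖y - x‖ ^ p)⁻¹)) y ∂ν) := by
          refine lintegral_lintegral_swap (Measurable.aemeasurable ?_)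
          have hset : MeasurableSet {w : E × ℝ | w.2 < f w.1} :=
            measurableSet_lt (by fun_prop) (by fun_prop)
          exact (by fun_prop : Measurable fun w : E × ℝ =>
            ENNReal.ofReal ((‖w.1 - x‖ ^ p)⁻¹)).indicator hset
      _ = _ := lintegral_congr fun t => lintegral_indicator (hsub t) _
  calc ν.toSphere univ * X = ∫⁻ x, g x * (ν.toSphere univ * ‖u x‖ₑ) ∂μ := by
        rw [hX, ← lintegral_const_mul' _ _ (measure_ne_top _ _)]
        refine lintegral_congr fun x => ?_
        rw [hmul, mul_left_comm]
    _ ≤ ∫⁻ x, g x * (∫⁻ t in Ioi (0 : ℝ), H x t) ∂μ := by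
        refine lintegral_mono fun x => mul_le_mul_right ?_ _
        rw [← hlayer]
        exact toSphere_mul_enorm_le_rieszPotential ν hm hmN hu hc x
    _ = ∫⁻ x, (∫⁻ t in Ioi (0 : ℝ), g x * H x t) ∂μ := by
        refine lintegral_congr fun x => ?_
        exact (lintegral_const_mul _
          (hHm.comp (by fun_prop : Measurable fun t : ℝ => (x, t)))).symm
    _ = ∫⁻ t in Ioi (0 : ℝ), (∫⁻ x, g x * H x t ∂μ) := by
        refine lintegral_lintegral_swap (Measurable.aemeasurable ?_)
        exact (hg.comp measurable_fst).mul hHm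
    _ ≤ ∫⁻ t in Ioi (0 : ℝ), p * J * X ^ (1 / q') * ν {y | t < f y} ^ (1 / q) := by
        refine setLIntegral_mono' measurableSet_Ioi fun t (ht : 0 < t) => ?_
        have hfin : ν {y | t < f y} ≠ ⊤ := by
          refine ((measure_mono fun y hy => ?_).trans_lt
            (hc.iteratedFDeriv (𝕜 := ℝ) (k + 1)).isCompact.measure_lt_top).ne
          exact subset_tsupport _ (norm_ne_zero_iff.1 (ht.trans hy).ne')
        have := lintegral_mul_rieszPotential_le ν (hsub t) hfin μ hA hd0 hμ (k := k) (p := p)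
          (by omega) (by omega) hqq' hqd hg
        rwa [hgq] at this
    _ = _ := by
        refine lintegral_const_mul _
          (Measurable.pow_const (Antitone.measurable fun a b hab => ?_) _)
        exact measure_mono fun y hy => lt_of_le_of_lt hab hy

/-- The trace inequality for measures satisfying a ball growth condition of order `d`, with the
Lorentz norm of exponent `q = (dim E - d) / m > 1` and second index one on the right-hand side. -/
theorem exists_trace_le_lorentz (ν : Measure E) [ν.IsAddHaarMeasure]
    (μ : Measure E) [IsFiniteMeasure μ] {A d : ℝ} (hA : 0 ≤ A) (hd0 : 0 < d)
    (hμ : ∀ (x : E) (r : ℝ), 0 < r → μ (Metric.ball x r) ≤ ENNReal.ofReal (A * r ^ d))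
    {m : ℕ} (hm : 1 ≤ m) (hmN : m < Module.finrank ℝ E)
    {q : ℝ} (hq : 1 < q) (hqd : (m : ℝ) * q + d = Module.finrank ℝ E) :
    ∃ C : ℝ, 0 < C ∧ ∀ u : E → ℝ, ContDiff ℝ (⊤ : ℕ∞) u → HasCompactSupport u →
      (∫⁻ x, ‖u x‖ₑ ^ q ∂μ) ^ (1 / q) ≤ ENNReal.ofReal C *
        ∫⁻ t in Ioi (0 : ℝ), ν {y | t < ‖iteratedFDeriv ℝ m u y‖} ^ (1 / q) := by
  have : Nontrivial E := Module.finrank_pos_iff (R := ℝ).1 (by omega)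
  have hqq' := (Real.HolderConjugate.conjExponent hq).symm
  set q' := q.conjExponent
  have hq0 := hqq'.symm.pos
  have hq'0 := hqq'.pos
  set K : ℝ≥0∞ := (Module.finrank ℝ E - m : ℕ) *
    (∫⁻ s in Ioo 0 (ν.real (Metric.ball (0 : E) 1)),
          ENNReal.ofReal (A * 4 ^ Module.finrank ℝ E / s) ^ (1 / q))
  set σ := ν.toSphere univ
  have hKtop : K ≠ ⊤ := ENNReal.mul_ne_top (ENNReal.natCast_ne_top _)
    (lintegral_ofReal_div_rpow_ne_top (by positivity) (by positivity) hq)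
  have hσ0 : σ ≠ 0 := fun h => ν.toSphere_ne_zero (Measure.measure_univ_eq_zero.1 h)
  have hσtop : σ ≠ ⊤ := measure_ne_top _ _
  refine ⟨(K / σ).toReal + 1, by positivity, fun u hu hc => ?_⟩
  set X := ∫⁻ x, ‖u x‖ₑ ^ q ∂μ
  set L := ∫⁻ t in Ioi (0 : ℝ), ν {y | t < ‖iteratedFDeriv ℝ m u y‖} ^ (1 / q)
  have hbound : σ * X ≤ K * X ^ (1 / q') * L :=
    toSphere_mul_lintegral_rpow_le ν μ hA hd0 hμ hm hmN hqq' hqd hu hc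
  have hXtop : X ≠ ⊤ := by
    obtain ⟨M, hM⟩ := hu.continuous.bounded_above_of_compact_support hc
    refine ((lintegral_mono fun x => ENNReal.rpow_le_rpow
      (enorm_le_iff_norm_le.2 (?_ : ‖u x‖ ≤ ‖M‖)) hq0.le).trans_lt ?_).ne
    · exact (hM x).trans (le_abs_self M)
    · rw [lintegral_const]
      exact ENNReal.mul_lt_top (ENNReal.rpow_lt_top_of_nonneg hq0.le enorm_ne_top)
        (measure_lt_top _ _)
  rcases eq_or_ne X 0 with h0 | h0
  · rw [h0, ENNReal.zero_rpow_of_pos (by positivity)]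
    exact zero_le
  have hsplit : X = X ^ (1 / q) * X ^ (1 / q') := by
    rw [← ENNReal.rpow_add _ _ h0 hXtop, one_div, one_div, hqq'.symm.inv_add_inv_eq_one,
      ENNReal.rpow_one]
  have hY0 : X ^ (1 / q') ≠ 0 := by simp [h0, hXtop]
  have hYtop : X ^ (1 / q') ≠ ⊤ := ENNReal.rpow_ne_top_of_nonneg (by positivity) hXtop
  have hcancel : σ * X ^ (1 / q) ≤ K * L := by
    rw [← ENNReal.mul_le_mul_iff_left hY0 hYtop]
    calc σ * X ^ (1 / q) * X ^ (1 / q') = σ * X := by rw [mul_assoc, ← hsplit]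
      _ ≤ _ := hbound
      _ = _ := by ring
  calc X ^ (1 / q) ≤ K * L / σ := by
        rw [ENNReal.le_div_iff_mul_le (Or.inl hσ0) (Or.inl hσtop), mul_comm]
        exact hcancel
    _ = K / σ * L := by rw [div_eq_mul_inv, div_eq_mul_inv]; ring
    _ ≤ _ := by
        gcongr
        exact (ENNReal.ofReal_toReal (ENNReal.div_ne_top hKtop hσ0)).symm.trans_le
          (ENNReal.ofReal_le_ofReal (by linarith))

end Trace

/-- **Endpoint trace embedding `W^m_0 L^{(n-d)/m,1}(Ω) → L^{(n-d)/m}(Ω,μ)` for slowly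
decaying `d`-Frostman measures (`0 < d < n-m`).** -/
theorem endpoint_trace_slow (n m : ℕ) (hn : 2 ≤ n) (hm : 1 ≤ m) (hmn : m < n)
    (d : ℝ) (hd0 : 0 < d) (hd : d < (n : ℝ) - m)
    (Ω : Set (EuclideanSpace ℝ (Fin n))) (hΩ : IsOpen Ω) (hΩvol : volume Ω < ⊤)
    (μ : Measure (EuclideanSpace ℝ (Fin n))) (hfin : IsFiniteMeasure μ) (hsupp : μ Ωᶜ = 0)
    (hFrostman : ∃ A : ℝ, ∀ (x : EuclideanSpace ℝ (Fin n)) (r : ℝ), 0 < r →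
        μ (Metric.ball x r ∩ Ω) ≤ ENNReal.ofReal (A * r ^ d)) :
    ∃ C : ℝ, 0 < C ∧
      ∀ u : EuclideanSpace ℝ (Fin n) → ℝ, ContDiff ℝ (⊤ : ℕ∞) u → HasCompactSupport u →
        tsupport u ⊆ Ω →
        (∫⁻ x in Ω, ENNReal.ofReal (|u x| ^ (((n : ℝ) - d) / m)) ∂μ) ^
            ((m : ℝ) / ((n : ℝ) - d)) ≤
          ENNReal.ofReal C *
            ∫⁻ lam in Set.Ioi (0 : ℝ),
              (volume {x | x ∈ Ω ∧ lam < ‖iteratedFDeriv ℝ m u x‖}) ^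
                ((m : ℝ) / ((n : ℝ) - d)) := by
  obtain ⟨A, hA⟩ := hFrostman
  have hm0 : (0 : ℝ) < m := by exact_mod_cast hm
  have hq : 1 < ((n : ℝ) - d) / m := by
    rw [lt_div_iff₀ hm0]; linarith
  have hμ : ∀ (x : EuclideanSpace ℝ (Fin n)) (r : ℝ), 0 < r →
      μ (Metric.ball x r) ≤ ENNReal.ofReal (max A 0 * r ^ d) := fun x r hr => by
    rw [← measure_inter_conull hsupp]
    refine (hA x r hr).trans (ENNReal.ofReal_le_ofReal ?_)
    gcongr
    exact le_max_left _ _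
  obtain ⟨C, hC, h⟩ := exists_trace_le_lorentz (volume : Measure (EuclideanSpace ℝ (Fin n))) μ
    (le_max_right A 0) hd0 hμ hm (by simpa using hmn) hq
    (by rw [mul_div_cancel₀ _ hm0.ne']; simp)
  refine ⟨C, hC, fun u hu hc hsub => ?_⟩
  have hexp : (m : ℝ) / ((n : ℝ) - d) = 1 / (((n : ℝ) - d) / m) := (one_div_div _ _).symm
  rw [hexp]
  calc _ ≤ (∫⁻ x, ‖u x‖ₑ ^ (((n : ℝ) - d) / m) ∂μ) ^ (1 / (((n : ℝ) - d) / m)) := by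
        refine ENNReal.rpow_le_rpow ?_ (one_div_pos.2 (one_pos.trans hq)).le
        refine (setLIntegral_le_lintegral _ _).trans_eq (lintegral_congr fun x => ?_)
        rw [← ENNReal.ofReal_rpow_of_nonneg (abs_nonneg _) (one_pos.trans hq).le,
          ← Real.norm_eq_abs, ofReal_norm]
    _ ≤ _ := h u hu hc
    _ = _ := by
        congr 1
        refine setLIntegral_congr_fun measurableSet_Ioi fun t (ht : 0 < t) => ?_
        congr 2
        ext y
        refine ⟨fun hy => ⟨hsub ?_, hy⟩, fun hy => hy.2⟩
        exact tsupport_iteratedFDeriv_subset (𝕜 := ℝ) m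
          (subset_tsupport _ (norm_ne_zero_iff.1 (ht.trans hy).ne'))
end

section
/- Let Ω be an open set of finite Lebesgue measure in ℝⁿ, n ≥ 2, let m ∈ ℕ with m < n, and let d ∈ (0, n−m). Let x₀ ∈ Ω and let g : (0,∞) → [0,∞) be a non-increasing measurable function, and let μ be the measure on Ω given by dμ(x) = g(|x−x₀|) dx. Assume that μ is finite and satisfies the d-Frostman condition sup_{x ∈ ℝⁿ, r > 0} μ(B_r(x) ∩ Ω)/r^d < ∞. Then there exists a constant C (depending on n, m, d, Ω and μ) such that for every u ∈ C_c^∞(Ω): ∫₀^∞ μ({x ∈ Ω : |u(x)| > λ})^{m/(n−d)} dλ ≤ C · ∫₀^∞ |{x ∈ Ω : |∇^m u(x)| > λ}|^{m/(n−d)} dλ. (Equivalently, ‖u‖_{L^{(n−d)/m,1}(Ω,μ)} ≲ ‖∇^m u‖_{L^{(n−d)/m,1}(Ω)}: for measures with a radially decreasing density the Lorentz target L^{(n−d)/m,1} replaces L^{(n−d)/m}.) -/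
open MeasureTheory Set
open scoped ENNReal NNReal

/-- The derivative of the smooth step `Real.smoothTransition` is bounded. -/
theorem exists_norm_deriv_smoothTransition_le :
    ∃ M : ℝ≥0, ∀ x, ‖deriv Real.smoothTransition x‖ₑ ≤ M := by
  have hc : Continuous (deriv Real.smoothTransition) :=
    (Real.smoothTransition.contDiff (n := 1)).continuous_deriv le_rfl
  have hs : HasCompactSupport (deriv Real.smoothTransition) := by
    refine HasCompactSupport.of_support_subset_isCompact (isCompact_Icc (a := (0 : ℝ)) (b := 1)) ?_
    intro x hx
    by_contra hx'
    refine hx ?_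
    rw [mem_Icc, not_and_or, not_le, not_le] at hx'
    rcases hx' with h | h
    · have : Real.smoothTransition =ᶠ[nhds x] fun _ => (0 : ℝ) := by
        filter_upwards [Iio_mem_nhds h] with y hy
        exact Real.smoothTransition.zero_of_nonpos (le_of_lt hy)
      simpa using this.deriv_eq
    · have : Real.smoothTransition =ᶠ[nhds x] fun _ => (1 : ℝ) := by
        filter_upwards [Ioi_mem_nhds h] with y hy
        exact Real.smoothTransition.one_of_one_le (le_of_lt hy)
      simpa using this.deriv_eq
  obtain ⟨M, hM⟩ := hs.exists_bound_of_continuous hc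
  refine ⟨M.toNNReal, fun x => ?_⟩
  rw [← ofReal_norm]
  exact ENNReal.ofReal_le_ofReal (hM x)

theorem deriv_smoothTransition_eq_zero {x : ℝ} (hx : x ∉ Ioo (0 : ℝ) 1) :
    deriv Real.smoothTransition x = 0 := by
  rw [mem_Ioo, not_and_or, not_lt, not_lt] at hx
  rcases hx with h | h
  · refine IsLocalMin.deriv_eq_zero (Filter.Eventually.of_forall fun y => ?_)
    rw [Real.smoothTransition.zero_of_nonpos h]
    exact Real.smoothTransition.nonneg y
  · refine IsLocalMax.deriv_eq_zero (Filter.Eventually.of_forall fun y => ?_)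
    rw [Real.smoothTransition.one_of_one_le h]
    exact Real.smoothTransition.le_one y

section

variable {E : Type*} [NormedAddCommGroup E] [NormedSpace ℝ E] [MeasurableSpace E] [BorelSpace E]
  [FiniteDimensional ℝ E] (μ : Measure E) [μ.IsAddHaarMeasure]

open Module

/-- Gagliardo–Nirenberg–Sobolev applied to a smooth truncation between two levels. -/
theorem exists_mul_meas_le_rpow_le_lintegral_fderiv (hn : 2 ≤ finrank ℝ E) :
    ∃ C : ℝ≥0, ∀ u : E → ℝ, ContDiff ℝ 1 u → HasCompactSupport u → ∀ t h : ℝ, 0 ≤ t → 0 < h →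
      ENNReal.ofReal h * μ {x | t + h ≤ u x} ^ (1 - 1 / (finrank ℝ E : ℝ)) ≤
        C * ∫⁻ x in {x | t < u x ∧ u x < t + h}, ‖fderiv ℝ u x‖ₑ ∂μ := by
  obtain ⟨M, hM⟩ := exists_norm_deriv_smoothTransition_le
  have hn1 : (1 : ℝ) < finrank ℝ E := by exact_mod_cast hn
  set p : ℝ := Real.conjExponent (finrank ℝ E) with hp_def
  have hp : Real.HolderConjugate (finrank ℝ E) p := Real.HolderConjugate.conjExponent hn1
  have hp0 : 0 < p := hp.symm.pos
  have hinv : 1 - 1 / (finrank ℝ E : ℝ) = p⁻¹ := by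
    have := hp.inv_add_inv_eq_one
    rw [one_div]; linarith
  set K := lintegralPowLePowLIntegralFDerivConst μ p with hK
  refine ⟨(K ^ p⁻¹) * M, fun u hu hsu t h ht hh => ?_⟩
  set v : E → ℝ := fun x => Real.smoothTransition ((u x - t) / h) with hv
  have hv1 : ContDiff ℝ 1 v :=
    Real.smoothTransition.contDiff.comp ((hu.sub contDiff_const).div_const h)
  have hvs : HasCompactSupport v := by
    refine hsu.comp_left (g := fun s => Real.smoothTransition ((s - t) / h)) ?_
    refine Real.smoothTransition.zero_of_nonpos ?_
    have : 0 ≤ t / h := by positivity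
    have e : (0 - t) / h = - (t / h) := by ring
    linarith
  have key := lintegral_pow_le_pow_lintegral_fderiv μ hv1 hvs hp
  have hmeasS : MeasurableSet {x | t < u x ∧ u x < t + h} :=
    ((measurableSet_lt measurable_const hu.continuous.measurable).inter
      (measurableSet_lt hu.continuous.measurable measurable_const))
  have hder : ∀ x, ‖fderiv ℝ v x‖ₑ ≤ {x | t < u x ∧ u x < t + h}.indicator
      (fun x => (M * ENNReal.ofReal h⁻¹) * ‖fderiv ℝ u x‖ₑ) x := by
    intro x
    have h1 : HasFDerivAt (fun x => (u x - t) / h) (h⁻¹ • fderiv ℝ u x) x := by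
      have := (((hu.differentiable one_ne_zero x).hasFDerivAt).sub_const t).const_smul h⁻¹
      refine this.congr_of_eventuallyEq (Filter.Eventually.of_forall fun y => ?_)
      simp [div_eq_inv_mul]
    have h2 : HasDerivAt Real.smoothTransition (deriv Real.smoothTransition ((u x - t) / h))
        ((u x - t) / h) :=
      ((Real.smoothTransition.contDiff (n := 1)).differentiable one_ne_zero _).hasDerivAt
    have h3 := (h2.comp_hasFDerivAt x h1).fderiv
    have h3' : fderiv ℝ v x =
        deriv Real.smoothTransition ((u x - t) / h) • h⁻¹ • fderiv ℝ u x := h3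
    rw [h3', enorm_smul, enorm_smul]
    by_cases hx : x ∈ {x | t < u x ∧ u x < t + h}
    · rw [indicator_of_mem hx, ← mul_assoc]
      gcongr
      · exact hM _
      · rw [Real.enorm_eq_ofReal (by positivity)]
    · rw [deriv_smoothTransition_eq_zero]
      · simp
      · contrapose! hx
        rw [mem_Ioo, lt_div_iff₀ hh, div_lt_iff₀ hh] at hx
        exact ⟨by linarith [hx.1], by linarith [hx.2]⟩
  have hle1 : μ {x | t + h ≤ u x} ≤ ∫⁻ x, ‖v x‖ₑ ^ p ∂μ := by
    have hm : MeasurableSet {x | t + h ≤ u x} :=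
      measurableSet_le measurable_const hu.continuous.measurable
    rw [← lintegral_indicator_one hm]
    refine lintegral_mono fun x => ?_
    by_cases hx : x ∈ {x | t + h ≤ u x}
    · have : v x = 1 := by
        refine Real.smoothTransition.one_of_one_le ?_
        rw [one_le_div hh]
        have : t + h ≤ u x := hx
        linarith
      simp [indicator_of_mem hx, this]
    · simp [indicator_of_notMem hx]
  have hle2 : ∫⁻ x, ‖fderiv ℝ v x‖ₑ ∂μ ≤ (M * ENNReal.ofReal h⁻¹) *
      ∫⁻ x in {x | t < u x ∧ u x < t + h}, ‖fderiv ℝ u x‖ₑ ∂μ := by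
    rw [← lintegral_const_mul' _ _ (ENNReal.mul_ne_top ENNReal.coe_ne_top ENNReal.ofReal_ne_top),
      ← lintegral_indicator hmeasS]
    exact lintegral_mono hder
  have hfin : μ {x | t + h ≤ u x} ^ (1 - 1 / (finrank ℝ E : ℝ)) ≤
      (K : ℝ≥0∞) ^ p⁻¹ * ((M * ENNReal.ofReal h⁻¹) *
      ∫⁻ x in {x | t < u x ∧ u x < t + h}, ‖fderiv ℝ u x‖ₑ ∂μ) := by
    rw [hinv]
    calc μ {x | t + h ≤ u x} ^ p⁻¹ ≤ (K * (∫⁻ x, ‖fderiv ℝ v x‖ₑ ∂μ) ^ p) ^ p⁻¹ :=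
          ENNReal.rpow_le_rpow (hle1.trans key) (by positivity)
      _ = (K : ℝ≥0∞) ^ p⁻¹ * ∫⁻ x, ‖fderiv ℝ v x‖ₑ ∂μ := by
          rw [ENNReal.mul_rpow_of_nonneg _ _ (by positivity), ENNReal.rpow_rpow_inv hp0.ne']
      _ ≤ _ := by gcongr
  calc _ ≤ ENNReal.ofReal h * ((K : ℝ≥0∞) ^ p⁻¹ * ((M * ENNReal.ofReal h⁻¹) *
        ∫⁻ x in {x | t < u x ∧ u x < t + h}, ‖fderiv ℝ u x‖ₑ ∂μ)) := by gcongr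
    _ = (ENNReal.ofReal h * ENNReal.ofReal h⁻¹) * ((K : ℝ≥0∞) ^ p⁻¹ * M *
        ∫⁻ x in {x | t < u x ∧ u x < t + h}, ‖fderiv ℝ u x‖ₑ ∂μ) := by ring
    _ = _ := by
      rw [← ENNReal.ofReal_mul hh.le, mul_inv_cancel₀ hh.ne', ENNReal.ofReal_one, one_mul,
        ENNReal.coe_mul, ENNReal.coe_rpow_of_nonneg _ (by positivity)]

/-- Weighted form of the coarea-type inequality `∫ μ{u > t}^{1-1/n} dt ≲ ∫ |∇u|`, for weights that
are nondecreasing functions of the level. -/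
theorem exists_lintegral_mul_meas_lt_rpow_le (hn : 2 ≤ finrank ℝ E) :
    ∃ C : ℝ≥0, ∀ u : E → ℝ, ContDiff ℝ 1 u → HasCompactSupport u → ∀ w : ℝ → ℝ≥0∞, Monotone w →
      ∫⁻ t in Ioi (0 : ℝ), w t * μ {x | t < u x} ^ (1 - 1 / (finrank ℝ E : ℝ)) ≤
        C * ∫⁻ x in {x | 0 < u x}, w (u x) * ‖fderiv ℝ u x‖ₑ ∂μ := by
  obtain ⟨C, hC⟩ := exists_mul_meas_le_rpow_le_lintegral_fderiv μ hn
  refine ⟨C, fun u hu hsu w hw => ?_⟩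
  have hn1 : (2 : ℝ) ≤ finrank ℝ E := by exact_mod_cast hn
  set θ : ℝ := 1 - 1 / (finrank ℝ E : ℝ) with hθ
  have hθ0 : 0 < θ := by
    have : 1 / (finrank ℝ E : ℝ) < 1 := by rw [div_lt_one (by linarith)]; linarith
    linarith
  have hum : Measurable u := hu.continuous.measurable
  have hwm : Measurable w := hw.measurable
  have hDm : Measurable fun x => ‖fderiv ℝ u x‖ₑ :=
    (hu.continuous_fderiv one_ne_zero).measurable.enorm
  have hpos : MeasurableSet {x | 0 < u x} := measurableSet_lt measurable_const hum
  have hstep : ∀ h : ℝ, 0 < h → ∫⁻ t in Ioi (0 : ℝ), w t * μ {x | t + h ≤ u x} ^ θ ≤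
      C * ∫⁻ x in {x | 0 < u x}, w (u x) * ‖fderiv ℝ u x‖ₑ ∂μ := by
    intro h hh
    have hh' : ENNReal.ofReal h ≠ 0 := by simpa using hh
    rw [← ENNReal.mul_le_mul_iff_right hh' ENNReal.ofReal_ne_top,
      ← lintegral_const_mul' _ _ ENNReal.ofReal_ne_top]
    have hSm : MeasurableSet {q : ℝ × E | q.1 < u q.2 ∧ u q.2 < q.1 + h} :=
      (measurableSet_lt measurable_fst (hum.comp measurable_snd)).inter
        (measurableSet_lt (hum.comp measurable_snd) (measurable_fst.add_const h))
    set F : ℝ → E → ℝ≥0∞ := fun t x => {q : ℝ × E | q.1 < u q.2 ∧ u q.2 < q.1 + h}.indicator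
      (fun q => w q.1 * ‖fderiv ℝ u q.2‖ₑ) (t, x) with hF
    have hFm : Measurable (Function.uncurry F) :=
      ((hwm.comp measurable_fst).mul (hDm.comp measurable_snd)).indicator hSm
    have hSt : ∀ t : ℝ, MeasurableSet {x | t < u x ∧ u x < t + h} := fun t =>
      (measurableSet_lt measurable_const hum).inter (measurableSet_lt hum measurable_const)
    calc ∫⁻ t in Ioi (0 : ℝ), ENNReal.ofReal h * (w t * μ {x | t + h ≤ u x} ^ θ)
        ≤ ∫⁻ t in Ioi (0 : ℝ), C * ∫⁻ x, F t x ∂μ := by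
          refine setLIntegral_mono' measurableSet_Ioi fun t ht => ?_
          calc ENNReal.ofReal h * (w t * μ {x | t + h ≤ u x} ^ θ)
              = w t * (ENNReal.ofReal h * μ {x | t + h ≤ u x} ^ θ) := by ring
            _ ≤ w t * (C * ∫⁻ x in {x | t < u x ∧ u x < t + h}, ‖fderiv ℝ u x‖ₑ ∂μ) := by
                gcongr w t * ?_
                exact hC u hu hsu t h (le_of_lt ht) hh
            _ = C * (w t * ∫⁻ x in {x | t < u x ∧ u x < t + h}, ‖fderiv ℝ u x‖ₑ ∂μ) := by ring
            _ = C * ∫⁻ x, F t x ∂μ := by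
                rw [← lintegral_const_mul _ hDm, ← lintegral_indicator (hSt t)]
                rfl
      _ = C * ∫⁻ x, (∫⁻ t in Ioi (0 : ℝ), F t x) ∂μ := by
          rw [lintegral_const_mul' _ _ ENNReal.coe_ne_top, lintegral_lintegral_swap hFm.aemeasurable]
      _ ≤ C * ∫⁻ x, {x | 0 < u x}.indicator
            (fun x => ENNReal.ofReal h * (w (u x) * ‖fderiv ℝ u x‖ₑ)) x ∂μ := by
          refine mul_le_mul_right (lintegral_mono fun x => ?_) _
          by_cases hx : x ∈ {x | 0 < u x}
          · rw [indicator_of_mem hx]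
            calc ∫⁻ t in Ioi (0 : ℝ), F t x
                ≤ ∫⁻ t, (Ioo (u x - h) (u x)).indicator
                    (fun _ => w (u x) * ‖fderiv ℝ u x‖ₑ) t := by
                  refine (setLIntegral_le_lintegral _ _).trans (lintegral_mono fun t => ?_)
                  by_cases ht : t < u x ∧ u x < t + h
                  · rw [hF]
                    simp only
                    rw [indicator_of_mem (by exact ht),
                      indicator_of_mem (by exact ⟨by linarith [ht.2], ht.1⟩)]
                    gcongr
                    exact hw ht.1.le
                  · rw [hF]
                    simp only
                    rw [indicator_of_notMem (by exact ht)]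
                    exact zero_le
              _ = ENNReal.ofReal h * (w (u x) * ‖fderiv ℝ u x‖ₑ) := by
                  rw [lintegral_indicator measurableSet_Ioo, setLIntegral_const, Real.volume_Ioo,
                    sub_sub_cancel, mul_comm]
          · rw [indicator_of_notMem hx, nonpos_iff_eq_zero]
            refine (setLIntegral_congr_fun (g := fun _ => 0) measurableSet_Ioi ?_).trans (by simp)
            intro t ht
            refine indicator_of_notMem ?_ _
            rintro ⟨h1, -⟩
            exact hx (lt_trans ht h1)
      _ = ENNReal.ofReal h * (C * ∫⁻ x in {x | 0 < u x}, w (u x) * ‖fderiv ℝ u x‖ₑ ∂μ) := by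
          rw [lintegral_indicator hpos, lintegral_const_mul' _ _ ENNReal.ofReal_ne_top]
          ring
  have hanti : Antitone fun k : ℕ => (1 : ℝ) / (k + 1) := fun i j hij =>
    one_div_le_one_div_of_le (by positivity) (by gcongr)
  have hmonoS : ∀ t : ℝ, Monotone fun k : ℕ => {x | t + 1 / ((k : ℝ) + 1) ≤ u x} := by
    intro t i j hij x hx
    have : (1 : ℝ) / (j + 1) ≤ 1 / (i + 1) := hanti hij
    simp only [mem_ofPred_eq] at hx ⊢
    linarith
  have hsup : ∀ t : ℝ, w t * μ {x | t < u x} ^ θ =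
      ⨆ k : ℕ, w t * μ {x | t + 1 / ((k : ℝ) + 1) ≤ u x} ^ θ := by
    intro t
    have hU : {x | t < u x} = ⋃ k : ℕ, {x | t + 1 / ((k : ℝ) + 1) ≤ u x} := by
      ext x
      simp only [mem_ofPred_eq, mem_iUnion]
      constructor
      · intro hx
        obtain ⟨k, hk⟩ := exists_nat_one_div_lt (sub_pos.2 hx)
        exact ⟨k, by linarith⟩
      · rintro ⟨k, hk⟩
        have : (0 : ℝ) < 1 / (k + 1) := by positivity
        linarith
    rw [hU, (hmonoS t).measure_iUnion, ← ENNReal.mul_iSup]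
    congr 1
    exact (ENNReal.orderIsoRpow θ hθ0).map_iSup _
  have hDanti : ∀ h : ℝ, Measurable fun t : ℝ => μ {x | t + h ≤ u x} := fun h =>
    Antitone.measurable fun s t hst => measure_mono fun x hx => by
      simp only [mem_ofPred_eq] at hx ⊢
      linarith
  simp_rw [hsup]
  have hmeas : ∀ k : ℕ, Measurable fun t => w t * μ {x | t + 1 / ((k : ℝ) + 1) ≤ u x} ^ θ :=
    fun k => hwm.mul ((hDanti _).pow_const θ)
  rw [lintegral_iSup hmeas]
  · exact iSup_le fun k => hstep _ (by positivity)
  · intro i j hij t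
    dsimp only
    gcongr

end

theorem ENNReal.rpow_le_rpow_of_exponent_nonpos {a b : ℝ≥0∞} {z : ℝ} (hz : z ≤ 0) (hab : a ≤ b) :
    b ^ z ≤ a ^ z := by
  rw [← neg_neg z, ENNReal.rpow_neg b, ENNReal.rpow_neg a, ENNReal.inv_le_inv]
  exact ENNReal.rpow_le_rpow hab (by linarith)

/-- If the sublevel sets of `F` satisfy `ν {F < s} ≤ s`, then negative powers of `F` are integrable
on sets of finite measure, with the bound one gets for `F s = s` on `(0, ν A)`. -/
theorem exists_lintegral_rpow_le_of_meas_lt_le {γ : ℝ} (hγ0 : 0 < γ) (hγ1 : γ < 1) :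
    ∃ C : ℝ≥0, ∀ {X : Type*} [MeasurableSpace X] (ν : Measure X) (F : X → ℝ≥0∞), Measurable F →
      (∀ s : ℝ≥0∞, ν {x | F x < s} ≤ s) → ∀ A : Set X, MeasurableSet A →
      ∫⁻ x in A, F x ^ (-γ) ∂ν ≤ C * ν A ^ (1 - γ) := by
  set ρ : ℝ≥0∞ := 2 ^ γ * 2⁻¹ with hρ
  have h2γ : (2 : ℝ≥0∞) ^ γ ≠ ∞ := ENNReal.rpow_ne_top_of_nonneg hγ0.le (by simp)
  have hρ1 : ρ < 1 := by
    have h2 : (2 : ℝ≥0∞) ^ γ < 2 := by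
      simpa using ENNReal.rpow_lt_rpow_of_exponent_lt (x := 2) (by norm_num) (by simp) hγ1
    rw [hρ, ← div_eq_mul_inv]
    exact ENNReal.div_lt_of_lt_mul (by simpa using h2)
  have hCtop : 1 + 2 ^ γ * ∑' k : ℕ, ρ ^ k ≠ ∞ := by
    rw [ENNReal.tsum_geometric]
    refine ENNReal.add_ne_top.2 ⟨by simp, ENNReal.mul_ne_top h2γ ?_⟩
    exact ENNReal.inv_ne_top.2 (tsub_pos_of_lt hρ1).ne'
  refine ⟨(1 + 2 ^ γ * ∑' k : ℕ, ρ ^ k).toNNReal, fun {X} _ ν F hF hν A hA => ?_⟩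
  rw [ENNReal.coe_toNNReal hCtop]
  set e := ν A with he
  rcases eq_or_ne e 0 with he0 | he0
  · rw [setLIntegral_measure_zero _ _ he0]
    exact zero_le
  rcases eq_or_ne e ∞ with het | het
  · rw [het, ENNReal.top_rpow_of_pos (by linarith), ENNReal.mul_top]
    · exact le_top
    · simp
  have hne : ∀ᵐ x ∂ν, F x ≠ 0 := by
    rw [ae_iff]
    refine le_antisymm (le_of_forall_gt fun s hs => ?_) zero_le
    obtain ⟨r, hr0, hrs⟩ := exists_between hs
    refine lt_of_le_of_lt (le_trans (measure_mono fun x hx => ?_) (hν r)) hrs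
    simp only [ne_eq, not_not, mem_ofPred_eq] at hx ⊢
    rwa [hx]
  have hpt : ∀ x, F x ≠ 0 → F x ^ (-γ) ≤ e ^ (-γ) +
      ∑' k : ℕ, {x | F x < 2⁻¹ ^ k * e}.indicator (fun _ => (2⁻¹ ^ (k + 1) * e) ^ (-γ)) x := by
    intro x hx
    rcases le_or_gt e (F x) with hle | hlt
    · exact le_add_right (ENNReal.rpow_le_rpow_of_exponent_nonpos (by linarith) hle)
    · have hex : ∃ j : ℕ, 2⁻¹ ^ j * e ≤ F x := by
        obtain ⟨j, hj⟩ := ENNReal.exists_inv_two_pow_lt (ENNReal.div_pos hx het).ne'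
        exact ⟨j, (ENNReal.le_div_iff_mul_le (Or.inl he0) (Or.inl het)).1 hj.le⟩
      classical
      obtain ⟨k, hk⟩ : ∃ k, Nat.find hex = k + 1 := by
        refine Nat.exists_eq_succ_of_ne_zero fun h0 => ?_
        have := Nat.find_spec hex
        rw [h0, pow_zero, one_mul] at this
        exact absurd this (not_le.2 hlt)
      have hk1 : 2⁻¹ ^ (k + 1) * e ≤ F x := hk ▸ Nat.find_spec hex
      have hk2 : F x < 2⁻¹ ^ k * e := not_le.1 (Nat.find_min hex (m := k) (by omega))
      refine le_trans ?_ (le_add_left (ENNReal.le_tsum k))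
      rw [indicator_of_mem (by exact hk2)]
      exact ENNReal.rpow_le_rpow_of_exponent_nonpos (by linarith) hk1
  have hterm : ∀ k : ℕ, (2⁻¹ ^ (k + 1) * e) ^ (-γ) * (2⁻¹ ^ k * e) =
      2 ^ γ * e ^ (1 - γ) * ρ ^ k := by
    intro k
    have hsplit : (2⁻¹ ^ (k + 1) * e) ^ (-γ) = (2 ^ γ) ^ (k + 1) * e ^ (-γ) := by
      rw [ENNReal.mul_rpow_of_ne_top (by simp) het]
      congr 1
      rw [← ENNReal.inv_pow, ENNReal.inv_rpow, ENNReal.rpow_neg, inv_inv, ← ENNReal.rpow_natCast,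
        ← ENNReal.rpow_natCast, ← ENNReal.rpow_mul, ← ENNReal.rpow_mul, mul_comm]
    have he1 : e ^ (1 - γ) = e ^ (-γ) * e := by
      rw [sub_eq_neg_add, ENNReal.rpow_add _ _ he0 het, ENNReal.rpow_one]
    rw [hsplit, he1, hρ, mul_pow, pow_succ]
    ring
  have hmeas : ∀ k : ℕ, MeasurableSet {x | F x < 2⁻¹ ^ k * e} := fun k =>
    measurableSet_lt hF measurable_const
  calc ∫⁻ x in A, F x ^ (-γ) ∂ν
      ≤ ∫⁻ x in A, (e ^ (-γ) + ∑' k : ℕ, {x | F x < 2⁻¹ ^ k * e}.indicator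
          (fun _ => (2⁻¹ ^ (k + 1) * e) ^ (-γ)) x) ∂ν :=
        lintegral_mono_ae (ae_restrict_of_ae (hne.mono hpt))
    _ = e ^ (-γ) * e + ∑' k : ℕ, (2⁻¹ ^ (k + 1) * e) ^ (-γ) *
          (ν.restrict A) {x | F x < 2⁻¹ ^ k * e} := by
        rw [lintegral_add_left measurable_const, setLIntegral_const,
          lintegral_tsum fun k => (measurable_const.indicator (hmeas k)).aemeasurable]
        congr 2
        ext k
        rw [lintegral_indicator (hmeas k), setLIntegral_const]
    _ ≤ e ^ (-γ) * e + ∑' k : ℕ, (2⁻¹ ^ (k + 1) * e) ^ (-γ) * (2⁻¹ ^ k * e) := by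
        refine add_le_add le_rfl (ENNReal.tsum_le_tsum fun k => mul_le_mul_right ?_ _)
        exact (Measure.restrict_apply_le _ _).trans (hν _)
    _ = (1 + 2 ^ γ * ∑' k : ℕ, ρ ^ k) * e ^ (1 - γ) := by
        simp_rw [hterm]
        rw [ENNReal.tsum_mul_left, add_mul, one_mul, sub_eq_neg_add,
          ENNReal.rpow_add _ _ he0 het, ENNReal.rpow_one]
        ring

/-- The distribution function composed with the function itself: `μ {D(u) < s} ≤ s`, where
`D t = μ {t ≤ u}`. -/
theorem meas_meas_le_lt_le {X : Type*} [MeasurableSpace X] (μ : Measure X) (u : X → ℝ) (s : ℝ≥0∞) :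
    μ {x | μ {y | u x ≤ u y} < s} ≤ s := by
  set J : Set ℝ := {t | μ {y | t ≤ u y} < s} with hJ
  have hup : ∀ a ∈ J, ∀ b, a ≤ b → b ∈ J := fun a ha b hab =>
    lt_of_le_of_lt (measure_mono fun y (hy : b ≤ u y) => hab.trans hy) ha
  by_cases hmin : ∃ a ∈ J, ∀ b ∈ J, a ≤ b
  · obtain ⟨a, ha, hab⟩ := hmin
    exact (measure_mono fun x hx => hab (u x) hx).trans (le_of_lt ha)
  · push Not at hmin
    have hsub : {x | μ {y | u x ≤ u y} < s} ⊆
        ⋃ q ∈ {q : ℚ | (q : ℝ) ∈ J}, {x | (q : ℝ) ≤ u x} := by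
      intro x hx
      obtain ⟨b, hb, hbx⟩ := hmin (u x) hx
      obtain ⟨q, hq1, hq2⟩ := exists_rat_btwn hbx
      exact mem_biUnion (x := q) (hup b hb _ hq1.le) hq2.le
    refine (measure_mono hsub).trans ?_
    rw [measure_biUnion_eq_iSup (to_countable _)]
    · exact iSup₂_le fun q hq => le_of_lt hq
    · intro p hp q hq
      rcases le_total p q with h | h
      · exact ⟨p, hp, le_rfl, fun x (hx : (q : ℝ) ≤ u x) => le_trans (by exact_mod_cast h) hx⟩
      · exact ⟨q, hq, fun x (hx : (p : ℝ) ≤ u x) => le_trans (by exact_mod_cast h) hx, le_rfl⟩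

theorem setLIntegral_Ioi_comp_mul_left {a : ℝ} (ha : 0 < a) (f : ℝ → ℝ≥0∞) :
    ∫⁻ t in Ioi (0 : ℝ), f (a * t) = ENNReal.ofReal a⁻¹ * ∫⁻ t in Ioi (0 : ℝ), f t := by
  have hemb : MeasurableEmbedding (fun t : ℝ => a * t) :=
    (Homeomorph.mulLeft₀ a ha.ne').measurableEmbedding
  have h := hemb.lintegral_map (μ := volume) ((Ioi (0 : ℝ)).indicator f)
  rw [Real.map_volume_mul_left ha.ne', lintegral_smul_measure, lintegral_indicator measurableSet_Ioi,
    abs_of_pos (inv_pos.2 ha)] at h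
  rw [smul_eq_mul] at h
  rw [h, ← lintegral_indicator measurableSet_Ioi]
  congr 1
  ext t
  simp only [indicator, mem_Ioi, mul_pos_iff_of_pos_left ha]

theorem exists_dual_family_lt {F : Type*} [NormedAddCommGroup F] [NormedSpace ℝ F]
    [FiniteDimensional ℝ F] :
    ∃ (N : ℕ) (ℓ : Fin N → F →L[ℝ] ℝ), ∀ (y : F) (t : ℝ), 0 < t → t < ‖y‖ → ∃ i, t < |ℓ i y| := by
  set b := Module.finBasis ℝ F
  set K : ℝ := ∑ i, ‖b i‖ with hK
  have hK0 : 0 ≤ K := Finset.sum_nonneg fun i _ => norm_nonneg _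
  refine ⟨_, fun i => K • (LinearMap.toContinuousLinearMap (b.coord i)), fun y t ht hy => ?_⟩
  by_contra! hcon
  have hcoord : ∀ i, K * |b.repr y i| ≤ t := by
    intro i
    have := hcon i
    simpa [abs_mul, abs_of_nonneg hK0] using this
  have hsum : ‖y‖ ≤ ∑ i, |b.repr y i| * ‖b i‖ := by
    conv_lhs => rw [← b.sum_repr y]
    refine (norm_sum_le _ _).trans (Finset.sum_le_sum fun i _ => ?_)
    rw [norm_smul, Real.norm_eq_abs]
  rcases hK0.eq_or_lt with h0 | hpos
  · have hz : ∀ i, ‖b i‖ = 0 := fun i =>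
      (Finset.sum_eq_zero_iff_of_nonneg fun i _ => norm_nonneg (b i)).1 h0.symm i (Finset.mem_univ i)
    simp only [hz, mul_zero, Finset.sum_const_zero] at hsum
    linarith
  · have : ‖y‖ ≤ ∑ i, t / K * ‖b i‖ := hsum.trans <| Finset.sum_le_sum fun i _ => by
      gcongr
      rw [le_div_iff₀ hpos, mul_comm]
      exact hcoord i
    rw [← Finset.mul_sum, ← hK, div_mul_cancel₀ _ hpos.ne'] at this
    linarith

section

variable {E : Type*} [NormedAddCommGroup E] [NormedSpace ℝ E] [MeasurableSpace E] [BorelSpace E]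
  [FiniteDimensional ℝ E] (μ : Measure E) [μ.IsAddHaarMeasure]

open Module

/-- First-order Sobolev–Lorentz inequality `L^{q,1} → L^{q*,1}` with `α = 1 / q`, for the positive
part of a scalar function. -/
theorem exists_lintegral_meas_lt_rpow_le_fderiv (hn : 2 ≤ finrank ℝ E) {α : ℝ}
    (hα : 1 / (finrank ℝ E : ℝ) < α) (hα1 : α < 1) :
    ∃ C : ℝ≥0, ∀ u : E → ℝ, ContDiff ℝ 1 u → HasCompactSupport u →
      ∫⁻ t in Ioi (0 : ℝ), μ {x | t < u x} ^ (α - 1 / (finrank ℝ E : ℝ)) ≤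
        C * ∫⁻ t in Ioi (0 : ℝ), μ {x | t < ‖fderiv ℝ u x‖} ^ α := by
  obtain ⟨C₁, hC₁⟩ := exists_lintegral_mul_meas_lt_rpow_le μ hn
  have hα0 : 0 < α := lt_of_le_of_lt (by positivity) hα
  obtain ⟨C₂, hC₂⟩ := exists_lintegral_rpow_le_of_meas_lt_le (γ := 1 - α) (by linarith) (by linarith)
  refine ⟨C₁ * C₂, fun u hu hsu => ?_⟩
  set θ : ℝ := 1 - 1 / (finrank ℝ E : ℝ) with hθ
  have hum : Measurable u := hu.continuous.measurable
  have hDm : Measurable fun x => ‖fderiv ℝ u x‖ :=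
    (hu.continuous_fderiv one_ne_zero).norm.measurable
  have hGanti : Antitone fun t : ℝ => μ {y | t ≤ u y} := fun s t hst =>
    measure_mono fun x (hx : t ≤ u x) => hst.trans hx
  set w : ℝ → ℝ≥0∞ := fun t => μ {y | t ≤ u y} ^ (-(1 - α)) with hw
  have hwmono : Monotone w := fun s t hst =>
    ENNReal.rpow_le_rpow_of_exponent_nonpos (by linarith) (hGanti hst)
  have hwm : Measurable fun x => w (u x) := hwmono.measurable.comp hum
  have hfin : ∀ t : ℝ, 0 < t → μ {x | t ≤ u x} < ∞ := fun t ht =>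
    lt_of_le_of_lt (measure_mono fun x (hx : t ≤ u x) => subset_tsupport u
      (Function.mem_support.2 (by linarith : 0 < u x).ne')) hsu.isCompact.measure_lt_top
  have hpos : MeasurableSet {x | 0 < u x} := measurableSet_lt measurable_const hum
  calc ∫⁻ t in Ioi (0 : ℝ), μ {x | t < u x} ^ (α - 1 / (finrank ℝ E : ℝ))
      ≤ ∫⁻ t in Ioi (0 : ℝ), w t * μ {x | t < u x} ^ θ := by
        refine lintegral_mono_ae ?_
        filter_upwards [meas_le_ae_eq_meas_lt μ (volume.restrict (Ioi (0 : ℝ))) u,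
          ae_restrict_mem measurableSet_Ioi] with t ht ht0
        rw [hw]
        simp only
        rw [ht]
        rcases eq_or_ne (μ {x | t < u x}) 0 with h0 | h0
        · rw [h0, ENNReal.zero_rpow_of_pos (by linarith)]
          exact zero_le
        · rw [← ENNReal.rpow_add _ _ h0 (ht ▸ (hfin t ht0).ne)]
          apply le_of_eq
          congr 1
          rw [hθ]
          ring
    _ ≤ C₁ * ∫⁻ x in {x | 0 < u x}, w (u x) * ‖fderiv ℝ u x‖ₑ ∂μ := hC₁ u hu hsu w hwmono
    _ = C₁ * ∫⁻ x, ENNReal.ofReal ‖fderiv ℝ u x‖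
          ∂((μ.restrict {x | 0 < u x}).withDensity fun x => w (u x)) := by
        rw [lintegral_withDensity_eq_lintegral_mul _ hwm hDm.ennreal_ofReal]
        simp only [Pi.mul_apply, ofReal_norm]
    _ = C₁ * ∫⁻ t in Ioi (0 : ℝ), ((μ.restrict {x | 0 < u x}).withDensity fun x => w (u x))
          {x | t < ‖fderiv ℝ u x‖} := by
        rw [lintegral_eq_lintegral_meas_lt _ (Filter.Eventually.of_forall fun x => norm_nonneg _)
          hDm.aemeasurable]
    _ ≤ C₁ * ∫⁻ t in Ioi (0 : ℝ), C₂ * μ {x | t < ‖fderiv ℝ u x‖} ^ α := by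
        refine mul_le_mul_right (lintegral_mono fun t => ?_) _
        have hm : MeasurableSet {x | t < ‖fderiv ℝ u x‖} := measurableSet_lt measurable_const hDm
        rw [withDensity_apply _ hm, Measure.restrict_restrict hm]
        have := hC₂ μ (fun x => μ {y | u x ≤ u y}) (hGanti.measurable.comp hum)
          (meas_meas_le_lt_le μ u) _ (hm.inter hpos)
        rw [sub_sub_cancel] at this
        refine this.trans ?_
        gcongr
        exact inter_subset_left
    _ = _ := by
        rw [lintegral_const_mul' _ _ ENNReal.coe_ne_top, ENNReal.coe_mul, mul_assoc]

/-- First-order Sobolev–Lorentz inequality for vector-valued functions. -/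
theorem exists_lintegral_meas_lt_norm_rpow_le_fderiv {F : Type*} [NormedAddCommGroup F]
    [NormedSpace ℝ F] [FiniteDimensional ℝ F] (hn : 2 ≤ finrank ℝ E) {α : ℝ}
    (hα : 1 / (finrank ℝ E : ℝ) < α) (hα1 : α < 1) :
    ∃ C : ℝ≥0, ∀ v : E → F, ContDiff ℝ 1 v → HasCompactSupport v →
      ∫⁻ t in Ioi (0 : ℝ), μ {x | t < ‖v x‖} ^ (α - 1 / (finrank ℝ E : ℝ)) ≤
        C * ∫⁻ t in Ioi (0 : ℝ), μ {x | t < ‖fderiv ℝ v x‖} ^ α := by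
  obtain ⟨C, hC⟩ := exists_lintegral_meas_lt_rpow_le_fderiv μ hn hα hα1
  obtain ⟨N, ℓ, hℓ⟩ := exists_dual_family_lt (F := F)
  set β : ℝ := α - 1 / (finrank ℝ E : ℝ) with hβ
  have hβ0 : 0 < β := by linarith
  have hβ1 : β ≤ 1 := by
    have : 0 ≤ 1 / (finrank ℝ E : ℝ) := by positivity
    linarith
  have hα0 : 0 < α := lt_of_le_of_lt (by positivity) hα
  have hone : ∀ (L : F →L[ℝ] ℝ) (v : E → F), ContDiff ℝ 1 v → HasCompactSupport v →
      ∫⁻ t in Ioi (0 : ℝ), μ {x | t < L (v x)} ^ β ≤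
        C * (ENNReal.ofReal (‖L‖ + 1) * ∫⁻ t in Ioi (0 : ℝ), μ {x | t < ‖fderiv ℝ v x‖} ^ α) := by
    intro L v hv hsv
    have hL : 0 < ‖L‖ + 1 := by positivity
    refine (hC (fun x => L (v x)) (L.contDiff.comp hv)
      (hsv.comp_left (g := L) (map_zero L))).trans (mul_le_mul_right ?_ _)
    have hscale := setLIntegral_Ioi_comp_mul_left (inv_pos.2 hL)
      (fun t => μ {x | t < ‖fderiv ℝ v x‖} ^ α)
    rw [inv_inv] at hscale
    rw [← hscale]
    refine lintegral_mono fun t => ENNReal.rpow_le_rpow (measure_mono fun x hx => ?_) hα0.le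
    have hd : fderiv ℝ (fun x => L (v x)) x = L.comp (fderiv ℝ v x) :=
      (L.hasFDerivAt.comp x (hv.differentiable one_ne_zero x).hasFDerivAt).fderiv
    simp only [mem_ofPred_eq] at hx ⊢
    rw [hd] at hx
    rw [inv_mul_lt_iff₀ hL]
    calc t < _ := hx
      _ ≤ ‖L‖ * ‖fderiv ℝ v x‖ := L.opNorm_comp_le _
      _ ≤ (‖L‖ + 1) * ‖fderiv ℝ v x‖ := by gcongr; linarith
  refine ⟨∑ i, (C * (‖ℓ i‖ + 1).toNNReal + C * (‖ℓ i‖ + 1).toNNReal), fun v hv hsv => ?_⟩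
  have hanti : ∀ L : F →L[ℝ] ℝ, Measurable fun t : ℝ => μ {x | t < L (v x)} ^ β := fun L =>
    Measurable.pow_const (Antitone.measurable fun s t hst =>
      measure_mono fun x (hx : t < L (v x)) => lt_of_le_of_lt hst hx) _
  calc ∫⁻ t in Ioi (0 : ℝ), μ {x | t < ‖v x‖} ^ β
      ≤ ∫⁻ t in Ioi (0 : ℝ), ∑ i, (μ {x | t < ℓ i (v x)} ^ β + μ {x | t < (-ℓ i) (v x)} ^ β) := by
        refine setLIntegral_mono' measurableSet_Ioi fun t ht => ?_
        have hsub : {x | t < ‖v x‖} ⊆ ⋃ i, ({x | t < ℓ i (v x)} ∪ {x | t < (-ℓ i) (v x)}) := by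
          intro x hx
          obtain ⟨i, hi⟩ := hℓ (v x) t ht hx
          refine mem_iUnion.2 ⟨i, ?_⟩
          exact lt_abs.1 hi
        calc μ {x | t < ‖v x‖} ^ β
            ≤ (∑ i, μ ({x | t < ℓ i (v x)} ∪ {x | t < (-ℓ i) (v x)})) ^ β :=
              ENNReal.rpow_le_rpow ((measure_mono hsub).trans (measure_iUnion_fintype_le _ _)) hβ0.le
          _ ≤ ∑ i, μ ({x | t < ℓ i (v x)} ∪ {x | t < (-ℓ i) (v x)}) ^ β :=
              Finset.le_sum_of_subadditive (fun a : ℝ≥0∞ => a ^ β)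
                (by simp [ENNReal.zero_rpow_of_pos hβ0])
                (fun a b => ENNReal.rpow_add_le_add_rpow a b hβ0.le hβ1) _ _
          _ ≤ _ := Finset.sum_le_sum fun i _ =>
              (ENNReal.rpow_le_rpow (measure_union_le _ _) hβ0.le).trans
                (ENNReal.rpow_add_le_add_rpow _ _ hβ0.le hβ1)
    _ = ∑ i, ((∫⁻ t in Ioi (0 : ℝ), μ {x | t < ℓ i (v x)} ^ β) +
          ∫⁻ t in Ioi (0 : ℝ), μ {x | t < (-ℓ i) (v x)} ^ β) := by
        have hmeas : ∀ i ∈ Finset.univ, Measurable fun t : ℝ =>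
            μ {x | t < ℓ i (v x)} ^ β + μ {x | t < (-ℓ i) (v x)} ^ β :=
          fun i _ => (hanti (ℓ i)).add (hanti (-ℓ i))
        rw [lintegral_finsetSum _ hmeas]
        exact Finset.sum_congr rfl fun i _ => lintegral_add_left (hanti _) _
    _ ≤ ∑ i, (C * (ENNReal.ofReal (‖ℓ i‖ + 1) *
            ∫⁻ t in Ioi (0 : ℝ), μ {x | t < ‖fderiv ℝ v x‖} ^ α) +
          C * (ENNReal.ofReal (‖ℓ i‖ + 1) *
            ∫⁻ t in Ioi (0 : ℝ), μ {x | t < ‖fderiv ℝ v x‖} ^ α)) :=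
        Finset.sum_le_sum fun i _ => add_le_add (hone _ v hv hsv)
          (by simpa only [norm_neg] using hone (-ℓ i) v hv hsv)
    _ = _ := by
        rw [ENNReal.ofNNReal_finsetSum, Finset.sum_mul]
        refine Finset.sum_congr rfl fun i _ => ?_
        simp only [ENNReal.coe_add, ENNReal.coe_mul, ENNReal.ofReal]
        ring

/-- Higher-order Sobolev–Lorentz inequality `L^{q,1} → L^{q*,1}`, with `α = 1 / q`. -/
theorem exists_lintegral_meas_lt_abs_rpow_le_iteratedFDeriv (hn : 2 ≤ finrank ℝ E) (m : ℕ) :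
    ∀ α : ℝ, m / (finrank ℝ E : ℝ) < α → α < 1 →
    ∃ C : ℝ≥0, ∀ u : E → ℝ, ContDiff ℝ (⊤ : ℕ∞) u → HasCompactSupport u →
      ∫⁻ t in Ioi (0 : ℝ), μ {x | t < |u x|} ^ (α - m / (finrank ℝ E : ℝ)) ≤
        C * ∫⁻ t in Ioi (0 : ℝ), μ {x | t < ‖iteratedFDeriv ℝ m u x‖} ^ α := by
  induction m with
  | zero =>
    intro α _ _
    exact ⟨1, fun u _ _ => by simp⟩
  | succ m ih =>
    intro α hα hα1
    have hn0 : (0 : ℝ) < finrank ℝ E := by exact_mod_cast (by omega : 0 < finrank ℝ E)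
    have hα' : m / (finrank ℝ E : ℝ) + 1 / (finrank ℝ E : ℝ) < α := by
      rw [← add_div]
      exact_mod_cast hα
    have hm0 : 0 ≤ m / (finrank ℝ E : ℝ) := by positivity
    have h10 : 0 < 1 / (finrank ℝ E : ℝ) := by positivity
    have : FiniteDimensional ℝ (E [×m]→L[ℝ] ℝ) :=
      Module.Finite.of_injective
        (ContinuousMultilinearMap.toMultilinearMapLinear :
          (E [×m]→L[ℝ] ℝ) →ₗ[ℝ] MultilinearMap ℝ (fun _ : Fin m => E) ℝ)
        ContinuousMultilinearMap.toMultilinearMap_injective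
    obtain ⟨C₁, hC₁⟩ := ih (α - 1 / (finrank ℝ E : ℝ)) (by linarith) (by linarith)
    obtain ⟨C₂, hC₂⟩ := exists_lintegral_meas_lt_norm_rpow_le_fderiv
      (F := E [×m]→L[ℝ] ℝ) μ hn (α := α) (by linarith) hα1
    refine ⟨C₁ * C₂, fun u hu hsu => ?_⟩
    have h1 := hC₁ u hu hsu
    have h2 := hC₂ (iteratedFDeriv ℝ m u)
      (hu.iteratedFDeriv_right (m := 1) (i := m) (by exact_mod_cast le_top)) (hsu.iteratedFDeriv m)
    simp only [norm_fderiv_iteratedFDeriv] at h2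
    have hexp : α - ((m + 1 : ℕ) : ℝ) / (finrank ℝ E : ℝ) =
        α - 1 / (finrank ℝ E : ℝ) - m / (finrank ℝ E : ℝ) := by
      push_cast
      ring
    rw [hexp, ENNReal.coe_mul, mul_assoc]
    exact h1.trans (mul_le_mul_right h2 _)

end

/-- A measure with radially nonincreasing density which satisfies the `d`-Frostman condition is
controlled by the power `d / n` of Lebesgue measure. -/
theorem exists_radial_withDensity_le_volume_rpow {n : ℕ} (hn : 0 < n) {d : ℝ} (hd0 : 0 < d)
    {Ω : Set (EuclideanSpace ℝ (Fin n))} (hΩ : IsOpen Ω)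
    {x₀ : EuclideanSpace ℝ (Fin n)} (hx₀ : x₀ ∈ Ω)
    {g : ℝ → ℝ} (hg : AntitoneOn g (Set.Ioi 0))
    {μ : Measure (EuclideanSpace ℝ (Fin n))}
    (hμdef : μ = (volume.restrict Ω).withDensity fun x => ENNReal.ofReal (g ‖x - x₀‖))
    (hfin : IsFiniteMeasure μ)
    (hFrostman : ∃ A : ℝ, ∀ (x : EuclideanSpace ℝ (Fin n)) (r : ℝ), 0 < r →
        μ (Metric.ball x r ∩ Ω) ≤ ENNReal.ofReal (A * r ^ d)) :
    ∃ C : ℝ≥0, ∀ S : Set (EuclideanSpace ℝ (Fin n)), MeasurableSet S →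
      μ S ≤ C * volume S ^ (d / n) := by
  obtain ⟨A, hA⟩ := hFrostman
  obtain ⟨δ, hδ, hball⟩ := Metric.isOpen_iff.1 hΩ x₀ hx₀
  have : Nonempty (Fin n) := ⟨⟨0, hn⟩⟩
  have hn' : (0 : ℝ) < n := by exact_mod_cast hn
  have hdn : 0 < d / n := by positivity
  set V : ℝ≥0∞ := volume (Metric.ball (0 : EuclideanSpace ℝ (Fin n)) 1) with hV
  have hV0 : V ≠ 0 := (Metric.measure_ball_pos _ _ one_pos).ne'
  have hVt : V ≠ ∞ := measure_ball_lt_top.ne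
  have hvol : ∀ r : ℝ, 0 ≤ r → volume (Metric.ball x₀ r) = ENNReal.ofReal (r ^ n) * V := by
    intro r hr
    simpa using Measure.addHaar_ball (volume : Measure (EuclideanSpace ℝ (Fin n))) x₀ hr
  have hpow : ∀ r : ℝ, 0 < r →
      ENNReal.ofReal (r ^ d) = volume (Metric.ball x₀ r) ^ (d / n) * (V ^ (d / n))⁻¹ := by
    intro r hr
    rw [hvol r hr.le, ENNReal.mul_rpow_of_nonneg _ _ hdn.le, mul_assoc, ENNReal.mul_inv_cancel,
      mul_one, ENNReal.ofReal_rpow_of_nonneg (by positivity) hdn.le, ← Real.rpow_natCast,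
      ← Real.rpow_mul hr.le, mul_div_cancel₀ _ hn'.ne']
    · simp [hV0, hVt]
    · exact ENNReal.rpow_ne_top_of_nonneg hdn.le hVt
  have hVinv : (V ^ (d / n))⁻¹ ≠ ∞ := by
    simp [hV0, hVt]
  have hδd : ENNReal.ofReal (δ ^ d) ≠ 0 := by
    simpa using Real.rpow_pos_of_pos hδ d
  set C : ℝ≥0∞ := 1 + 2 * (ENNReal.ofReal A * (V ^ (d / n))⁻¹) +
    μ univ * ((V ^ (d / n))⁻¹ * (ENNReal.ofReal (δ ^ d))⁻¹) with hC
  have hCt : C ≠ ∞ := by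
    refine ENNReal.add_ne_top.2 ⟨ENNReal.add_ne_top.2 ⟨by simp, ?_⟩, ?_⟩
    · exact ENNReal.mul_ne_top (by simp) (ENNReal.mul_ne_top ENNReal.ofReal_ne_top hVinv)
    · exact ENNReal.mul_ne_top (measure_ne_top _ _)
        (ENNReal.mul_ne_top hVinv (ENNReal.inv_ne_top.2 hδd))
  have hC0 : C ≠ 0 := by
    rw [hC, add_assoc]
    exact (lt_of_lt_of_le one_pos le_self_add).ne'
  refine ⟨C.toNNReal, fun S hS => ?_⟩
  rw [ENNReal.coe_toNNReal hCt]
  rcases eq_or_ne (volume S) 0 with hS0 | hS0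
  · have hac : μ ≪ volume := by
      rw [hμdef]
      exact (withDensity_absolutelyContinuous _ _).trans Measure.absolutelyContinuous_restrict
    rw [hac hS0]
    exact zero_le
  rcases eq_or_ne (volume S) ∞ with hSt | hSt
  · rw [hSt, ENNReal.top_rpow_of_pos hdn, ENNReal.mul_top hC0]
    exact le_top
  obtain ⟨r, hr, hrS⟩ : ∃ r : ℝ, 0 < r ∧ volume (Metric.ball x₀ r) = volume S := by
    have hq : 0 < (volume S / V).toReal := ENNReal.toReal_pos
      (ENNReal.div_pos hS0 hVt).ne' (ENNReal.div_ne_top hSt hV0)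
    refine ⟨(volume S / V).toReal ^ ((n : ℝ)⁻¹), Real.rpow_pos_of_pos hq _, ?_⟩
    rw [hvol _ (by positivity), Real.rpow_inv_natCast_pow hq.le hn.ne',
      ENNReal.ofReal_toReal (ENNReal.div_ne_top hSt hV0), ENNReal.div_mul_cancel hV0 hVt]
  rcases le_or_gt r δ with hrδ | hrδ
  · have hsub : Metric.ball x₀ r ⊆ Ω := (Metric.ball_subset_ball hrδ).trans hball
    have hlow : ENNReal.ofReal (g r) * volume S ≤ μ (Metric.ball x₀ r) := by
      rw [hμdef, withDensity_apply _ Metric.isOpen_ball.measurableSet,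
        Measure.restrict_restrict Metric.isOpen_ball.measurableSet, inter_eq_left.2 hsub, ← hrS,
        ← setLIntegral_const]
      refine lintegral_mono_ae ?_
      filter_upwards [ae_restrict_mem Metric.isOpen_ball.measurableSet,
        ae_restrict_of_ae (Measure.ae_ne volume x₀)] with x hx hne
      refine ENNReal.ofReal_le_ofReal (hg ?_ hr ?_)
      · exact norm_pos_iff.2 (sub_ne_zero.2 hne)
      · rw [← dist_eq_norm]
        exact (Metric.mem_ball.1 hx).le
    have hup : μ (S \ Metric.ball x₀ r) ≤ ENNReal.ofReal (g r) * volume S := by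
      have hm : MeasurableSet (S \ Metric.ball x₀ r) := hS.diff Metric.isOpen_ball.measurableSet
      rw [hμdef, withDensity_apply _ hm]
      calc ∫⁻ x in S \ Metric.ball x₀ r, ENNReal.ofReal (g ‖x - x₀‖) ∂(volume.restrict Ω)
          ≤ ∫⁻ _ in S \ Metric.ball x₀ r, ENNReal.ofReal (g r) ∂(volume.restrict Ω) := by
            refine setLIntegral_mono' hm fun x hx => ENNReal.ofReal_le_ofReal ?_
            have hxr : r ≤ ‖x - x₀‖ := by
              rw [← dist_eq_norm]
              exact not_lt.1 fun h => hx.2 (Metric.mem_ball.2 h)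
            exact hg hr (lt_of_lt_of_le hr hxr) hxr
        _ ≤ ENNReal.ofReal (g r) * volume S := by
            rw [setLIntegral_const]
            exact mul_le_mul_right
              ((Measure.restrict_apply_le _ _).trans (measure_mono sdiff_subset)) _
    have hbr : μ (Metric.ball x₀ r) ≤ ENNReal.ofReal A * (V ^ (d / n))⁻¹ * volume S ^ (d / n) := by
      have h := hA x₀ r hr
      rw [inter_eq_left.2 hsub, ENNReal.ofReal_mul' (by positivity), hpow r hr, hrS] at h
      exact h.trans (le_of_eq (by ring))
    calc μ S ≤ μ (Metric.ball x₀ r ∪ S \ Metric.ball x₀ r) :=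
          measure_mono fun x hx => by by_cases h : x ∈ Metric.ball x₀ r <;> simp [h, hx]
      _ ≤ μ (Metric.ball x₀ r) + μ (S \ Metric.ball x₀ r) := measure_union_le _ _
      _ ≤ μ (Metric.ball x₀ r) + μ (Metric.ball x₀ r) :=
          add_le_add le_rfl (hup.trans hlow)
      _ ≤ 2 * (ENNReal.ofReal A * (V ^ (d / n))⁻¹) * volume S ^ (d / n) := by
          rw [← two_mul, mul_assoc]
          gcongr
      _ ≤ C * volume S ^ (d / n) := by
          gcongr
          rw [hC]
          exact le_add_right le_add_self
  · calc μ S ≤ μ univ * 1 := by rw [mul_one]; exact measure_mono (subset_univ _)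
      _ ≤ μ univ * (((V ^ (d / n))⁻¹ * (ENNReal.ofReal (δ ^ d))⁻¹) * volume S ^ (d / n)) := by
          gcongr
          calc (1 : ℝ≥0∞) = ENNReal.ofReal (δ ^ d) * (ENNReal.ofReal (δ ^ d))⁻¹ :=
                (ENNReal.mul_inv_cancel hδd ENNReal.ofReal_ne_top).symm
            _ ≤ ENNReal.ofReal (r ^ d) * (ENNReal.ofReal (δ ^ d))⁻¹ := by
                gcongr
            _ = _ := by
                rw [hpow r hr, hrS]
                ring
      _ = μ univ * ((V ^ (d / n))⁻¹ * (ENNReal.ofReal (δ ^ d))⁻¹) * volume S ^ (d / n) := by ring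
      _ ≤ C * volume S ^ (d / n) := by
          gcongr
          rw [hC]
          exact le_add_self

/-- **Improved endpoint trace embedding for measures with a radially decreasing density**
(`0 < d < n-m`): the Lorentz target `L^{(n-d)/m,1}(Ω,μ)` replaces `L^{(n-d)/m}(Ω,μ)`. -/
theorem endpoint_trace_radial (n m : ℕ) (hn : 2 ≤ n) (hm : 1 ≤ m) (hmn : m < n)
    (d : ℝ) (hd0 : 0 < d) (hd : d < (n : ℝ) - m)
    (Ω : Set (EuclideanSpace ℝ (Fin n))) (hΩ : IsOpen Ω) (hΩvol : volume Ω < ⊤)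
    (x₀ : EuclideanSpace ℝ (Fin n)) (hx₀ : x₀ ∈ Ω)
    (g : ℝ → ℝ) (hgm : Measurable g) (hg : AntitoneOn g (Set.Ioi 0))
    (hgnn : ∀ t : ℝ, 0 < t → 0 ≤ g t)
    (μ : Measure (EuclideanSpace ℝ (Fin n)))
    (hμdef : μ = (volume.restrict Ω).withDensity fun x => ENNReal.ofReal (g ‖x - x₀‖))
    (hfin : IsFiniteMeasure μ)
    (hFrostman : ∃ A : ℝ, ∀ (x : EuclideanSpace ℝ (Fin n)) (r : ℝ), 0 < r →
        μ (Metric.ball x r ∩ Ω) ≤ ENNReal.ofReal (A * r ^ d)) :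
    ∃ C : ℝ, 0 < C ∧
      ∀ u : EuclideanSpace ℝ (Fin n) → ℝ, ContDiff ℝ (⊤ : ℕ∞) u → HasCompactSupport u →
        tsupport u ⊆ Ω →
        (∫⁻ lam in Set.Ioi (0 : ℝ),
            (μ {x | x ∈ Ω ∧ lam < |u x|}) ^ ((m : ℝ) / ((n : ℝ) - d))) ≤
          ENNReal.ofReal C *
            ∫⁻ lam in Set.Ioi (0 : ℝ),
              (volume {x | x ∈ Ω ∧ lam < ‖iteratedFDeriv ℝ m u x‖}) ^
                ((m : ℝ) / ((n : ℝ) - d)) := by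
  have hn0 : (0 : ℝ) < n := by exact_mod_cast (by omega : 0 < n)
  have hm0 : (0 : ℝ) < m := by exact_mod_cast hm
  have hmn' : (0 : ℝ) < n - d := by linarith
  have hα0 : 0 < (m : ℝ) / (n - d) := by positivity
  obtain ⟨C₁, hC₁⟩ := exists_radial_withDensity_le_volume_rpow (by omega) hd0 hΩ hx₀ hg hμdef hfin
    hFrostman
  obtain ⟨C₂, hC₂⟩ := exists_lintegral_meas_lt_abs_rpow_le_iteratedFDeriv
    (volume : Measure (EuclideanSpace ℝ (Fin n))) (by simpa using hn) m ((m : ℝ) / (n - d))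
    (by
      rw [finrank_euclideanSpace_fin]
      exact div_lt_div_of_pos_left hm0 hmn' (by linarith))
    (by rw [div_lt_one hmn']; linarith)
  simp only [finrank_euclideanSpace_fin] at hC₂
  refine ⟨C₁ ^ ((m : ℝ) / (n - d)) * C₂ + 1, by positivity, fun u hu hsu hsuΩ => ?_⟩
  have hexp : d / n * ((m : ℝ) / (n - d)) = (m : ℝ) / (n - d) - m / n := by
    field_simp
    ring
  have hmeas : ∀ t : ℝ, MeasurableSet {x | t < |u x|} := fun t =>
    measurableSet_lt measurable_const hu.continuous.abs.measurable
  have hsupp : ∀ t ∈ Ioi (0 : ℝ), {x | t < ‖iteratedFDeriv ℝ m u x‖} ⊆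
      {x | x ∈ Ω ∧ t < ‖iteratedFDeriv ℝ m u x‖} := fun t ht x hx =>
    ⟨hsuΩ (support_iteratedFDeriv_subset m (Function.mem_support.2
      (norm_pos_iff.1 (lt_trans ht hx)))), hx⟩
  calc ∫⁻ t in Ioi (0 : ℝ), μ {x | x ∈ Ω ∧ t < |u x|} ^ ((m : ℝ) / (n - d))
      ≤ ∫⁻ t in Ioi (0 : ℝ), (C₁ : ℝ≥0∞) ^ ((m : ℝ) / (n - d)) *
          volume {x | t < |u x|} ^ ((m : ℝ) / (n - d) - m / n) := by
        refine lintegral_mono fun t => ?_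
        rw [← hexp, ENNReal.rpow_mul, ← ENNReal.mul_rpow_of_nonneg _ _ hα0.le]
        exact ENNReal.rpow_le_rpow ((measure_mono fun x hx => hx.2).trans (hC₁ _ (hmeas t))) hα0.le
    _ = (C₁ : ℝ≥0∞) ^ ((m : ℝ) / (n - d)) *
          ∫⁻ t in Ioi (0 : ℝ), volume {x | t < |u x|} ^ ((m : ℝ) / (n - d) - m / n) :=
        lintegral_const_mul' _ _ (ENNReal.rpow_ne_top_of_nonneg hα0.le ENNReal.coe_ne_top)
    _ ≤ (C₁ : ℝ≥0∞) ^ ((m : ℝ) / (n - d)) * (C₂ *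
          ∫⁻ t in Ioi (0 : ℝ), volume {x | t < ‖iteratedFDeriv ℝ m u x‖} ^ ((m : ℝ) / (n - d))) :=
        mul_le_mul_right (hC₂ u hu hsu) _
    _ ≤ (C₁ : ℝ≥0∞) ^ ((m : ℝ) / (n - d)) * (C₂ *
          ∫⁻ t in Ioi (0 : ℝ), volume {x | x ∈ Ω ∧ t < ‖iteratedFDeriv ℝ m u x‖} ^
            ((m : ℝ) / (n - d))) := by
        refine mul_le_mul_right (mul_le_mul_right
          (setLIntegral_mono' measurableSet_Ioi fun t ht => ?_) _) _
        exact ENNReal.rpow_le_rpow (measure_mono (hsupp t ht)) hα0.le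
    _ ≤ _ := by
        rw [← mul_assoc]
        gcongr
        rw [← ENNReal.coe_rpow_of_nonneg _ hα0.le, ← ENNReal.coe_mul, ← ENNReal.ofReal_coe_nnreal]
        refine ENNReal.ofReal_le_ofReal ?_
        push_cast
        linarith
end
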